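/- Let 𝒜 be a homogeneous constant-coefficient differential operator of order k on ℝ^n and let 1 ≤ j ≤ min{k, n}. Then 𝒜 is elliptic if and only if for every u ∈ BV^𝒜_loc(ℝ^n), D^{k−j}u ∈ t^{j,(n/(n−j),∞)}(x) for ℒ^n-almost every x ∈ ℝ^n (with the convention n/0 = ∞, the case j = n being interpreted in the Bennett–DeVore–Sharpley weak-L^∞ space L^{∞,∞}). -/

import Mathlib

open MeasureTheory Metric Filter
open scoped ENNReal RealInnerProductSpace Topology

noncomputable section

/-- Euclidean space `ℝ^n`. -/
abbrev Euc (n : ℕ) : Type := EuclideanSpace ℝ (Fin n)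

/-- The `i`-th standard basis vector of `ℝ^n`. -/
def stdVec (n : ℕ) (i : Fin n) : Euc n := EuclideanSpace.single i (1 : ℝ)

/-- Coefficients `A_I : V →ₗ W` (indexed by `I : Fin k → Fin n`) of a homogeneous linear
constant-coefficient differential operator `𝒜 u = ∑_I A_I ∂_I u` of order `k` on `ℝ^n`. -/
abbrev CoeffOp (n k : ℕ) (V W : Type*) [NormedAddCommGroup V] [InnerProductSpace ℝ V]
    [NormedAddCommGroup W] [InnerProductSpace ℝ W] : Type _ :=
  (Fin k → Fin n) → (V →ₗ[ℝ] W)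

variable {V W F : Type*}
  [NormedAddCommGroup V] [InnerProductSpace ℝ V] [FiniteDimensional ℝ V]
  [NormedAddCommGroup W] [InnerProductSpace ℝ W] [FiniteDimensional ℝ W]

/-- The coefficients represent a linear map on symmetric tensors `V ⊙^k ℝ^n`. -/
def IsSymmetricOp (n k : ℕ) (A : CoeffOp n k V W) : Prop :=
  ∀ (I : Fin k → Fin n) (σ : Equiv.Perm (Fin k)), A (I ∘ σ) = A I

/-- The symbol `𝒜[ξ] v = A (v ⊗^k ξ) = ∑_I (∏ i, ξ_{I i}) A_I v`. -/
def symbolMap (n k : ℕ) (A : CoeffOp n k V W) (ξ : Euc n) : V →ₗ[ℝ] W :=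
  ∑ I : Fin k → Fin n, (∏ i, ξ (I i)) • A I

/-- Ellipticity: the symbol is injective for all `ξ ≠ 0`. -/
def IsElliptic (n k : ℕ) (A : CoeffOp n k V W) : Prop :=
  ∀ ξ : Euc n, ξ ≠ 0 → Function.Injective (symbolMap n k A ξ)

/-- Van Schaftingen's cancellation condition: `⋂_{ξ ∈ 𝕊^{n-1}} im 𝒜[ξ] = {0}`. -/
def IsCanceling (n k : ℕ) (A : CoeffOp n k V W) : Prop :=
  (⋂ ξ ∈ sphere (0 : Euc n) 1, (LinearMap.range (symbolMap n k A ξ) : Set W)) = {0}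

/-- Inverse of an endomorphism (junk value when not invertible), via matrix inversion. -/
def linInv (f : V →ₗ[ℝ] V) : V →ₗ[ℝ] V :=
  letI b := Module.finBasis ℝ V
  Matrix.toLin b b ((LinearMap.toMatrix b b f)⁻¹)

/-- `𝒜†[ξ] = (𝒜*[ξ] 𝒜[ξ])⁻¹ 𝒜*[ξ]`. -/
def Adagger (n k : ℕ) (A : CoeffOp n k V W) (ξ : Euc n) : W →ₗ[ℝ] V :=
  linInv (LinearMap.adjoint (symbolMap n k A ξ) ∘ₗ symbolMap n k A ξ) ∘ₗ
    LinearMap.adjoint (symbolMap n k A ξ)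

/-- Condition (WC): for every `w ∈ ⋂_{ξ ∈ 𝕊^{n-1}} im 𝒜[ξ]`,
`∫_{𝕊^{n-1}} 𝒜†[ξ] w ⊗^{k-n} ξ dℋ^{n-1}(ξ) = 0`, written componentwise in the
tensor coordinates indexed by `J : Fin (k-n) → Fin n`. -/
def IsWeaklyCanceling (n k : ℕ) (A : CoeffOp n k V W) : Prop :=
  ∀ w : W, (∀ ξ ∈ sphere (0 : Euc n) 1, w ∈ LinearMap.range (symbolMap n k A ξ)) →
    ∀ J : Fin (k - n) → Fin n,
      (∫ ξ in sphere (0 : Euc n) 1,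
        (∏ i, ξ (J i)) • (Adagger n k A ξ w) ∂(μH[(n : ℝ) - 1])) = 0

section TestFun

variable [NormedAddCommGroup F] [NormedSpace ℝ F]

/-- Compactly supported smooth test function. -/
def IsTestFun (n : ℕ) (φ : Euc n → F) : Prop :=
  ContDiff ℝ (⊤ : ℕ∞) φ ∧ HasCompactSupport φ

/-- Iterated directional derivative `∂_{I 0} ⋯ ∂_{I (m-1)} φ (x)`. -/
def dirDeriv (n m : ℕ) (I : Fin m → Fin n) (φ : Euc n → F) (x : Euc n) : F :=
  iteratedFDeriv ℝ m φ x (fun i => stdVec n (I i))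

/-- Smooth functions of degree-`≤ j` polynomial type. -/
def IsPolyDeg (n : ℕ) (j : ℕ) (P : Euc n → F) : Prop :=
  ContDiff ℝ (⊤ : ℕ∞) P ∧ ∀ x, iteratedFDeriv ℝ (j + 1) P x = 0

end TestFun

/-- Pointwise application of the operator `𝒜` to a smooth map. -/
def Aapply (n k : ℕ) (A : CoeffOp n k V W) (u : Euc n → V) (x : Euc n) : W :=
  ∑ I : Fin k → Fin n, A I (dirDeriv n k I u x)

/-- `𝒜 u = f σ` (a `W`-valued measure with total-variation measure `σ` and polar density `f`)
in the sense of distributions. -/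
def HasDistribA (n k : ℕ) (A : CoeffOp n k V W) (u : Euc n → V) (σ : Measure (Euc n))
    (f : Euc n → W) : Prop :=
  ∀ φ : Euc n → W, IsTestFun n φ →
    ((-1 : ℝ) ^ k) * (∑ I : Fin k → Fin n,
        ∫ x, ⟪u x, LinearMap.adjoint (A I) (dirDeriv n k I φ x)⟫) =
      ∫ x, ⟪f x, φ x⟫ ∂σ

/-- `u ∈ BV^𝒜_loc(ℝ^n)`: `u` is locally integrable and `𝒜 u` is a `W`-valued Radon measure,
given by its polar decomposition `f σ` with `σ` locally finite and `‖f‖ = 1` σ-a.e. -/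
def MemBVAloc (n k : ℕ) (A : CoeffOp n k V W) (u : Euc n → V) : Prop :=
  LocallyIntegrable u volume ∧
    ∃ (σ : Measure (Euc n)) (f : Euc n → W), IsLocallyFiniteMeasure σ ∧
      LocallyIntegrable f σ ∧ (∀ᵐ x ∂σ, ‖f x‖ = 1) ∧ HasDistribA n k A u σ f

/-- `v` is the family of weak derivatives of order `m` of `u` (componentwise, indexed by
`I : Fin m → Fin n`). -/
def IsWeakDerivFamily (n m : ℕ) (u : Euc n → V) (v : (Fin m → Fin n) → Euc n → V) : Prop :=
  (∀ I, LocallyIntegrable (v I) volume) ∧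
    ∀ (I : Fin m → Fin n) (φ : Euc n → ℝ), IsTestFun n φ →
      ∫ x, (dirDeriv n m I φ x) • u x = ((-1 : ℝ) ^ m) • ∫ x, φ x • v I x

/-- `Q r = o(r^a)` as `r ↓ 0`. -/
def SmallO (Q : ℝ → ℝ≥0∞) (a : ℝ) : Prop :=
  Tendsto (fun r => Q r / ENNReal.ofReal (r ^ a)) (𝓝[>] (0 : ℝ)) (𝓝 0)

section Spaces

variable [NormedAddCommGroup F] [NormedSpace ℝ F]

/-- `f ∈ t^{j,p}(x)`: there is a polynomial `P` of degree at most `j` with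
`(⨍_{B_r(x)} |f - P|^p)^{1/p} = o(r^j)` as `r ↓ 0`. -/
def MemT (n : ℕ) (j : ℕ) (p : ℝ) (f : Euc n → F) (x : Euc n) : Prop :=
  ∃ P : Euc n → F, IsPolyDeg n j P ∧
    SmallO (fun r => ((volume (ball x r))⁻¹ *
      ∫⁻ y in ball x r, (‖f y - P y‖₊ : ℝ≥0∞) ^ p) ^ (1 / p)) (j : ℝ)

/-- `f ∈ t^{j,∞}(x)`: there is a polynomial `P` of degree at most `j` with
`‖f - P‖_{L^∞(B_r(x))} = o(r^j)` as `r ↓ 0`. -/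
def MemTInf (n : ℕ) (j : ℕ) (f : Euc n → F) (x : Euc n) : Prop :=
  ∃ P : Euc n → F, IsPolyDeg n j P ∧
    SmallO (fun r => essSup (fun y => (‖f y - P y‖₊ : ℝ≥0∞))
      (volume.restrict (ball x r))) (j : ℝ)

/-- The Lorentz `L^{p,q}` quasi-norm (for `p, q < ∞`). -/
def lorentzNorm {α : Type*} [MeasurableSpace α] (p q : ℝ) (μ : Measure α) (f : α → F) : ℝ≥0∞ :=
  ENNReal.ofReal p ^ (1 / q) *
    (∫⁻ t in Set.Ioi (0 : ℝ),
      (ENNReal.ofReal t * (μ {x | t < ‖f x‖}) ^ (1 / p)) ^ q * (ENNReal.ofReal t)⁻¹) ^ (1 / q)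

/-- `f` is `L^{p,q}`-differentiable of order `j` at `x`:
`‖f - P‖_{L^{p,q}(B_r(x))} = o(r^{j + n/p})` for a polynomial `P` of degree at most `j`. -/
def MemTLorentz (n : ℕ) (j : ℕ) (p q : ℝ) (f : Euc n → F) (x : Euc n) : Prop :=
  ∃ P : Euc n → F, IsPolyDeg n j P ∧
    SmallO (fun r => lorentzNorm p q (volume.restrict (ball x r)) (fun y => f y - P y))
      ((j : ℝ) + n / p)

/-- `f ∈ L^p_loc`. -/
def LocLp (n : ℕ) (p : ℝ) (f : Euc n → F) : Prop :=
  ∀ K : Set (Euc n), IsCompact K → ∫⁻ x in K, (‖f x‖₊ : ℝ≥0∞) ^ p < ⊤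

end Spaces

end

noncomputable section

variable {α F : Type*} [MeasurableSpace α] [NormedAddCommGroup F]

/-- The weak-`L^p` (Lorentz `L^{p,∞}`) quasi-norm, `p < ∞`. -/
def weakLpNorm (p : ℝ) (μ : Measure α) (f : α → F) : ℝ≥0∞ :=
  ⨆ (t : ℝ) (_ : 0 < t), ENNReal.ofReal t * (μ {x | t < ‖f x‖}) ^ (1 / p)

/-- The decreasing rearrangement `f^*`. -/
def rearr (μ : Measure α) (f : α → F) (t : ℝ) : ℝ≥0∞ :=
  sInf {l : ℝ≥0∞ | μ {x | l < (‖f x‖₊ : ℝ≥0∞)} ≤ ENNReal.ofReal t}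

/-- The maximal function `f^{**}(t) = t⁻¹ ∫_0^t f^*`. -/
def rearrStar2 (μ : Measure α) (f : α → F) (t : ℝ) : ℝ≥0∞ :=
  (ENNReal.ofReal t)⁻¹ * ∫⁻ s in Set.Ioc (0 : ℝ) t, rearr μ f s

/-- The Bennett–DeVore–Sharpley weak-`L^∞` quasi-norm `sup_{0<t<μ(univ)} (f^{**}(t) - f^*(t))`. -/
def weakLInftyNorm (μ : Measure α) (f : α → F) : ℝ≥0∞ :=
  ⨆ (t : ℝ) (_ : 0 < t) (_ : ENNReal.ofReal t < μ Set.univ),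
    (rearrStar2 μ f t - rearr μ f t)

/-- `f ∈ t^{j,(p,∞)}(x)` for `p < ∞`. -/
def MemTWeakLp {F : Type*} [NormedAddCommGroup F] [NormedSpace ℝ F]
    (n : ℕ) (j : ℕ) (p : ℝ) (f : Euc n → F) (x : Euc n) : Prop :=
  ∃ P : Euc n → F, IsPolyDeg n j P ∧
    SmallO (fun r => weakLpNorm p (volume.restrict (ball x r)) (fun y => f y - P y))
      ((j : ℝ) + n / p)

/-- `f ∈ t^{j,(∞,∞)}(x)`, with the Bennett–DeVore–Sharpley weak-`L^∞` quasi-norm. -/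
def MemTWeakLinfty {F : Type*} [NormedAddCommGroup F] [NormedSpace ℝ F]
    (n : ℕ) (j : ℕ) (f : Euc n → F) (x : Euc n) : Prop :=
  ∃ P : Euc n → F, IsPolyDeg n j P ∧
    SmallO (fun r => weakLInftyNorm (volume.restrict (ball x r)) (fun y => f y - P y)) (j : ℝ)

end

set_option linter.unusedSectionVars false

open scoped FourierTransform SchwartzMap ContDiff

noncomputable section SymbolKernel

variable {V W : Type*}
  [NormedAddCommGroup V] [InnerProductSpace ℝ V] [FiniteDimensional ℝ V]
  [NormedAddCommGroup W] [InnerProductSpace ℝ W] [FiniteDimensional ℝ W]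

/-- The symbol as a continuous linear map. -/
def symbolCLM (n k : ℕ) (A : CoeffOp n k V W) (ξ : Euc n) : V →L[ℝ] W :=
  ∑ I : Fin k → Fin n, (∏ i, ξ (I i)) • LinearMap.toContinuousLinearMap (A I)

lemma symbolCLM_apply (n k : ℕ) (A : CoeffOp n k V W) (ξ : Euc n) (v : V) :
    symbolCLM n k A ξ v = symbolMap n k A ξ v := by
  simp [symbolCLM, symbolMap, LinearMap.sum_apply]

lemma contDiff_symbolCLM (n k : ℕ) (A : CoeffOp n k V W) :
    ContDiff ℝ ∞ (symbolCLM n k A) := by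
  unfold symbolCLM
  refine ContDiff.sum fun I _ => ?_
  have : ContDiff ℝ ∞ fun ξ : Euc n => ∏ i, ξ (I i) :=
    contDiff_prod fun i _ => (EuclideanSpace.proj (𝕜 := ℝ) (I i)).contDiff
  exact this.smul contDiff_const

/-- The left inverse `(𝒜*𝒜)⁻¹𝒜*` of the symbol. -/
def symbolLeftInv (n k : ℕ) (A : CoeffOp n k V W) (ξ : Euc n) : W →L[ℝ] V :=
  Ring.inverse ((ContinuousLinearMap.adjoint (symbolCLM n k A ξ)) ∘L symbolCLM n k A ξ) ∘L
    ContinuousLinearMap.adjoint (symbolCLM n k A ξ)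

lemma isUnit_adjoint_comp_self {T : V →L[ℝ] W} (hT : Function.Injective T) :
    IsUnit ((ContinuousLinearMap.adjoint T) ∘L T) := by
  have hinj : Function.Injective ((ContinuousLinearMap.adjoint T) ∘L T) := by
    rw [injective_iff_map_eq_zero]
    intro v hv
    have h1 : ⟪(ContinuousLinearMap.adjoint T) (T v), v⟫ = 0 := by
      have : (ContinuousLinearMap.adjoint T) (T v) = 0 := hv
      rw [this, inner_zero_left]
    rw [ContinuousLinearMap.adjoint_inner_left] at h1
    exact hT (by simpa using h1)
  rw [ContinuousLinearMap.isUnit_iff_bijective]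
  exact ⟨hinj, LinearMap.surjective_of_injective (f := ((ContinuousLinearMap.adjoint T) ∘L T :
    V →L[ℝ] V).toLinearMap) hinj⟩

lemma symbolLeftInv_comp {n k : ℕ} {A : CoeffOp n k V W} (hA : IsElliptic n k A) {ξ : Euc n}
    (hξ : ξ ≠ 0) : symbolLeftInv n k A ξ ∘L symbolCLM n k A ξ = ContinuousLinearMap.id ℝ V := by
  have hT : Function.Injective (symbolCLM n k A ξ) := by
    intro a b h
    rw [symbolCLM_apply, symbolCLM_apply] at h
    exact hA ξ hξ h
  have := Ring.inverse_mul_cancel _ (isUnit_adjoint_comp_self hT)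
  rw [symbolLeftInv, ContinuousLinearMap.comp_assoc]
  exact this

lemma contDiffAt_symbolLeftInv {n k : ℕ} {A : CoeffOp n k V W} (hA : IsElliptic n k A) {ξ : Euc n}
    (hξ : ξ ≠ 0) : ContDiffAt ℝ ∞ (symbolLeftInv n k A) ξ := by
  have hT : Function.Injective (symbolCLM n k A ξ) := by
    intro a b h
    rw [symbolCLM_apply, symbolCLM_apply] at h
    exact hA ξ hξ h
  have hs := (contDiff_symbolCLM n k A).contDiffAt (x := ξ)
  have hadj : ContDiffAt ℝ ∞ (fun ξ => ContinuousLinearMap.adjoint (symbolCLM n k A ξ)) ξ :=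
    (ContinuousLinearMap.adjoint (𝕜 := ℝ) (E := V) (F := W)).contDiff.contDiffAt.comp ξ hs
  have hc : ContDiffAt ℝ ∞ (fun ξ => (ContinuousLinearMap.adjoint (symbolCLM n k A ξ)) ∘L
      symbolCLM n k A ξ) ξ := hadj.clm_comp hs
  obtain ⟨u, hu⟩ := isUnit_adjoint_comp_self hT
  refine ContDiffAt.clm_comp ?_ hadj
  have h1 := contDiffAt_ringInverse ℝ (n := ∞) u
  rw [hu] at h1
  exact h1.comp ξ hc

end SymbolKernel

noncomputable section FourierKernel

variable {V W : Type*}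
  [NormedAddCommGroup V] [InnerProductSpace ℝ V] [FiniteDimensional ℝ V]
  [NormedAddCommGroup W] [InnerProductSpace ℝ W] [FiniteDimensional ℝ W]

/-- The embedding of a real inner product space in a complexification. -/
def complexEmb (V : Type*) [NormedAddCommGroup V] [InnerProductSpace ℝ V] :
    V →L[ℝ] (V →L[ℝ] ℂ) :=
  (ContinuousLinearMap.compL ℝ V ℝ ℂ Complex.ofRealCLM) ∘L innerSL ℝ

/-- The real part in the complexification. -/
def complexRe (V : Type*) [NormedAddCommGroup V] [InnerProductSpace ℝ V] [FiniteDimensional ℝ V] :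
    (V →L[ℝ] ℂ) →L[ℝ] V :=
  ((InnerProductSpace.toDual ℝ V).symm.toContinuousLinearEquiv.toContinuousLinearMap) ∘L
    (ContinuousLinearMap.compL ℝ V ℂ ℝ Complex.reCLM)

lemma complexRe_smul_complexEmb (c : ℂ) (v : V) : complexRe V (c • complexEmb V v) = c.re • v := by
  have : (ContinuousLinearMap.compL ℝ V ℂ ℝ Complex.reCLM) (c • complexEmb V v) =
      InnerProductSpace.toDual ℝ V (c.re • v) := by
    ext w
    simp [complexEmb]
    exact Or.inl rfl
  simp only [complexRe, ContinuousLinearMap.comp_apply]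
  rw [this]
  simp

lemma dirDeriv_clm_comp {F G : Type*} [NormedAddCommGroup F] [NormedSpace ℝ F]
    [NormedAddCommGroup G] [NormedSpace ℝ G] {n m : ℕ} (I : Fin m → Fin n) (L : F →L[ℝ] G)
    {f : Euc n → F} {x : Euc n} (hf : ContDiffAt ℝ m f x) :
    dirDeriv n m I (fun y => L (f y)) x = L (dirDeriv n m I f x) := by
  have := L.iteratedFDeriv_comp_left hf (i := m) le_rfl
  simp only [dirDeriv]
  change iteratedFDeriv ℝ m (L ∘ f) x _ = _
  rw [this]
  rfl

lemma dirDeriv_fourier {E : Type*} [NormedAddCommGroup E] [NormedSpace ℂ E]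
    {n m : ℕ} (I : Fin m → Fin n) (f : 𝓢(Euc n, E)) (x : Euc n) :
    dirDeriv n m I (𝓕 (f : Euc n → E)) x =
      𝓕 (fun ξ => (-(2 * Real.pi * Complex.I)) ^ m • (∏ i, ξ (I i)) • f ξ) x := by
  have hInt : ∀ (l : ℕ), (l : ℕ∞) ≤ ⊤ → Integrable (fun v => ‖v‖ ^ l * ‖f v‖) := by
    intro l _
    exact f.integrable_pow_mul volume l
  have h := Real.iteratedFDeriv_fourier (N := ⊤) (f := (f : Euc n → E)) hInt
    f.continuous.aestronglyMeasurable (n := m) le_top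
  rw [dirDeriv, h]
  rw [Real.fourier_continuousMultilinearMap_apply]
  · have he : (fun ξ : Euc n => VectorFourier.fourierPowSMulRight (innerSL ℝ) f ξ m
        fun i => stdVec n (I i)) =
        fun ξ => (-(2 * Real.pi * Complex.I)) ^ m • (∏ i, ξ (I i)) • f ξ := by
      funext ξ
      have hi : ∀ i, innerSL ℝ ξ (EuclideanSpace.single (I i) (1 : ℝ)) = ξ (I i) := fun i => by
        change ⟪ξ, EuclideanSpace.single (I i) (1 : ℝ)⟫ = _
        simp [EuclideanSpace.inner_single_right]
      simp [VectorFourier.fourierPowSMulRight_apply, stdVec, hi]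
    rw [he]
  · refine (VectorFourier.integrable_fourierPowSMulRight _ (hInt m le_top)
      f.continuous.aestronglyMeasurable)

lemma dirDeriv_clm_fourier {E G : Type*} [NormedAddCommGroup E] [NormedSpace ℂ E]
    [NormedAddCommGroup G] [NormedSpace ℝ G]
    {n m : ℕ} (I : Fin m → Fin n) (ρ : E →L[ℝ] G) (f : 𝓢(Euc n, E)) (x : Euc n) :
    dirDeriv n m I (fun y => ρ (𝓕 f y)) x =
      ρ (𝓕 (fun ξ => (-(2 * Real.pi * Complex.I)) ^ m • (∏ i, ξ (I i)) • f ξ) x) := by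
  have h1 := dirDeriv_clm_comp (n := n) I ρ (f := fun y => 𝓕 f y) (x := x)
    ((𝓕 f).smooth _).contDiffAt
  rw [h1, ← dirDeriv_fourier]
  rfl

lemma integrable_prod_coord_smul {E : Type*} [NormedAddCommGroup E] [NormedSpace ℂ E]
    {n m : ℕ} (I : Fin m → Fin n) {f : Euc n → E} (hf : Continuous f) (hc : HasCompactSupport f)
    (c : ℂ) : Integrable (fun ξ => c • (∏ i, ξ (I i)) • f ξ) := by
  refine Continuous.integrable_of_hasCompactSupport ?_ ?_
  · have : Continuous fun ξ : Euc n => ∏ i, ξ (I i) :=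
      continuous_finsetProd _ fun i _ => (EuclideanSpace.proj (𝕜 := ℝ) (I i)).continuous
    exact (this.smul hf).const_smul c
  · refine hc.mono fun ξ hξ => ?_
    rw [Function.mem_support] at hξ ⊢
    intro h
    exact hξ (by rw [h, smul_zero, smul_zero])

/-- The low frequency cutoff. -/
def freqBump (n : ℕ) : ContDiffBump (0 : Euc n) := ⟨1, 2, one_pos, one_lt_two⟩

/-- The annular frequency cutoff. -/
def freqAnn (n : ℕ) (ξ : Euc n) : ℝ := freqBump n ((2 : ℝ)⁻¹ • ξ) - freqBump n ξ

lemma freqAnn_eq_zero_of_norm_le {n : ℕ} {ξ : Euc n} (h : ‖ξ‖ ≤ 1) : freqAnn n ξ = 0 := by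
  have h1 : freqBump n ξ = 1 := (freqBump n).one_of_mem_closedBall (by simpa [freqBump] using h)
  have h2 : freqBump n ((2 : ℝ)⁻¹ • ξ) = 1 := (freqBump n).one_of_mem_closedBall (by
    simp [freqBump, norm_smul]; linarith)
  rw [freqAnn, h1, h2, sub_self]

lemma contDiff_freqAnn (n : ℕ) : ContDiff ℝ ∞ (freqAnn n) := by
  unfold freqAnn
  exact ((freqBump n).contDiff.comp (contDiff_const_smul _)).sub (freqBump n).contDiff

lemma hasCompactSupport_freqAnn (n : ℕ) : HasCompactSupport (freqAnn n) := by
  refine HasCompactSupport.intro (isCompact_closedBall (0 : Euc n) 4) fun ξ hξ => ?_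
  have hξ' : 4 < ‖ξ‖ := by simpa using hξ
  have h1 : freqBump n ξ = 0 := (freqBump n).zero_of_le_dist (by simp [freqBump]; linarith)
  have h2 : freqBump n ((2 : ℝ)⁻¹ • ξ) = 0 := (freqBump n).zero_of_le_dist (by
    simp [freqBump, norm_smul]; linarith)
  rw [freqAnn, h1, h2, sub_self]

lemma contDiff_freqAnn_smul_symbolLeftInv {n k : ℕ} {A : CoeffOp n k V W}
    (hA : IsElliptic n k A) :
    ContDiff ℝ ∞ fun ξ => freqAnn n ξ • symbolLeftInv n k A ξ := by
  rw [contDiff_iff_contDiffAt]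
  intro ξ
  by_cases hξ : ξ = 0
  · have : (fun ξ => freqAnn n ξ • symbolLeftInv n k A ξ) =ᶠ[𝓝 ξ] fun _ => 0 := by
      subst hξ
      filter_upwards [Metric.ball_mem_nhds (0 : Euc n) one_pos] with y hy
      rw [freqAnn_eq_zero_of_norm_le (by simpa using (mem_ball_zero_iff.1 hy).le), zero_smul]
    exact contDiffAt_const.congr_of_eventuallyEq this
  · exact (contDiff_freqAnn n).contDiffAt.smul (contDiffAt_symbolLeftInv hA hξ)

/-- Low frequency cutoff as a complex Schwartz function. -/
def freqBumpSchwartz (n : ℕ) : 𝓢(Euc n, ℂ) :=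
  HasCompactSupport.toSchwartzMap (f := fun ξ : Euc n => ((freqBump n ξ : ℝ) : ℂ))
    ((freqBump n).hasCompactSupport.comp_left (g := fun r : ℝ => (r : ℂ)) Complex.ofReal_zero)
    (Complex.ofRealCLM.contDiff.comp (freqBump n).contDiff)

lemma freqBumpSchwartz_apply {n : ℕ} (ξ : Euc n) :
    freqBumpSchwartz n ξ = ((freqBump n ξ : ℝ) : ℂ) := rfl

lemma fourier_freqAnn {n : ℕ} (x : Euc n) :
    𝓕 (fun ξ : Euc n => ((freqAnn n ξ : ℝ) : ℂ)) x =
      (2 : ℝ) ^ n • 𝓕 (freqBumpSchwartz n : Euc n → ℂ) ((2 : ℝ) • x) -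
        𝓕 (freqBumpSchwartz n : Euc n → ℂ) x := by
  have hi : Integrable (fun ξ : Euc n => ((freqBump n ξ : ℝ) : ℂ)) :=
    (freqBumpSchwartz n).integrable
  have hi2 : Integrable (fun ξ : Euc n => ((freqBump n ((2 : ℝ)⁻¹ • ξ) : ℝ) : ℂ)) :=
    (integrable_comp_smul_iff volume (fun ξ : Euc n => ((freqBump n ξ : ℝ) : ℂ))
      (inv_ne_zero two_ne_zero)).2 hi
  have h1 : (fun ξ : Euc n => ((freqAnn n ξ : ℝ) : ℂ)) =
      fun ξ => ((freqBump n ((2 : ℝ)⁻¹ • ξ) : ℝ) : ℂ) - ((freqBump n ξ : ℝ) : ℂ) := by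
    funext ξ; simp [freqAnn]
  rw [h1, Real.fourier_eq, Real.fourier_eq, Real.fourier_eq]
  simp_rw [smul_sub]
  rw [integral_sub ((Real.fourierIntegral_convergent_iff _).2 hi2)
    ((Real.fourierIntegral_convergent_iff _).2 hi)]
  congr 1
  have h3 := Measure.integral_comp_inv_smul (μ := (volume : Measure (Euc n)))
    (fun η : Euc n => Real.fourierChar (-⟪η, (2 : ℝ) • x⟫) • ((freqBump n η : ℝ) : ℂ)) 2
  rw [finrank_euclideanSpace_fin, abs_of_nonneg (by positivity)] at h3
  rw [show (∫ v, Real.fourierChar (-⟪v, (2:ℝ) • x⟫) • (freqBumpSchwartz n) v) =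
    ∫ η : Euc n, Real.fourierChar (-⟪η, (2 : ℝ) • x⟫) • ((freqBump n η : ℝ) : ℂ) from rfl, ← h3]
  congr 1
  funext η
  rw [inner_smul_left, inner_smul_right]
  simp

lemma integral_fourier_freqBump (n : ℕ) :
    ∫ x, 𝓕 (freqBumpSchwartz n : Euc n → ℂ) x = 1 := by
  have h := FourierTransform.fourierInv_fourier_eq (F := 𝓢(Euc n, ℂ)) (freqBumpSchwartz n)
  have h0 := congrArg (fun f : 𝓢(Euc n, ℂ) => f 0) h
  simp only [SchwartzMap.fourierInv_coe, SchwartzMap.fourier_coe] at h0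
  rw [Real.fourierInv_eq] at h0
  simp only [inner_zero_right, AddChar.map_zero_eq_one, one_smul] at h0
  rw [h0, freqBumpSchwartz_apply]
  have h1 : freqBump n 0 = 1 := (freqBump n).one_of_mem_closedBall (by simp [freqBump])
  simp [h1]

lemma exists_schwartz_dyadic_kernel_aux {E : Type*} [NormedAddCommGroup E] [NormedSpace ℂ E]
    [CompleteSpace E]
    (ι : V →L[ℝ] E) (ρ : E →L[ℝ] V) (hρ : ∀ (c : ℂ) (v : V), ρ (c • ι v) = c.re • v)
    {n k : ℕ} {A : CoeffOp n k V W} (hA : IsElliptic n k A) :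
    ∃ (S₀ : 𝓢(Euc n, ℝ)) (K₀ : 𝓢(Euc n, W →L[ℝ] V)), ∫ x, S₀ x = 1 ∧
      ∀ x, ((2 : ℝ) ^ n * S₀ ((2 : ℝ) • x) - S₀ x) • ContinuousLinearMap.id ℝ V =
        ∑ I : Fin k → Fin n, (dirDeriv n k I K₀ x) ∘L LinearMap.toContinuousLinearMap (A I) := by
  set c : ℂ := -(2 * Real.pi * Complex.I) with hc
  have hc0 : c ≠ 0 := by simp [hc, Real.pi_ne_zero]
  let M : Euc n → (W →L[ℝ] E) := fun ξ =>
    (c ^ k)⁻¹ • (ι ∘L (freqAnn n ξ • symbolLeftInv n k A ξ))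
  have hMsm : ContDiff ℝ ∞ M :=
    (contDiff_const.clm_comp (contDiff_freqAnn_smul_symbolLeftInv hA)).const_smul _
  have hMcs : HasCompactSupport M := by
    refine (hasCompactSupport_freqAnn n).mono fun ξ hξ => ?_
    rw [Function.mem_support] at hξ ⊢
    intro h
    apply hξ
    simp [M, h]
  let MS : 𝓢(Euc n, W →L[ℝ] E) := hMcs.toSchwartzMap hMsm
  let ρ' : (W →L[ℝ] E) →L[ℝ] (W →L[ℝ] V) := ContinuousLinearMap.compL ℝ W E V ρ
  let K₀ : 𝓢(Euc n, W →L[ℝ] V) := SchwartzMap.postcompCLM ρ' (𝓕 MS)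
  let S₀ : 𝓢(Euc n, ℝ) := SchwartzMap.postcompCLM Complex.reCLM (𝓕 (freqBumpSchwartz n))
  refine ⟨S₀, K₀, ?_, fun x => ?_⟩
  · change ∫ x, Complex.reCLM (𝓕 (freqBumpSchwartz n) x) = 1
    rw [Complex.reCLM.integral_comp_comm (𝓕 (freqBumpSchwartz n)).integrable]
    rw [SchwartzMap.fourier_coe, integral_fourier_freqBump]
    simp
  · ext v
    have hInt : ∀ I : Fin k → Fin n, Integrable fun ξ => c ^ k • (∏ i, ξ (I i)) • MS ξ :=
      fun I => integrable_prod_coord_smul I MS.continuous hMcs _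
    have hd : ∀ I : Fin k → Fin n, dirDeriv n k I K₀ x =
        ρ' (𝓕 (fun ξ => c ^ k • (∏ i, ξ (I i)) • MS ξ) x) := fun I => dirDeriv_clm_fourier I ρ' MS x
    have he : ∀ I : Fin k → Fin n, (dirDeriv n k I K₀ x) (A I v) =
        ρ (𝓕 (fun ξ => c ^ k • (∏ i, ξ (I i)) • M ξ (A I v)) x) := by
      intro I
      rw [hd I]
      change ρ ((𝓕 (fun ξ => c ^ k • (∏ i, ξ (I i)) • MS ξ) x) (A I v)) = _
      rw [Real.fourier_continuousLinearMap_apply (hInt I)]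
      rfl
    simp only [_root_.sum_apply, ContinuousLinearMap.comp_apply,
      LinearMap.coe_toContinuousLinearMap']
    simp_rw [he]
    rw [← map_sum]
    have hsum : ∑ I : Fin k → Fin n, 𝓕 (fun ξ => c ^ k • (∏ i, ξ (I i)) • M ξ (A I v)) x =
        𝓕 (fun ξ => ((freqAnn n ξ : ℝ) : ℂ) • ι v) x := by
      simp_rw [Real.fourier_eq]
      rw [← integral_finsetSum]
      · congr 1
        funext ξ
        rw [← Finset.smul_sum]
        congr 1
        by_cases hξ : ξ = 0
        · simp [M, freqAnn_eq_zero_of_norm_le (n := n) (ξ := ξ) (by simp [hξ])]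
        · have h1 := congrArg (fun T : V →L[ℝ] V => T v) (symbolLeftInv_comp hA hξ)
          simp only [ContinuousLinearMap.comp_apply, symbolCLM, _root_.sum_apply,
            map_sum, _root_.smul_apply, map_smul,
            LinearMap.coe_toContinuousLinearMap', ContinuousLinearMap.id_apply] at h1
          have h2 : ∀ I : Fin k → Fin n, c ^ k • (∏ i, ξ (I i)) • M ξ (A I v) =
              freqAnn n ξ • ι ((∏ i, ξ (I i)) • symbolLeftInv n k A ξ (A I v)) := by
            intro I
            simp only [M, _root_.smul_apply, ContinuousLinearMap.comp_apply, map_smul]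
            rw [smul_comm (∏ i, ξ (I i)) ((c ^ k)⁻¹), smul_smul,
              mul_inv_cancel₀ (pow_ne_zero _ hc0),
              one_smul, smul_comm]
          simp_rw [h2]
          rw [← Finset.smul_sum, ← map_sum, h1]
          simp
      · intro I _
        rw [Real.fourierIntegral_convergent_iff]
        exact (ContinuousLinearMap.apply ℝ E (A I v)).integrable_comp (hInt I)
    have hfin : 𝓕 (fun ξ => ((freqAnn n ξ : ℝ) : ℂ) • ι v) x =
        𝓕 (fun ξ : Euc n => ((freqAnn n ξ : ℝ) : ℂ)) x • ι v := by
      rw [Real.fourier_eq, Real.fourier_eq, ← integral_smul_const]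
      congr 1
      funext ξ
      rw [smul_assoc]
    rw [hsum, hfin, hρ, fourier_freqAnn, Complex.sub_re, Complex.smul_re]
    simp [S₀, SchwartzMap.fourier_coe]

/-- The integrable kernel realizing one dyadic step of the Littlewood-Paley decomposition through
the elliptic operator. -/
theorem exists_schwartz_dyadic_kernel {n k : ℕ} {A : CoeffOp n k V W}
    (hA : IsElliptic n k A) :
    ∃ (S₀ : 𝓢(Euc n, ℝ)) (K₀ : 𝓢(Euc n, W →L[ℝ] V)), ∫ x, S₀ x = 1 ∧
      ∀ x, ((2 : ℝ) ^ n * S₀ ((2 : ℝ) • x) - S₀ x) • ContinuousLinearMap.id ℝ V =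
        ∑ I : Fin k → Fin n, (dirDeriv n k I K₀ x) ∘L LinearMap.toContinuousLinearMap (A I) :=
  exists_schwartz_dyadic_kernel_aux (complexEmb V) (complexRe V) complexRe_smul_complexEmb hA

end FourierKernel

noncomputable section DirDeriv

variable {F G : Type*} [NormedAddCommGroup F] [NormedSpace ℝ F]
  [NormedAddCommGroup G] [NormedSpace ℝ G] {n m : ℕ}

lemma dirDeriv_fin_zero (I : Fin 0 → Fin n) (f : Euc n → F) (x : Euc n) :
    dirDeriv n 0 I f x = f x := by
  simp [dirDeriv]

lemma ContDiff.fderiv_dir {f : Euc n → F} (hf : ContDiff ℝ ∞ f) (v : Euc n) :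
    ContDiff ℝ ∞ fun x => fderiv ℝ f x v :=
  (hf.fderiv_right (m := ∞) (by exact_mod_cast le_rfl)).clm_apply contDiff_const

lemma contDiff_dirDeriv {f : Euc n → F} (hf : ContDiff ℝ ∞ f) (I : Fin m → Fin n) :
    ContDiff ℝ ∞ (dirDeriv n m I f) := by
  have h := hf.iteratedFDeriv_right (m := ∞) (i := m) (by exact_mod_cast le_top)
  exact (ContinuousMultilinearMap.apply ℝ (fun _ : Fin m => Euc n) F
    (fun i => stdVec n (I i))).contDiff.comp h

lemma dirDeriv_succ {f : Euc n → F} (hf : ContDiff ℝ ∞ f) (I : Fin (m + 1) → Fin n) (x : Euc n) :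
    dirDeriv n (m + 1) I f x =
      fderiv ℝ (dirDeriv n m (Fin.tail I) f) x (stdVec n (I 0)) := by
  have h := hf.iteratedFDeriv_right (m := ∞) (i := m) (by exact_mod_cast le_top)
  exact DifferentiableAt.iteratedFDeriv_succ_apply_left' (h.differentiable (by simp) x)

lemma fderiv_fderiv_dir_comm {f : Euc n → F} (hf : ContDiff ℝ ∞ f) (v w x : Euc n) :
    fderiv ℝ (fun y => fderiv ℝ f y v) x w = fderiv ℝ (fun y => fderiv ℝ f y w) x v := by
  have hd : DifferentiableAt ℝ (fderiv ℝ f) x :=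
    (hf.fderiv_right (m := ∞) (by exact_mod_cast le_rfl)).differentiable (by simp) x
  rw [fderiv_clm_apply hd (differentiableAt_const _),
    fderiv_clm_apply hd (differentiableAt_const _)]
  have hs : IsSymmSndFDerivAt ℝ f x := hf.contDiffAt.isSymmSndFDerivAt (by
    rw [minSmoothness_of_isRCLikeNormedField]; exact WithTop.coe_le_coe.2 le_top)
  simpa using hs.eq w v

lemma fderiv_dirDeriv_comm {f : Euc n → F} (hf : ContDiff ℝ ∞ f) (I : Fin m → Fin n)
    (v x : Euc n) :
    fderiv ℝ (dirDeriv n m I f) x v = dirDeriv n m I (fun y => fderiv ℝ f y v) x := by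
  induction m generalizing x with
  | zero =>
    rw [dirDeriv_fin_zero]
    rfl
  | succ m ih =>
    rw [dirDeriv_succ (hf.fderiv_dir v)]
    have h1 : dirDeriv n (m + 1) I f =
        fun y => fderiv ℝ (dirDeriv n m (Fin.tail I) f) y (stdVec n (I 0)) :=
      funext fun y => dirDeriv_succ hf I y
    rw [h1, fderiv_fderiv_dir_comm (contDiff_dirDeriv hf _)]
    congr 2
    funext y
    exact ih (Fin.tail I) y

lemma HasCompactSupport.dirDeriv {f : Euc n → F} (hf : HasCompactSupport f) (I : Fin m → Fin n) :
    HasCompactSupport (dirDeriv n m I f) := by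
  refine (hf.iteratedFDeriv (𝕜 := ℝ) m).mono fun x hx => ?_
  rw [Function.mem_support] at hx ⊢
  intro h
  exact hx (by rw [_root_.dirDeriv, h]; rfl)

lemma IsTestFun.dirDeriv {f : Euc n → F} (hf : IsTestFun n f) (I : Fin m → Fin n) :
    IsTestFun n (dirDeriv n m I f) :=
  ⟨contDiff_dirDeriv hf.1 I, hf.2.dirDeriv I⟩

/-- Integration by parts against a smooth compactly supported function. -/
theorem integral_dirDeriv_smul {φ : Euc n → ℝ} (hφ : IsTestFun n φ) {g : Euc n → F}
    (hg : ContDiff ℝ ∞ g) (I : Fin m → Fin n) :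
    ∫ x, dirDeriv n m I φ x • g x = (-1 : ℝ) ^ m • ∫ x, φ x • dirDeriv n m I g x := by
  induction m generalizing g with
  | zero => simp [dirDeriv_fin_zero]
  | succ m ih =>
    set ψ := dirDeriv n m (Fin.tail I) φ with hψ
    have hψt : IsTestFun n ψ := hφ.dirDeriv _
    have h1 : ∀ x, dirDeriv n (m + 1) I φ x = fderiv ℝ ψ x (stdVec n (I 0)) :=
      fun x => dirDeriv_succ hφ.1 I x
    have hc : ∀ (a : Euc n → ℝ) (b : Euc n → F), Continuous a → HasCompactSupport a →
        Continuous b → Integrable fun x => a x • b x := fun a b ha hac hb =>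
      (ha.smul hb).integrable_of_hasCompactSupport hac.smul_right
    have h2 := integral_smul_fderiv_eq_neg_fderiv_smul_of_integrable
      (μ := (volume : Measure (Euc n)))
      (f := ψ) (g := g) (v := stdVec n (I 0))
      (hc _ _ (hψt.1.fderiv_dir _).continuous (hψt.2.fderiv_apply (𝕜 := ℝ) _) hg.continuous)
      (hc _ _ hψt.1.continuous hψt.2 (hg.fderiv_dir _).continuous)
      (hc _ _ hψt.1.continuous hψt.2 hg.continuous)
      (fun x _ => hψt.1.differentiable (by simp) x) (fun x _ => hg.differentiable (by simp) x)
    simp_rw [h1]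
    rw [← neg_eq_iff_eq_neg.2 h2, ih (hg.fderiv_dir _) (Fin.tail I), pow_succ,
      mul_neg_one, neg_smul]
    congr 3
    funext x
    rw [← fderiv_dirDeriv_comm hg, ← dirDeriv_succ hg]

lemma dirDeriv_congr {f g : Euc n → F} {x : Euc n} (h : f =ᶠ[𝓝 x] g) (I : Fin m → Fin n) :
    dirDeriv n m I f x = dirDeriv n m I g x := by
  rw [dirDeriv, dirDeriv, (Filter.EventuallyEq.iteratedFDeriv ℝ h m).eq_of_nhds]

lemma dirDeriv_comp_smul (f : Euc n → F) (x : Euc n) {c : ℝ} (hc : c ≠ 0) (I : Fin m → Fin n) :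
    dirDeriv n m I (fun y => f (c • y)) x = c ^ m • dirDeriv n m I f (c • x) := by
  let L : Euc n ≃L[ℝ] Euc n := ContinuousLinearEquiv.smulLeft (Units.mk0 c hc)
  have h := L.iteratedFDerivWithin_comp_right f (s := Set.univ) uniqueDiffOn_univ
    (x := x) (Set.mem_univ _) m
  rw [Set.preimage_univ, iteratedFDerivWithin_univ, iteratedFDerivWithin_univ] at h
  rw [dirDeriv]
  change iteratedFDeriv ℝ m (f ∘ L) x _ = _
  rw [h, ContinuousMultilinearMap.compContinuousLinearMap_apply]
  change iteratedFDeriv ℝ m f (c • x) (fun i => c • stdVec n (I i)) = _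
  rw [ContinuousMultilinearMap.map_smul_univ]
  simp [dirDeriv]

lemma dirDeriv_add {f g : Euc n → F} {x : Euc n} (hf : ContDiffAt ℝ m f x)
    (hg : ContDiffAt ℝ m g x) (I : Fin m → Fin n) :
    dirDeriv n m I (fun y => f y + g y) x = dirDeriv n m I f x + dirDeriv n m I g x := by
  rw [dirDeriv, fun_iteratedFDeriv_add_apply hf hg]; rfl

lemma dirDeriv_sub {f g : Euc n → F} {x : Euc n} (hf : ContDiffAt ℝ m f x)
    (hg : ContDiffAt ℝ m g x) (I : Fin m → Fin n) :
    dirDeriv n m I (fun y => f y - g y) x = dirDeriv n m I f x - dirDeriv n m I g x := by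
  rw [dirDeriv, fun_iteratedFDeriv_sub_apply hf hg]; rfl

lemma dirDeriv_const_smul {f : Euc n → F} {x : Euc n} (hf : ContDiffAt ℝ m f x)
    (c : ℝ) (I : Fin m → Fin n) :
    dirDeriv n m I (fun y => c • f y) x = c • dirDeriv n m I f x := by
  rw [dirDeriv, iteratedFDeriv_const_smul_apply' hf]; rfl

end DirDeriv

noncomputable section Compactification

variable {G : Type*} [NormedAddCommGroup G] [NormedSpace ℝ G] {n k : ℕ}

/-- A smooth function vanishing on the unit ball and equal to `1` off the ball of radius `2`. -/
def outerCutoff (n : ℕ) (x : Euc n) : ℝ := 1 - freqBump n x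

lemma contDiff_outerCutoff : ContDiff ℝ ∞ (outerCutoff n) :=
  contDiff_const.sub (freqBump n).contDiff

lemma outerCutoff_eq_zero {x : Euc n} (hx : ‖x‖ ≤ 1) : outerCutoff n x = 0 := by
  have h1 : freqBump n x = 1 := (freqBump n).one_of_mem_closedBall (by simpa [freqBump] using hx)
  simp [outerCutoff, h1]

lemma outerCutoff_eq_one {x : Euc n} (hx : 2 ≤ ‖x‖) : outerCutoff n x = 1 := by
  have h1 : freqBump n x = 0 := (freqBump n).zero_of_le_dist (by simp [freqBump]; linarith)
  simp [outerCutoff, h1]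

lemma exists_norm_iteratedFDeriv_outerCutoff_le (m : ℕ) :
    ∃ B, ∀ x : Euc n, ‖iteratedFDeriv ℝ m (outerCutoff n) x‖ ≤ B := by
  have hc : HasCompactSupport (iteratedFDeriv ℝ m (freqBump n)) :=
    (freqBump n).hasCompactSupport.iteratedFDeriv m
  obtain ⟨B, hB⟩ := hc.exists_bound_of_continuous
    (((freqBump n).contDiff (n := m)).continuous_iteratedFDeriv le_rfl)
  refine ⟨1 + B, fun x => ?_⟩
  have h : iteratedFDeriv ℝ m (outerCutoff n) x =
      iteratedFDeriv ℝ m (fun _ => (1 : ℝ)) x - iteratedFDeriv ℝ m (freqBump n) x :=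
    iteratedFDeriv_sub_apply contDiffAt_const (freqBump n).contDiffAt
  rw [h]
  refine (norm_sub_le _ _).trans (add_le_add ?_ (hB x))
  rcases eq_or_ne m 0 with rfl | hm
  · simp
  · rw [iteratedFDeriv_const_of_ne hm]; simp

/-- The `i`-th term of the cut-off homogeneous series. -/
def cutTerm (r : ℝ) (K : 𝓢(Euc n, G)) (i : ℕ) (x : Euc n) : G :=
  outerCutoff n x • r ^ i • K ((2 : ℝ) ^ i • x)

lemma contDiff_cutTerm (r : ℝ) (K : 𝓢(Euc n, G)) (i : ℕ) : ContDiff ℝ ∞ (cutTerm r K i) :=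
  contDiff_outerCutoff.smul (contDiff_const.smul ((K.smooth ⊤).comp (contDiff_const_smul _)))

lemma iteratedFDeriv_cutTerm_bound (r : ℝ) (K : 𝓢(Euc n, G)) (m q : ℕ) :
    ∃ C, 0 ≤ C ∧ ∀ i x, ‖x‖ ^ q * ‖iteratedFDeriv ℝ m (cutTerm r K i) x‖ ≤ C * (1 / 2) ^ i := by
  choose B hB using fun m => exists_norm_iteratedFDeriv_outerCutoff_le (n := n) m
  have hB0 : ∀ m, 0 ≤ B m := fun m => (norm_nonneg _).trans (hB m 0)
  obtain ⟨p, hp⟩ : ∃ p : ℕ, 2 * (|r| * 2 ^ m) ≤ (2 : ℝ) ^ p :=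
    (pow_unbounded_of_one_lt _ one_lt_two).imp fun _ h => h.le
  choose C hC0 hC using fun b => K.decay (p + q) b
  refine ⟨∑ a ∈ Finset.range (m + 1), (m.choose a : ℝ) * B a * C (m - a), ?_, ?_⟩
  · exact Finset.sum_nonneg fun a _ => by have := hB0 a; have := (hC0 (m - a)).le; positivity
  intro i x
  rcases lt_or_ge ‖x‖ 1 with hx | hx
  · have h0 : cutTerm r K i =ᶠ[𝓝 x] fun _ => 0 := by
      filter_upwards [(isOpen_lt continuous_norm continuous_const).mem_nhds hx] with y hy
      rw [cutTerm, outerCutoff_eq_zero (le_of_lt hy), zero_smul]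
    have h1 : iteratedFDeriv ℝ m (cutTerm r K i) x = 0 := by
      rw [h0.iteratedFDeriv ℝ m |>.eq_of_nhds]
      simp
    rw [h1, norm_zero, mul_zero]
    exact mul_nonneg (Finset.sum_nonneg fun a _ => by
      have := hB0 a; have := (hC0 (m - a)).le; positivity) (by positivity)
  have hf : ContDiff ℝ ∞ fun x => r ^ i • K ((2 : ℝ) ^ i • x) :=
    contDiff_const.smul ((K.smooth ⊤).comp (contDiff_const_smul _))
  have h1 := norm_iteratedFDeriv_smul_le (𝕜 := ℝ) contDiff_outerCutoff hf x (n := m)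
    (by exact_mod_cast le_top)
  have hterm : ∀ b ≤ m, ‖x‖ ^ q * ‖iteratedFDeriv ℝ b (fun x => r ^ i • K ((2 : ℝ) ^ i • x)) x‖ ≤
      C b * (1 / 2) ^ i := by
    intro b hb
    have h2 : iteratedFDeriv ℝ b (fun x => r ^ i • K ((2 : ℝ) ^ i • x)) x =
        r ^ i • ((2 : ℝ) ^ i) ^ b • iteratedFDeriv ℝ b K ((2 : ℝ) ^ i • x) := by
      have h3 := iteratedFDeriv_const_smul_apply (𝕜 := ℝ) (a := r ^ i) (i := b)
        (f := fun x => K ((2 : ℝ) ^ i • x)) (x := x)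
        (((K.smooth ⊤).of_le (by exact_mod_cast le_top)).comp (contDiff_const_smul _)).contDiffAt
      have h4 := congrFun (iteratedFDeriv_comp_const_smul (𝕜 := ℝ) (i := b) (f := K)
        ((2 : ℝ) ^ i) ((K.smooth ⊤).of_le (by exact_mod_cast le_top))) x
      rw [← h4, ← h3]
      rfl
    rw [h2, norm_smul, norm_smul, norm_pow, Real.norm_eq_abs, norm_pow, norm_pow, Real.norm_two]
    have h5 := hC b ((2 : ℝ) ^ i • x)
    rw [norm_smul, norm_pow, Real.norm_two, mul_pow, pow_add] at h5
    set D := ‖iteratedFDeriv ℝ b K ((2 : ℝ) ^ i • x)‖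
    have hD : 0 ≤ D := norm_nonneg _
    have h6 : |r| ^ i * ((2 : ℝ) ^ i) ^ b ≤ (1 / 2) ^ i * ((2 : ℝ) ^ i) ^ p := by
      have : (2 : ℝ) ^ b ≤ 2 ^ m := pow_le_pow_right₀ one_le_two hb
      calc |r| ^ i * ((2 : ℝ) ^ i) ^ b = (|r| * 2 ^ b) ^ i := by
            rw [mul_pow, ← pow_mul, ← pow_mul, mul_comm i b]
        _ ≤ ((1 / 2) * 2 ^ p) ^ i := by
            refine pow_le_pow_left₀ (by positivity) ?_ i
            have := mul_le_mul_of_nonneg_left this (abs_nonneg r)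
            linarith
        _ = _ := by rw [mul_pow, ← pow_mul, ← pow_mul, mul_comm i p]
    have h7 : (1 : ℝ) ≤ ((2 : ℝ) ^ i) ^ q := one_le_pow₀ (one_le_pow₀ one_le_two)
    have h8 : (1 : ℝ) ≤ ‖x‖ ^ p := one_le_pow₀ hx
    have hxq : 0 ≤ ‖x‖ ^ q := by positivity
    calc ‖x‖ ^ q * (|r| ^ i * (((2 : ℝ) ^ i) ^ b * D))
        = (|r| ^ i * ((2 : ℝ) ^ i) ^ b) * (‖x‖ ^ q * D) := by ring
      _ ≤ ((1 / 2) ^ i * ((2 : ℝ) ^ i) ^ p) * (‖x‖ ^ q * D) :=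
          mul_le_mul_of_nonneg_right h6 (by positivity)
      _ = ((1 / 2) ^ i * (((2 : ℝ) ^ i) ^ p * ‖x‖ ^ q * D)) * (1 * 1) := by ring
      _ ≤ ((1 / 2) ^ i * (((2 : ℝ) ^ i) ^ p * ‖x‖ ^ q * D)) * (((2 : ℝ) ^ i) ^ q * ‖x‖ ^ p) :=
          mul_le_mul_of_nonneg_left (mul_le_mul h7 h8 zero_le_one (by positivity)) (by positivity)
      _ = (1 / 2) ^ i * (((2 : ℝ) ^ i) ^ p * ((2 : ℝ) ^ i) ^ q * (‖x‖ ^ p * ‖x‖ ^ q) * D) := by ring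
      _ ≤ (1 / 2) ^ i * C b := by
          refine mul_le_mul_of_nonneg_left (le_trans (le_of_eq ?_) h5) (by positivity)
          ring
      _ = _ := by ring
  calc ‖x‖ ^ q * ‖iteratedFDeriv ℝ m (cutTerm r K i) x‖
      ≤ ‖x‖ ^ q * _ := mul_le_mul_of_nonneg_left h1 (by positivity)
    _ = ∑ a ∈ Finset.range (m + 1), (m.choose a : ℝ) * ‖iteratedFDeriv ℝ a (outerCutoff n) x‖ *
        (‖x‖ ^ q * ‖iteratedFDeriv ℝ (m - a) (fun x => r ^ i • K ((2 : ℝ) ^ i • x)) x‖) := by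
        rw [Finset.mul_sum]
        exact Finset.sum_congr rfl fun a _ => by ring
    _ ≤ ∑ a ∈ Finset.range (m + 1), (m.choose a : ℝ) * B a * (C (m - a) * (1 / 2) ^ i) := by
        refine Finset.sum_le_sum fun a _ => mul_le_mul ?_ (hterm _ (Nat.sub_le _ _))
          (by positivity) (mul_nonneg (by positivity) (hB0 a))
        exact mul_le_mul_of_nonneg_left (hB a x) (by positivity)
    _ = _ := by
        rw [Finset.sum_mul]
        exact Finset.sum_congr rfl fun a _ => by ring

lemma norm_iteratedFDeriv_cutTerm_le (r : ℝ) (K : 𝓢(Euc n, G)) :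
    ∃ v : ℕ → ℕ → ℝ, (∀ m, Summable (v m)) ∧
      ∀ m i x, ‖iteratedFDeriv ℝ m (cutTerm r K i) x‖ ≤ v m i := by
  choose C hC0 hC using fun m => iteratedFDeriv_cutTerm_bound r K m 0
  refine ⟨fun m i => C m * (1 / 2) ^ i, fun m => summable_geometric_two.mul_left _,
    fun m i x => ?_⟩
  simpa using hC m i x

variable [CompleteSpace G]

lemma contDiff_tsum_cutTerm (r : ℝ) (K : 𝓢(Euc n, G)) :
    ContDiff ℝ ∞ fun x => ∑' i, cutTerm r K i x := by
  obtain ⟨v, hv, h⟩ := norm_iteratedFDeriv_cutTerm_le r K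
  exact contDiff_tsum (v := v) (contDiff_cutTerm r K) (fun m _ => hv m) (fun m i x _ => h m i x)

lemma hasSum_iteratedFDeriv_cutTerm (r : ℝ) (K : 𝓢(Euc n, G)) (m : ℕ) (x : Euc n) :
    HasSum (fun i => iteratedFDeriv ℝ m (cutTerm r K i) x)
      (iteratedFDeriv ℝ m (fun y => ∑' i, cutTerm r K i y) x) := by
  obtain ⟨v, hv, h⟩ := norm_iteratedFDeriv_cutTerm_le r K
  rw [iteratedFDeriv_tsum_apply (N := ⊤) (v := v) (contDiff_cutTerm r K) (fun m _ => hv m)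
    (fun m i x _ => h m i x) le_top]
  exact (Summable.of_norm_bounded (hv m) (fun i => h m i x)).hasSum

/-- The cut-off homogeneous series is a Schwartz function. -/
def cutSeries (r : ℝ) (K : 𝓢(Euc n, G)) : 𝓢(Euc n, G) where
  toFun x := ∑' i, cutTerm r K i x
  smooth' := contDiff_tsum_cutTerm r K
  decay' q m := by
    obtain ⟨C, hC0, hC⟩ := iteratedFDeriv_cutTerm_bound r K m q
    refine ⟨C * 2, fun x => ?_⟩
    have h := (hasSum_iteratedFDeriv_cutTerm r K m x).const_smul (‖x‖ ^ q)
    have h2 : HasSum (fun i => C * (1 / 2 : ℝ) ^ i) (C * 2) := hasSum_geometric_two.mul_left _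
    have h3 := h.norm_le_of_bounded h2 (fun i => by
      rw [norm_smul, norm_pow, norm_norm]; exact hC i x)
    rwa [norm_smul, norm_pow, norm_norm] at h3

lemma hasSum_cutSeries {r : ℝ} {K : 𝓢(Euc n, G)} {x : Euc n} (hx : 2 < ‖x‖) :
    HasSum (fun i : ℕ => r ^ i • K ((2 : ℝ) ^ i • x)) (cutSeries r K x) := by
  obtain ⟨v, hv, h⟩ := norm_iteratedFDeriv_cutTerm_le r K
  have hs : Summable fun i => cutTerm r K i x :=
    Summable.of_norm_bounded (hv 0) (fun i => by simpa using h 0 i x)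
  have h1 : ∀ i, cutTerm r K i x = r ^ i • K ((2 : ℝ) ^ i • x) := fun i => by
    rw [cutTerm, outerCutoff_eq_one hx.le, one_smul]
  have h2 := hs.hasSum
  rw [funext h1] at h2
  have h3 : cutSeries r K x = ∑' i, cutTerm r K i x := rfl
  rw [h3, funext h1]
  exact h2

lemma hasSum_dirDeriv_cutSeries {r : ℝ} {K : 𝓢(Euc n, G)} {x : Euc n} (hx : 2 < ‖x‖)
    (I : Fin k → Fin n) :
    HasSum (fun i : ℕ => (r * 2 ^ k) ^ i • dirDeriv n k I K ((2 : ℝ) ^ i • x))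
      (dirDeriv n k I (cutSeries r K) x) := by
  have h := (hasSum_iteratedFDeriv_cutTerm r K k x).mapL
    (ContinuousMultilinearMap.apply ℝ (fun _ : Fin k => Euc n) G (fun i => stdVec n (I i)))
  refine h.congr_fun ?_
  intro i
  have h1 : cutTerm r K i =ᶠ[𝓝 x] fun y => r ^ i • K ((2 : ℝ) ^ i • y) := by
    filter_upwards [(isOpen_lt continuous_const continuous_norm).mem_nhds hx] with y hy
    rw [cutTerm, outerCutoff_eq_one (le_of_lt hy), one_smul]
  have h2 := dirDeriv_congr h1 I
  have hK : ContDiff ℝ k fun y => K ((2 : ℝ) ^ i • y) :=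
    ((K.smooth ⊤).of_le (by exact_mod_cast le_top)).comp (contDiff_const_smul _)
  rw [dirDeriv_const_smul hK.contDiffAt, dirDeriv_comp_smul _ _ (by positivity)] at h2
  rw [mul_pow, mul_smul, ← pow_mul, mul_comm k i, pow_mul]
  exact h2.symm

lemma smul_cutSeries_two_smul {r : ℝ} {K : 𝓢(Euc n, G)} {x : Euc n} (hx : 2 < ‖x‖) :
    r • cutSeries r K ((2 : ℝ) • x) = cutSeries r K x - K x := by
  have hx2 : 2 < ‖(2 : ℝ) • x‖ := by rw [norm_smul, Real.norm_two]; linarith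
  have h1 := (hasSum_cutSeries (r := r) (K := K) hx2).const_smul r
  have h2 := (hasSum_nat_add_iff' 1).2 (hasSum_cutSeries (r := r) (K := K) hx)
  simp only [Finset.range_one, Finset.sum_singleton, pow_zero, one_smul] at h2
  refine h1.unique (h2.congr_fun ?_)
  intro i
  simp only [smul_smul, ← pow_succ, ← pow_succ']

lemma integral_fderiv_schwartz (K : 𝓢(Euc n, G)) (v : Euc n) :
    ∫ x, fderiv ℝ K x v = 0 := by
  have h := integral_smul_fderiv_eq_neg_fderiv_smul_of_integrable (𝕜 := ℝ)
    (μ := (volume : Measure (Euc n))) (f := fun _ => (1 : ℝ)) (g := K) (v := v)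
    (by simp) (by simpa using! (LineDeriv.lineDerivOp v K).integrable (μ := volume))
    (by simpa using K.integrable (μ := volume))
    (fun x _ => by fun_prop) (fun x _ => K.differentiableAt)
  simpa using h

lemma exists_schwartz_dirDeriv (K : 𝓢(Euc n, G)) (I : Fin k → Fin n) :
    ∃ L : 𝓢(Euc n, G), ∀ x, L x = dirDeriv n k I K x := by
  induction k with
  | zero => exact ⟨K, fun x => (dirDeriv_fin_zero I _ x).symm⟩
  | succ k ih =>
    obtain ⟨L, hL⟩ := ih (Fin.tail I)
    refine ⟨LineDeriv.lineDerivOp (stdVec n (I 0)) L, fun x => ?_⟩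
    rw [dirDeriv_succ (K.smooth ⊤), SchwartzMap.lineDerivOp_apply_eq_fderiv, ← funext hL]

lemma integrable_dirDeriv_schwartz (K : 𝓢(Euc n, G)) (I : Fin k → Fin n) :
    Integrable (dirDeriv n k I K) := by
  obtain ⟨L, hL⟩ := exists_schwartz_dirDeriv K I
  rw [← funext hL]
  exact L.integrable

lemma integral_dirDeriv_schwartz (hk : 1 ≤ k) (K : 𝓢(Euc n, G)) (I : Fin k → Fin n) :
    ∫ x, dirDeriv n k I K x = 0 := by
  obtain ⟨k, rfl⟩ := Nat.exists_eq_add_of_le' hk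
  obtain ⟨L, hL⟩ := exists_schwartz_dirDeriv K (Fin.tail I)
  rw [← integral_fderiv_schwartz L (stdVec n (I 0))]
  congr 1
  funext x
  rw [dirDeriv_succ (K.smooth ⊤), ← funext hL]

end Compactification

noncomputable section DyadicKernel

variable {V W : Type*}
  [NormedAddCommGroup V] [InnerProductSpace ℝ V] [FiniteDimensional ℝ V]
  [NormedAddCommGroup W] [InnerProductSpace ℝ W] [FiniteDimensional ℝ W] {n k : ℕ}

lemma tendsto_dyadic_schwartz (S : 𝓢(Euc n, ℝ)) {x : Euc n} (hx : 0 < ‖x‖) :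
    Tendsto (fun N : ℕ => ((2 : ℝ) ^ n) ^ N * S ((2 : ℝ) ^ N • x)) atTop (𝓝 0) := by
  obtain ⟨C, hC0, hC⟩ := S.decay (n + 1) 0
  have h1 : Tendsto (fun N : ℕ => C / ‖x‖ ^ (n + 1) * (1 / 2 : ℝ) ^ N) atTop (𝓝 0) := by
    simpa using (tendsto_pow_atTop_nhds_zero_of_lt_one (r := (1 / 2 : ℝ)) (by norm_num)
      (by norm_num)).const_mul (C / ‖x‖ ^ (n + 1))
  refine squeeze_zero_norm (fun N => ?_) h1
  have h2 := hC ((2 : ℝ) ^ N • x)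
  rw [norm_smul, norm_pow, Real.norm_two, norm_iteratedFDeriv_zero] at h2
  rw [norm_mul, norm_pow, norm_pow, Real.norm_two, one_div, inv_pow, ← div_eq_mul_inv, div_div,
    le_div_iff₀ (by positivity)]
  refine le_trans (le_of_eq ?_) h2
  ring

/-- Any elliptic operator of positive order admits smooth compactly supported kernels `S`, `K`
such that the difference of consecutive dyadic mollifications by `S` factors through the
operator by means of `K`. -/
theorem exists_compact_dyadic_kernel {A : CoeffOp n k V W} (hk : 1 ≤ k)
    (hA : IsElliptic n k A) :
    ∃ (S : Euc n → V →L[ℝ] V) (K : Euc n → W →L[ℝ] V), IsTestFun n S ∧ IsTestFun n K ∧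
      ∫ x, S x = ContinuousLinearMap.id ℝ V ∧
      ∀ x, (2 : ℝ) ^ n • S ((2 : ℝ) • x) - S x =
        ∑ I : Fin k → Fin n, (dirDeriv n k I K x) ∘L LinearMap.toContinuousLinearMap (A I) := by
  obtain ⟨S₀, K₀, hInt, hid⟩ := exists_schwartz_dyadic_kernel hA
  set a : (Fin k → Fin n) → (V →L[ℝ] W) := fun I => LinearMap.toContinuousLinearMap (A I) with ha
  set r : ℝ := 2 ^ n / 2 ^ k with hr
  have hrk : r * 2 ^ k = 2 ^ n := by rw [hr]; field_simp
  set H : 𝓢(Euc n, W →L[ℝ] V) := cutSeries r K₀ with hH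
  set S : Euc n → V →L[ℝ] V := fun x => S₀ x • ContinuousLinearMap.id ℝ V +
    ∑ I : Fin k → Fin n, (dirDeriv n k I H x) ∘L a I with hS
  set K : Euc n → W →L[ℝ] V := fun x => K₀ x - H x + r • H ((2 : ℝ) • x) with hK
  have hcH2 : ContDiff ℝ ∞ fun x : Euc n => H ((2 : ℝ) • x) :=
    (H.smooth ⊤).comp (contDiff_const_smul _)
  have hcK : ContDiff ℝ ∞ K := ((K₀.smooth ⊤).sub (H.smooth ⊤)).add (hcH2.const_smul r)
  have hcS : ContDiff ℝ ∞ S := ((S₀.smooth ⊤).smul contDiff_const).add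
    (ContDiff.sum fun I _ => (contDiff_dirDeriv (H.smooth ⊤) I).clm_comp contDiff_const)
  have hS0 : ∀ x : Euc n, x ∉ closedBall 0 2 → S x = 0 := by
    intro x hx
    have hx : 2 < ‖x‖ := by simpa using hx
    have h1 : HasSum (fun i : ℕ => ∑ I : Fin k → Fin n,
        ((r * 2 ^ k) ^ i • dirDeriv n k I K₀ ((2 : ℝ) ^ i • x)) ∘L a I)
        (∑ I : Fin k → Fin n, (dirDeriv n k I H x) ∘L a I) :=
      hasSum_sum fun I _ => (hasSum_dirDeriv_cutSeries hx I).mapL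
        ((ContinuousLinearMap.compL ℝ V W V).flip (a I))
    set g : ℕ → ℝ := fun N => ((2 : ℝ) ^ n) ^ N * S₀ ((2 : ℝ) ^ N • x) with hg
    have h2 : ∀ i : ℕ, ∑ I : Fin k → Fin n,
        ((r * 2 ^ k) ^ i • dirDeriv n k I K₀ ((2 : ℝ) ^ i • x)) ∘L a I =
        (g (i + 1) - g i) • ContinuousLinearMap.id ℝ V := by
      intro i
      simp_rw [ContinuousLinearMap.smul_comp, ← Finset.smul_sum]
      rw [← hid, smul_smul, smul_smul, ← pow_succ', hrk]
      congr 1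
      simp only [hg]
      ring
    rw [funext h2] at h1
    have h3 := h1.tendsto_sum_nat
    simp_rw [← Finset.sum_smul, Finset.sum_range_sub] at h3
    have h4 := ((tendsto_dyadic_schwartz S₀ (x := x) (by linarith)).sub_const (g 0)).smul_const
      (ContinuousLinearMap.id ℝ V)
    have h5 := tendsto_nhds_unique h3 h4
    simp only [hS, h5]
    simp [hg]
  have hK0 : ∀ x : Euc n, x ∉ closedBall 0 2 → K x = 0 := by
    intro x hx
    have hx : 2 < ‖x‖ := by simpa using hx
    simp only [hK, hH, smul_cutSeries_two_smul hx]
    abel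
  refine ⟨S, K, ⟨hcS, HasCompactSupport.intro (isCompact_closedBall 0 2) hS0⟩,
    ⟨hcK, HasCompactSupport.intro (isCompact_closedBall 0 2) hK0⟩, ?_, fun x => ?_⟩
  · have hi : ∀ I : Fin k → Fin n, Integrable fun x => (dirDeriv n k I H x) ∘L a I := fun I =>
      ((ContinuousLinearMap.compL ℝ V W V).flip (a I)).integrable_comp
        (integrable_dirDeriv_schwartz H I)
    rw [hS, integral_add (S₀.integrable.smul_const _) (integrable_finsetSum _ fun I _ => hi I),
      integral_finsetSum _ fun I _ => hi I, integral_smul_const, hInt, one_smul]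
    have h0 : ∀ I : Fin k → Fin n, ∫ x, (dirDeriv n k I H x) ∘L a I = 0 := fun I => by
      have := ((ContinuousLinearMap.compL ℝ V W V).flip (a I)).integral_comp_comm
        (integrable_dirDeriv_schwartz H I)
      rw [integral_dirDeriv_schwartz hk, map_zero] at this
      exact this
    simp [h0]
  · have hd : ∀ I : Fin k → Fin n, dirDeriv n k I K x =
        dirDeriv n k I K₀ x - dirDeriv n k I H x +
          (2 : ℝ) ^ n • dirDeriv n k I H ((2 : ℝ) • x) := by
      intro I
      have hle : ((k : ℕ∞) : ℕ∞ω) ≤ ((⊤ : ℕ∞) : ℕ∞ω) := by exact_mod_cast le_top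
      rw [hK, dirDeriv_add (f := fun x => K₀ x - H x) (g := fun x => r • H ((2 : ℝ) • x))
        (((K₀.smooth ⊤).sub (H.smooth ⊤)).of_le hle).contDiffAt
        ((hcH2.const_smul r).of_le hle).contDiffAt,
        dirDeriv_sub ((K₀.smooth ⊤).of_le hle).contDiffAt ((H.smooth ⊤).of_le hle).contDiffAt,
        dirDeriv_const_smul (hcH2.of_le hle).contDiffAt, dirDeriv_comp_smul _ _ two_ne_zero,
        smul_smul, hrk]
    simp_rw [hd, ContinuousLinearMap.add_comp, ContinuousLinearMap.sub_comp,
      ContinuousLinearMap.smul_comp, Finset.sum_add_distrib, Finset.sum_sub_distrib,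
      ← Finset.smul_sum]
    rw [← hid x]
    simp only [hS, smul_add, smul_smul, sub_smul]
    abel

end DyadicKernel

noncomputable section Dyad

variable {G : Type*} [NormedAddCommGroup G] [NormedSpace ℝ G] {n : ℕ}

/-- The mass-preserving dyadic dilation `2^{in} Φ(2^i ·)`. -/
def dyad (Φ : Euc n → G) (i : ℕ) (z : Euc n) : G := ((2 : ℝ) ^ i) ^ n • Φ ((2 : ℝ) ^ i • z)

lemma contDiff_dyad {Φ : Euc n → G} (hΦ : ContDiff ℝ ∞ Φ) (i : ℕ) : ContDiff ℝ ∞ (dyad Φ i) :=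
  contDiff_const.smul (hΦ.comp (contDiff_const_smul _))

lemma hasCompactSupport_dyad {Φ : Euc n → G} (hΦ : HasCompactSupport Φ) (i : ℕ) :
    HasCompactSupport (dyad Φ i) :=
  (hΦ.comp_smul (pow_ne_zero i two_ne_zero)).smul_left (f := fun _ => ((2 : ℝ) ^ i) ^ n)

lemma IsTestFun.dyad {Φ : Euc n → G} (hΦ : IsTestFun n Φ) (i : ℕ) : IsTestFun n (dyad Φ i) :=
  ⟨contDiff_dyad hΦ.1 i, hasCompactSupport_dyad hΦ.2 i⟩

lemma IsTestFun.continuous {Φ : Euc n → G} (hΦ : IsTestFun n Φ) : Continuous Φ := hΦ.1.continuous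

lemma IsTestFun.integrable {Φ : Euc n → G} (hΦ : IsTestFun n Φ) : Integrable Φ :=
  hΦ.continuous.integrable_of_hasCompactSupport hΦ.2

lemma integral_dyad (Φ : Euc n → G) (i : ℕ) : ∫ z, dyad Φ i z = ∫ z, Φ z := by
  simp only [dyad]
  rw [integral_smul, Measure.integral_comp_smul, finrank_euclideanSpace_fin, smul_smul,
    abs_of_pos (by positivity), mul_inv_cancel₀ (by positivity), one_smul]

lemma exists_pos_bounds {Φ : Euc n → G} (hΦ : IsTestFun n Φ) :
    ∃ C R : ℝ, 0 < C ∧ 1 ≤ R ∧ (∀ z, ‖Φ z‖ ≤ C) ∧ (∀ z w, ‖Φ z - Φ w‖ ≤ C * ‖z - w‖) ∧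
      ∀ z, Φ z ≠ 0 → ‖z‖ ≤ R := by
  obtain ⟨C₁, hC₁⟩ := hΦ.2.exists_bound_of_continuous hΦ.continuous
  obtain ⟨L, hL⟩ := (hΦ.1.of_le (m := 1)
    (by exact_mod_cast le_top)).lipschitzWith_of_hasCompactSupport
    hΦ.2 one_ne_zero
  obtain ⟨R, hR⟩ := (hΦ.2.isBounded).exists_norm_le
  refine ⟨max C₁ L + 1, max R 1, ?_, le_max_right _ _, fun z => ?_, fun z w => ?_, fun z hz => ?_⟩
  · have : (0 : ℝ) ≤ max C₁ L := L.2.trans (le_max_right _ _)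
    linarith
  · exact (hC₁ z).trans ((le_max_left _ _).trans (by linarith))
  · refine (hL.norm_sub_le z w).trans (mul_le_mul_of_nonneg_right ?_ (norm_nonneg _))
    exact (le_max_right _ _).trans (by linarith)
  · exact (hR z (subset_tsupport _ hz)).trans (le_max_left _ _)

lemma norm_dyad_le {Φ : Euc n → G} {C : ℝ} (hC : ∀ z, ‖Φ z‖ ≤ C) (i : ℕ) (z : Euc n) :
    ‖dyad Φ i z‖ ≤ ((2 : ℝ) ^ i) ^ n * C := by
  rw [dyad, norm_smul, norm_pow, norm_pow, Real.norm_two]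
  exact mul_le_mul_of_nonneg_left (hC _) (by positivity)

lemma norm_dyad_sub_le {Φ : Euc n → G} {C : ℝ} (hC : ∀ z w, ‖Φ z - Φ w‖ ≤ C * ‖z - w‖) (i : ℕ)
    (z w : Euc n) :
    ‖dyad Φ i z - dyad Φ i w‖ ≤ ((2 : ℝ) ^ i) ^ n * (C * (2 ^ i * ‖z - w‖)) := by
  rw [dyad, dyad, ← smul_sub, norm_smul, norm_pow, norm_pow, Real.norm_two]
  refine mul_le_mul_of_nonneg_left ((hC _ _).trans (le_of_eq ?_)) (by positivity)
  rw [← smul_sub, norm_smul, norm_pow, Real.norm_two]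

lemma dyad_eq_zero {Φ : Euc n → G} {R : ℝ} (hR : ∀ z, Φ z ≠ 0 → ‖z‖ ≤ R) {i : ℕ} {z : Euc n}
    (hz : R < 2 ^ i * ‖z‖) : dyad Φ i z = 0 := by
  by_contra h
  have h1 : Φ ((2 : ℝ) ^ i • z) ≠ 0 := fun h0 => h (by simp [dyad, h0])
  have := hR _ h1
  rw [norm_smul, norm_pow, Real.norm_two] at this
  linarith

end Dyad

noncomputable section Plancherel

variable {n : ℕ}

/-- A real test function as a complex Schwartz function. -/
def testSchwartz {φ : Euc n → ℝ} (h : IsTestFun n φ) : 𝓢(Euc n, ℂ) :=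
  HasCompactSupport.toSchwartzMap (f := fun x => ((φ x : ℝ) : ℂ))
    (h.2.comp_left (g := fun r : ℝ => (r : ℂ)) Complex.ofReal_zero)
    (Complex.ofRealCLM.contDiff.comp h.1)

lemma testSchwartz_apply {φ : Euc n → ℝ} (h : IsTestFun n φ) (x : Euc n) :
    testSchwartz h x = (φ x : ℂ) := rfl

lemma integral_norm_sq_testSchwartz {φ : Euc n → ℝ} (h : IsTestFun n φ) :
    ∫ ξ, ‖𝓕 (testSchwartz h) ξ‖ ^ 2 = ∫ x, φ x ^ 2 := by
  rw [SchwartzMap.integral_norm_sq_fourier]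
  simp [testSchwartz_apply]

/-- The convolution of two real functions. -/
def conv (φ g : Euc n → ℝ) (x : Euc n) : ℝ := ∫ y, φ (x - y) * g y

lemma convolution_testSchwartz {φ g : Euc n → ℝ} (hφ : IsTestFun n φ) (hg : IsTestFun n g)
    (x : Euc n) :
    SchwartzMap.convolution (ContinuousLinearMap.mul ℂ ℂ) (testSchwartz hg)
      (testSchwartz hφ) x = ((conv φ g x : ℝ) : ℂ) := by
  rw [SchwartzMap.convolution_apply, convolution, conv, ← integral_complex_ofReal]
  congr 1
  funext y
  simp [testSchwartz_apply, mul_comm]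

lemma memLp_conv_testFun {φ g : Euc n → ℝ} (hφ : IsTestFun n φ) (hg : IsTestFun n g) :
    MemLp (conv φ g) 2 := by
  have h := (SchwartzMap.convolution (ContinuousLinearMap.mul ℂ ℂ) (testSchwartz hg)
    (testSchwartz hφ)).memLp 2 (μ := volume)
  have h2 := h.re
  simpa [convolution_testSchwartz] using h2

lemma integral_sq_conv {φ g : Euc n → ℝ} (hφ : IsTestFun n φ) (hg : IsTestFun n g) :
    ∫ x, (conv φ g x) ^ 2 =
      ∫ ξ, (‖𝓕 (testSchwartz hφ) ξ‖ * ‖𝓕 (testSchwartz hg) ξ‖) ^ 2 := by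
  have h1 := SchwartzMap.integral_norm_sq_fourier
    (SchwartzMap.convolution (ContinuousLinearMap.mul ℂ ℂ) (testSchwartz hg) (testSchwartz hφ))
  simp_rw [SchwartzMap.fourier_convolution] at h1
  simp_rw [convolution_testSchwartz] at h1
  simp only [Complex.norm_real, Real.norm_eq_abs, sq_abs] at h1
  rw [← h1]
  congr 1
  funext ξ
  simp [mul_comm]

lemma fourier_dyad {Φ : Euc n → ℝ} (hΦ : IsTestFun n Φ) (i : ℕ) (ξ : Euc n) :
    𝓕 (testSchwartz (hΦ.dyad i)) ξ = 𝓕 (testSchwartz hΦ) (((2 : ℝ) ^ i)⁻¹ • ξ) := by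
  rw [SchwartzMap.fourier_coe, SchwartzMap.fourier_coe, Real.fourier_eq, Real.fourier_eq]
  rw [← integral_dyad (fun v : Euc n => Real.fourierChar (-⟪v, ((2 : ℝ) ^ i)⁻¹ • ξ⟫) •
    testSchwartz hΦ v) i]
  congr 1
  funext z
  simp only [testSchwartz_apply, dyad]
  rw [inner_smul_left, inner_smul_right]
  have : (2 : ℝ) ^ i ≠ 0 := by positivity
  rw [conj_trivial, mul_inv_cancel_left₀ this]
  simp only [Circle.smul_def]
  simp
  ring

lemma fourier_testSchwartz_zero {Φ : Euc n → ℝ} (hΦ : IsTestFun n Φ) (h0 : ∫ x, Φ x = 0) :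
    𝓕 (testSchwartz hΦ) 0 = 0 := by
  rw [SchwartzMap.fourier_coe, Real.fourier_eq]
  simp only [inner_zero_right, neg_zero, AddChar.map_zero_eq_one, one_smul, testSchwartz_apply]
  rw [integral_complex_ofReal, h0]
  simp

lemma exists_norm_fourier_le {Φ : Euc n → ℝ} (hΦ : IsTestFun n Φ) (h0 : ∫ x, Φ x = 0) :
    ∃ C, 0 < C ∧ ∀ ξ, ‖𝓕 (testSchwartz hΦ) ξ‖ ≤ C * ‖ξ‖ ∧ ‖ξ‖ * ‖𝓕 (testSchwartz hΦ) ξ‖ ≤ C := by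
  set f := 𝓕 (testSchwartz hΦ) with hf
  obtain ⟨C₁, hC₁, h1⟩ := f.decay 0 1
  obtain ⟨C₂, hC₂, h2⟩ := f.decay 1 0
  refine ⟨max C₁ C₂, lt_max_of_lt_left hC₁, fun ξ => ⟨?_, ?_⟩⟩
  · have h3 : ∀ x, ‖fderiv ℝ f x‖ ≤ C₁ := fun x => by
      have := h1 x
      rwa [pow_zero, one_mul, norm_iteratedFDeriv_one] at this
    have h4 := Convex.norm_image_sub_le_of_norm_fderiv_le (𝕜 := ℝ) (f := f) (s := Set.univ)
      (fun x _ => f.differentiableAt) (fun x _ => h3 x) convex_univ (Set.mem_univ 0)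
      (Set.mem_univ ξ)
    rw [hf, fourier_testSchwartz_zero hΦ h0, sub_zero, sub_zero] at h4
    exact h4.trans (mul_le_mul_of_nonneg_right (le_max_left _ _) (norm_nonneg _))
  · have := h2 ξ
    rw [pow_one, norm_iteratedFDeriv_zero] at this
    exact this.trans (le_max_right _ _)

/-- The dyadic sums of a function vanishing linearly at `0` and decaying like `1/|ξ|` at infinity
are uniformly bounded. -/
lemma sum_min_dyadic_le {t : ℝ} (N : ℕ) (a : ℕ → ℝ) {C : ℝ} (hC : 0 < C)
    (h1 : ∀ i, a i ≤ C * (((2 : ℝ) ^ i)⁻¹ * t)) (h2 : ∀ i, (((2 : ℝ) ^ i)⁻¹ * t) * a i ≤ C) :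
    ∑ i ∈ Finset.range N, a i ≤ 4 * C := by
  rcases le_or_gt t 1 with h | h
  · calc ∑ i ∈ Finset.range N, a i ≤ ∑ i ∈ Finset.range N, C * (1 / 2 : ℝ) ^ i := by
          refine Finset.sum_le_sum fun i _ => (h1 i).trans ?_
          rw [one_div, inv_pow]
          refine mul_le_mul_of_nonneg_left ?_ hC.le
          exact mul_le_of_le_one_right (by positivity) h
      _ ≤ C * 2 := by
          rw [← Finset.mul_sum]
          exact mul_le_mul_of_nonneg_left (sum_geometric_two_le N) hC.le
      _ ≤ _ := by linarith
  · obtain ⟨M, hM1, hM2⟩ := exists_nat_pow_near h.le (one_lt_two (α := ℝ))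
    have hlow : ∀ i ∈ Finset.range (M + 1), a i ≤ C * (1 / 2) ^ (M - i) := by
      intro i hi
      have hi : i ≤ M := Nat.lt_succ_iff.1 (Finset.mem_range.1 hi)
      have h3 : (2 : ℝ) ^ (M - i) ≤ ((2 : ℝ) ^ i)⁻¹ * t := by
        rw [le_inv_mul_iff₀ (by positivity), ← pow_add, Nat.add_sub_cancel' hi]
        exact hM1
      rcases le_or_gt (a i) 0 with h0 | h0
      · exact h0.trans (by positivity)
      · have h4 := (mul_le_mul_of_nonneg_right h3 h0.le).trans (h2 i)
        rw [one_div, inv_pow, ← div_eq_mul_inv, le_div_iff₀ (by positivity)]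
        linarith
    have hhigh : ∀ i, a (M + 1 + i) ≤ C * (1 / 2) ^ i := by
      intro i
      refine (h1 _).trans (mul_le_mul_of_nonneg_left ?_ hC.le)
      rw [inv_mul_le_iff₀ (by positivity), pow_add, mul_assoc, ← mul_pow]
      norm_num
      exact hM2.le
    have hb : ∀ N, ∑ i ∈ Finset.range N, max (a i) 0 ≤ 4 * C := by
      have hmax : ∀ i b, 0 ≤ b → a i ≤ b → max (a i) 0 ≤ b := fun i b hb h => max_le h hb
      have hN : ∀ N, ∑ i ∈ Finset.range (M + 1 + N), max (a i) 0 ≤ 4 * C := by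
        intro N
        rw [Finset.sum_range_add]
        have e1 : ∑ i ∈ Finset.range (M + 1), max (a i) 0 ≤ C * 2 := by
          calc _ ≤ ∑ i ∈ Finset.range (M + 1), C * (1 / 2 : ℝ) ^ (M - i) :=
                Finset.sum_le_sum fun i hi => hmax i _ (by positivity) (hlow i hi)
            _ = ∑ i ∈ Finset.range (M + 1), C * (1 / 2 : ℝ) ^ i := by
                rw [← Finset.sum_range_reflect]
                refine Finset.sum_congr rfl fun i hi => ?_
                have hi := Finset.mem_range.1 hi
                congr 2
                omega
            _ ≤ C * 2 := by
                rw [← Finset.mul_sum]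
                exact mul_le_mul_of_nonneg_left (sum_geometric_two_le _) hC.le
        have e2 : ∑ i ∈ Finset.range N, max (a (M + 1 + i)) 0 ≤ C * 2 := by
          calc _ ≤ ∑ i ∈ Finset.range N, C * (1 / 2 : ℝ) ^ i :=
                Finset.sum_le_sum fun i _ => hmax _ _ (by positivity) (hhigh i)
            _ ≤ C * 2 := by
                rw [← Finset.mul_sum]
                exact mul_le_mul_of_nonneg_left (sum_geometric_two_le _) hC.le
        linarith
      intro N
      refine le_trans (Finset.sum_le_sum_of_subset_of_nonneg
        (Finset.range_mono (?_ : N ≤ M + 1 + N))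
        fun i _ _ => le_max_right _ _) (hN N)
      omega
    exact (Finset.sum_le_sum fun i _ => le_max_left _ _).trans (hb N)

lemma eLpNorm_two_eq {f : Euc n → ℝ} (hf : MemLp f 2) :
    eLpNorm f 2 = ENNReal.ofReal (√(∫ x, f x ^ 2)) := by
  rw [hf.eLpNorm_eq_integral_rpow_norm two_ne_zero ENNReal.ofNat_ne_top, Real.sqrt_eq_rpow]
  simp

lemma eLpNorm_conv_le {φ g : Euc n → ℝ} (hφ : IsTestFun n φ) (hg : IsTestFun n g)
    {C : ℝ} (hC : 0 ≤ C) {p : ℕ}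
    (h : ∀ ξ, ‖𝓕 (testSchwartz hφ) ξ‖ ≤ C * ‖ξ‖ ^ p) :
    eLpNorm (conv φ g) 2 ≤
      ENNReal.ofReal (C * √(∫ ξ, (‖ξ‖ ^ p * ‖𝓕 (testSchwartz hg) ξ‖) ^ 2)) := by
  rw [eLpNorm_two_eq (memLp_conv_testFun hφ hg), integral_sq_conv hφ hg]
  refine ENNReal.ofReal_le_ofReal ?_
  rw [← Real.sqrt_sq hC, ← Real.sqrt_mul (sq_nonneg C), ← integral_const_mul]
  refine Real.sqrt_le_sqrt (integral_mono_of_nonneg (ae_of_all _ fun ξ => by positivity) ?_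
    (ae_of_all _ fun ξ => ?_))
  · obtain ⟨D, hD0, hD⟩ := (𝓕 (testSchwartz hg)).decay p 0
    refine Integrable.const_mul ?_ _
    have hi := (𝓕 (testSchwartz hg)).integrable_pow_mul volume p
    refine (hi.const_mul D).mono' ?_ (ae_of_all _ fun ξ => ?_)
    · have := (𝓕 (testSchwartz hg)).continuous
      exact (by fun_prop : Continuous fun ξ => (‖ξ‖ ^ p * ‖𝓕 (testSchwartz hg) ξ‖) ^ 2
        ).aestronglyMeasurable
    · have := hD ξ
      rw [norm_iteratedFDeriv_zero] at this
      rw [Real.norm_of_nonneg (by positivity), sq]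
      exact mul_le_mul_of_nonneg_right this (by positivity)
  · have := h ξ
    calc (‖𝓕 (testSchwartz hφ) ξ‖ * ‖𝓕 (testSchwartz hg) ξ‖) ^ 2
        ≤ (C * ‖ξ‖ ^ p * ‖𝓕 (testSchwartz hg) ξ‖) ^ 2 := by gcongr
      _ = C ^ 2 * (‖ξ‖ ^ p * ‖𝓕 (testSchwartz hg) ξ‖) ^ 2 := by ring

/-- The `N`-th partial sum of dyadic dilations. -/
def dyadSum (Φ : Euc n → ℝ) (N : ℕ) (z : Euc n) : ℝ := ∑ i ∈ Finset.range N, dyad Φ i z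

lemma IsTestFun.dyadSum {Φ : Euc n → ℝ} (hΦ : IsTestFun n Φ) (N : ℕ) :
    IsTestFun n (dyadSum Φ N) := by
  induction N with
  | zero =>
    have h : _root_.dyadSum Φ 0 = fun _ => (0 : ℝ) := by funext z; simp [_root_.dyadSum]
    rw [h]
    exact ⟨contDiff_const, HasCompactSupport.zero⟩
  | succ N ih =>
    have h : _root_.dyadSum Φ (N + 1) = _root_.dyadSum Φ N + _root_.dyad Φ N := by
      funext z; simp [_root_.dyadSum, Finset.sum_range_succ]
    rw [h]
    exact ⟨ih.1.add (hΦ.dyad N).1, ih.2.add (hΦ.dyad N).2⟩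

lemma fourier_dyadSum {Φ : Euc n → ℝ} (hΦ : IsTestFun n Φ) (N : ℕ) (ξ : Euc n) :
    𝓕 (testSchwartz (hΦ.dyadSum N)) ξ =
      ∑ i ∈ Finset.range N, 𝓕 (testSchwartz hΦ) (((2 : ℝ) ^ i)⁻¹ • ξ) := by
  have h : testSchwartz (hΦ.dyadSum N) =
      ∑ i ∈ Finset.range N, testSchwartz (hΦ.dyad i) := by
    ext x
    rw [_root_.sum_apply]
    simp [testSchwartz_apply, dyadSum]
  rw [h, FourierTransform.fourier_sum, _root_.sum_apply]
  exact Finset.sum_congr rfl fun i _ => fourier_dyad hΦ i ξ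

/-- The convolutions with dyadic sums of a mean-zero test function are uniformly bounded
in `L²`. -/
lemma exists_eLpNorm_conv_dyadSum_le {Φ : Euc n → ℝ} (hΦ : IsTestFun n Φ)
    (h0 : ∫ x, Φ x = 0) :
    ∃ C : ℝ, 0 < C ∧ ∀ N (g : Euc n → ℝ), IsTestFun n g →
      eLpNorm (conv (dyadSum Φ N) g) 2 ≤ ENNReal.ofReal C * eLpNorm g 2 := by
  obtain ⟨C, hC, h⟩ := exists_norm_fourier_le hΦ h0
  refine ⟨4 * C, by positivity, fun N g hg => ?_⟩
  have hb : ∀ ξ, ‖𝓕 (testSchwartz (hΦ.dyadSum N)) ξ‖ ≤ 4 * C * ‖ξ‖ ^ 0 := fun ξ => by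
    rw [fourier_dyadSum, pow_zero, mul_one]
    refine (norm_sum_le _ _).trans (sum_min_dyadic_le (t := ‖ξ‖) N _ hC (fun i => ?_) fun i => ?_)
    · have := (h (((2 : ℝ) ^ i)⁻¹ • ξ)).1
      rwa [norm_smul, norm_inv, norm_pow, Real.norm_two] at this
    · have := (h (((2 : ℝ) ^ i)⁻¹ • ξ)).2
      rwa [norm_smul, norm_inv, norm_pow, Real.norm_two] at this
  refine (eLpNorm_conv_le (hΦ.dyadSum N) hg (by positivity) hb).trans ?_
  have hm : MemLp g 2 := hg.continuous.memLp_of_hasCompactSupport hg.2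
  rw [eLpNorm_two_eq hm, ← ENNReal.ofReal_mul (by positivity)]
  simp only [pow_zero, one_mul]
  rw [integral_norm_sq_testSchwartz hg]

/-- Dyadic convolution of a test function decays geometrically in `L²`. -/
lemma exists_eLpNorm_conv_dyad_le {Φ g : Euc n → ℝ} (hΦ : IsTestFun n Φ)
    (h0 : ∫ x, Φ x = 0) (hg : IsTestFun n g) :
    ∃ C : ℝ, 0 ≤ C ∧ ∀ i, eLpNorm (conv (dyad Φ i) g) 2 ≤ ENNReal.ofReal (C * (1 / 2) ^ i) := by
  obtain ⟨C, hC, h⟩ := exists_norm_fourier_le hΦ h0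
  refine ⟨C * √(∫ ξ, (‖ξ‖ ^ 1 * ‖𝓕 (testSchwartz hg) ξ‖) ^ 2), by positivity, fun i => ?_⟩
  refine (eLpNorm_conv_le (C := C * (1 / 2) ^ i) (p := 1) (hΦ.dyad i) hg (by positivity)
    fun ξ => ?_).trans (le_of_eq (by congr 1; ring))
  rw [fourier_dyad]
  refine ((h _).1).trans (le_of_eq ?_)
  rw [norm_smul, norm_inv, norm_pow, Real.norm_two, one_div, inv_pow]
  ring

end Plancherel

noncomputable section LebesguePoints

variable {G : Type*} [NormedAddCommGroup G] [NormedSpace ℝ G] {n : ℕ}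

lemma tendsto_half_pow_mul {R : ℝ} (hR : 0 < R) :
    Tendsto (fun i : ℕ => R * (1 / 2 : ℝ) ^ i) atTop (𝓝[>] 0) := by
  refine tendsto_nhdsWithin_iff.2 ⟨?_, Eventually.of_forall fun i => ?_⟩
  · have := (tendsto_pow_atTop_nhds_zero_of_lt_one (r := (1 / 2 : ℝ)) (by norm_num)
      (by norm_num)).const_mul R
    simpa using this
  · exact Set.mem_Ioi.2 (by positivity)

/-- Almost every point is a Lebesgue point along dyadic balls. -/
lemma ae_tendsto_dyadic_average {h : Euc n → G} (hh : LocallyIntegrable h volume) {R : ℝ}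
    (hR : 0 < R) :
    ∀ᵐ x ∂(volume : Measure (Euc n)), Tendsto (fun i : ℕ => ((2 : ℝ) ^ i) ^ n *
      ∫ y in closedBall x (R * (1 / 2) ^ i), ‖h y - h x‖) atTop (𝓝 0) := by
  filter_upwards [IsUnifLocDoublingMeasure.ae_tendsto_average_norm_sub
    (volume : Measure (Euc n)) hh 1] with x hx
  have h1 := hx (fun _ : ℕ => x) (fun i => R * (1 / 2) ^ i) (tendsto_half_pow_mul hR)
    (Eventually.of_forall fun i => mem_closedBall_self (by positivity))
  have h2 := h1.const_mul (R ^ n * volume.real (ball (0 : Euc n) 1))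
  rw [mul_zero] at h2
  refine h2.congr fun i => ?_
  have hv : volume.real (closedBall x (R * (1 / 2) ^ i)) =
      (R * (1 / 2) ^ i) ^ n * volume.real (ball (0 : Euc n) 1) := by
    rw [Measure.real, Measure.addHaar_closedBall _ _ (by positivity),
      ENNReal.toReal_mul, ENNReal.toReal_ofReal (by positivity), finrank_euclideanSpace_fin,
      ← Measure.real]
  rw [setAverage_eq, smul_eq_mul, hv]
  have hb : 0 < volume.real (ball (0 : Euc n) 1) :=
    ENNReal.toReal_pos (measure_ball_pos _ _ one_pos).ne' measure_ball_lt_top.ne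
  rw [mul_pow, one_div, inv_pow, inv_pow]
  have : (0 : ℝ) < (2 ^ i) ^ n := by positivity
  field_simp

/-- Integrals against a bounded kernel supported in a ball. -/
lemma norm_integral_le_mul_integral_closedBall {H : Type*} [NormedAddCommGroup H] [NormedSpace ℝ H]
    {μ : Measure (Euc n)} {F : Euc n → H} {f : Euc n → G}
    {B ρ : ℝ} {x : Euc n} (hf : IntegrableOn f (closedBall x ρ) μ)
    (h1 : ∀ y ∈ closedBall x ρ, ‖F y‖ ≤ B * ‖f y‖) (h2 : ∀ y ∉ closedBall x ρ, F y = 0) :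
    ‖∫ y, F y ∂μ‖ ≤ B * ∫ y in closedBall x ρ, ‖f y‖ ∂μ := by
  rw [← setIntegral_eq_integral_of_forall_compl_eq_zero (s := closedBall x ρ) h2,
    ← integral_const_mul]
  exact norm_integral_le_of_norm_le (hf.norm.const_mul B)
    (ae_restrict_of_forall_mem measurableSet_closedBall h1)

lemma tendsto_sum_geometric_mul {m : ℕ → ℝ} (hm : Tendsto m atTop (𝓝 0)) :
    Tendsto (fun N => ∑ i ∈ Finset.range N, (1 / 2 : ℝ) ^ (N - i) * m i) atTop (𝓝 0) := by
  set a : ℕ → ℝ := fun N => ∑ i ∈ Finset.range N, (1 / 2 : ℝ) ^ (N - i) * m i with ha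
  have hrec : ∀ N, a (N + 1) = (a N + m N) / 2 := fun N => by
    simp only [ha]
    rw [Finset.sum_range_succ, add_tsub_cancel_left, add_div, Finset.sum_div]
    congr 1
    · refine Finset.sum_congr rfl fun i hi => ?_
      rw [Nat.succ_sub (Finset.mem_range.1 hi).le, pow_succ]
      ring
    · ring
  rw [Metric.tendsto_atTop]
  intro ε hε
  obtain ⟨N₀, hN₀⟩ := Metric.tendsto_atTop.1 hm (ε / 2) (by positivity)
  have hb : ∀ l, |a (N₀ + l)| ≤ (1 / 2) ^ l * |a N₀| + ε / 2 := by
    intro l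
    induction l with
    | zero => simp; positivity
    | succ l ih =>
      rw [← add_assoc, hrec, abs_div, abs_two]
      have := hN₀ (N₀ + l) (by omega)
      rw [Real.dist_eq, sub_zero] at this
      have h3 := abs_add_le (a (N₀ + l)) (m (N₀ + l))
      rw [pow_succ]
      linarith
  have ht : Tendsto (fun l : ℕ => (1 / 2 : ℝ) ^ l * |a N₀|) atTop (𝓝 0) := by
    simpa using (tendsto_pow_atTop_nhds_zero_of_lt_one (r := (1 / 2 : ℝ)) (by norm_num)
      (by norm_num)).mul_const |a N₀|
  obtain ⟨L, hL⟩ := Metric.tendsto_atTop.1 ht (ε / 2) (by positivity)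
  refine ⟨N₀ + L, fun N hN => ?_⟩
  obtain ⟨l, rfl⟩ := Nat.exists_eq_add_of_le (show N₀ ≤ N by omega)
  have h4 := hL l (by omega)
  rw [Real.dist_eq, sub_zero] at h4 ⊢
  have := hb l
  linarith [le_abs_self ((1 / 2 : ℝ) ^ l * |a N₀|)]

end LebesguePoints

noncomputable section Conv

variable {n : ℕ} {φ ψ g : Euc n → ℝ}

lemma integrable_kernel_mul (hφ : Continuous φ) (hφ' : HasCompactSupport φ)
    (hg : LocallyIntegrable g volume) (x : Euc n) :
    Integrable (fun y => φ (x - y) * g y) := by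
  have h := hg.integrable_smul_left_of_hasCompactSupport
    (hφ.comp (continuous_const.sub continuous_id : Continuous fun y : Euc n => x - y))
    (hφ'.comp_homeomorph (Homeomorph.subLeft x))
  simpa using h

lemma conv_eq_convolution (x : Euc n) :
    conv φ g x = convolution g φ (ContinuousLinearMap.mul ℝ ℝ) volume x := by
  rw [convolution_def, conv]
  congr 1
  funext y
  simp [mul_comm]

lemma conv_comm (φ g : Euc n → ℝ) (x : Euc n) : conv φ g x = conv g φ x := by
  rw [conv, conv, ← integral_sub_left_eq_self (fun y => φ (x - y) * g y) volume x]
  congr 1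
  funext y
  rw [sub_sub_cancel, mul_comm]

lemma conv_conv (hφ : IsTestFun n φ) (hψ : IsTestFun n ψ) (hg : LocallyIntegrable g volume)
    (x : Euc n) : conv φ (conv ψ g) x = conv (conv φ ψ) g x := by
  have h1 : ∀ f f' : Euc n → ℝ, conv f f' = convolution f' f (ContinuousLinearMap.mul ℝ ℝ) volume :=
    fun f f' => funext fun x => conv_eq_convolution x
  rw [h1, h1, h1, h1]
  refine convolution_assoc _ _ _ _ (fun a b c => ?_) hg.aestronglyMeasurable
    hψ.continuous.aestronglyMeasurable hφ.continuous.aestronglyMeasurable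
    (Eventually.of_forall fun y => ?_) (Eventually.of_forall fun y => ?_) ?_
  · simp [mul_assoc]
  · exact hψ.2.convolutionExists_right _ hg hψ.continuous y
  · exact hφ.2.norm.convolutionExists_right _ hψ.continuous.norm.locallyIntegrable
      hφ.continuous.norm y
  · refine HasCompactSupport.convolutionExists_right _ ?_ (fun y => (hg y).norm) ?_ x
    · exact hψ.2.norm.convolution _ hφ.2.norm
    · exact hφ.2.norm.continuous_convolution_right _ hψ.continuous.norm.locallyIntegrable
        hφ.continuous.norm

lemma continuous_conv (hφ : IsTestFun n φ) (hg : LocallyIntegrable g volume) :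
    Continuous (conv φ g) := by
  have : conv φ g = convolution g φ (ContinuousLinearMap.mul ℝ ℝ) volume :=
    funext fun x => conv_eq_convolution x
  rw [this]
  exact hφ.2.continuous_convolution_right _ hg hφ.continuous

lemma conv_sub_right (hφ : IsTestFun n φ) {g' : Euc n → ℝ} (hg : LocallyIntegrable g volume)
    (hg' : LocallyIntegrable g' volume) (x : Euc n) :
    conv φ (g - g') x = conv φ g x - conv φ g' x := by
  rw [conv, conv, conv, ← integral_sub (integrable_kernel_mul hφ.continuous hφ.2 hg x)
    (integrable_kernel_mul hφ.continuous hφ.2 hg' x)]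
  simp [mul_sub]

lemma conv_dyadSum {Φ : Euc n → ℝ} (hΦ : IsTestFun n Φ) (hg : LocallyIntegrable g volume) (N : ℕ)
    (x : Euc n) :
    conv (dyadSum Φ N) g x = ∑ i ∈ Finset.range N, conv (dyad Φ i) g x := by
  simp only [conv, dyadSum, Finset.sum_mul]
  exact integral_finsetSum _ fun i _ =>
    integrable_kernel_mul (hΦ.dyad i).continuous (hΦ.dyad i).2 hg x

/-- Convolution with a fixed test function is pointwise continuous in `L²`. -/
lemma enorm_conv_le (hφ : IsTestFun n φ) (hg : AEStronglyMeasurable g volume) (x : Euc n) :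
    ‖conv φ g x‖ₑ ≤ eLpNorm φ 2 * eLpNorm g 2 := by
  have hm : MeasurePreserving (fun y : Euc n => x - y) volume volume :=
    Measure.measurePreserving_sub_left volume x
  have h1 : eLpNorm (fun y => φ (x - y)) 2 = eLpNorm φ 2 :=
    eLpNorm_comp_measurePreserving hφ.continuous.aestronglyMeasurable hm
  rw [← h1]
  refine le_trans ?_ (eLpNorm_smul_le_mul_eLpNorm (r := 1) hg
    (hφ.continuous.comp (continuous_const.sub continuous_id)).aestronglyMeasurable)
  rw [eLpNorm_one_eq_lintegral_enorm]
  exact enorm_integral_le_lintegral_enorm _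

lemma tendsto_conv_of_tendsto_eLpNorm (hφ : IsTestFun n φ) {ι : Type*} {l : Filter ι}
    {f : ι → Euc n → ℝ} (hf : ∀ i, MemLp (f i) 2) (hg : MemLp g 2)
    (h : Tendsto (fun i => eLpNorm (f i - g) 2) l (𝓝 0)) (x : Euc n) :
    Tendsto (fun i => conv φ (f i) x) l (𝓝 (conv φ g x)) := by
  rw [tendsto_iff_edist_tendsto_0]
  have h2 : Tendsto (fun i => eLpNorm φ 2 * eLpNorm (f i - g) 2) l (𝓝 0) := by
    have := ENNReal.Tendsto.const_mul (a := eLpNorm φ 2) h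
      (Or.inr (hφ.continuous.memLp_of_hasCompactSupport hφ.2 (p := 2)).2.ne)
    rwa [mul_zero] at this
  refine tendsto_of_tendsto_of_tendsto_of_le_of_le tendsto_const_nhds h2 (fun _ => zero_le) ?_
  intro i
  have h3 := enorm_conv_le hφ ((hf i).1.sub hg.1) x
  rwa [conv_sub_right hφ ((hf i).locallyIntegrable (by norm_num))
    (hg.locallyIntegrable (by norm_num)), ← edist_eq_enorm_sub] at h3

lemma exists_testFun_seq (hg : MemLp g 2) :
    ∃ f : ℕ → Euc n → ℝ, (∀ i, IsTestFun n (f i)) ∧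
      Tendsto (fun i => eLpNorm (f i - g) 2) atTop (𝓝 0) := by
  have h : ∀ i : ℕ, ∃ f : Euc n → ℝ, IsTestFun n f ∧
      eLpNorm (f - g) 2 ≤ ENNReal.ofReal (1 / ((i : ℝ) + 1)) := fun i => by
    obtain ⟨f, h1, h2, h3⟩ := hg.exist_eLpNorm_sub_le (by norm_num) (by norm_num)
      (ε := 1 / ((i : ℝ) + 1)) (by positivity)
    exact ⟨f, ⟨h2, h1⟩, by rwa [eLpNorm_sub_comm]⟩
  choose f hf1 hf2 using h
  refine ⟨f, hf1, ?_⟩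
  have h0 : Tendsto (fun i : ℕ => ENNReal.ofReal (1 / ((i : ℝ) + 1))) atTop (𝓝 0) := by
    rw [← ENNReal.ofReal_zero]
    exact (ENNReal.continuous_ofReal.tendsto _).comp tendsto_one_div_add_atTop_nhds_zero_nat
  exact tendsto_of_tendsto_of_tendsto_of_le_of_le tendsto_const_nhds h0 (fun _ => zero_le) hf2

/-- The uniform `L²` bound of dyadic sums on all of `L²`. -/
lemma exists_eLpNorm_conv_dyadSum_le_of_memLp {Φ : Euc n → ℝ} (hΦ : IsTestFun n Φ)
    (h0 : ∫ x, Φ x = 0) :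
    ∃ C : ℝ, 0 < C ∧ ∀ N (g : Euc n → ℝ), MemLp g 2 →
      eLpNorm (conv (dyadSum Φ N) g) 2 ≤ ENNReal.ofReal C * eLpNorm g 2 := by
  obtain ⟨C, hC, h⟩ := exists_eLpNorm_conv_dyadSum_le hΦ h0
  refine ⟨C, hC, fun N g hg => ?_⟩
  obtain ⟨f, hf, hfg⟩ := exists_testFun_seq hg
  have hm : ∀ i, MemLp (f i) 2 := fun i => (hf i).continuous.memLp_of_hasCompactSupport (hf i).2
  have h2 : Tendsto (fun i => ENNReal.ofReal C * (eLpNorm (f i - g) 2 + eLpNorm g 2)) atTop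
      (𝓝 (ENNReal.ofReal C * (0 + eLpNorm g 2))) :=
    ENNReal.Tendsto.const_mul (hfg.add_const _) (Or.inr ENNReal.ofReal_ne_top)
  rw [zero_add] at h2
  have h3 : ∀ i, eLpNorm (conv (dyadSum Φ N) (f i)) 2 ≤
      ENNReal.ofReal C * (eLpNorm (f i - g) 2 + eLpNorm g 2) := fun i => by
    refine (h N (f i) (hf i)).trans ?_
    gcongr
    have h5 : eLpNorm ((f i - g) + g) 2 ≤ eLpNorm (f i - g) 2 + eLpNorm g 2 :=
      eLpNorm_add_le ((hm i).1.sub hg.1) hg.1 (by norm_num)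
    rwa [sub_add_cancel] at h5
  have h4 : liminf (fun i => eLpNorm (conv (dyadSum Φ N) (f i)) 2) atTop ≤
      ENNReal.ofReal C * eLpNorm g 2 :=
    (liminf_le_liminf (Eventually.of_forall h3)).trans h2.liminf_eq.le
  refine le_trans ?_ h4
  refine Lp.eLpNorm_lim_le_liminf_eLpNorm (fun i => ?_) _ (Eventually.of_forall fun x => ?_)
  · exact (continuous_conv (hΦ.dyadSum N)
      (hf i).continuous.locallyIntegrable).aestronglyMeasurable
  · exact tendsto_conv_of_tendsto_eLpNorm (hΦ.dyadSum N) hm hg hfg x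

lemma memLp_conv_dyadSum {Φ : Euc n → ℝ} (hΦ : IsTestFun n Φ) (h0 : ∫ x, Φ x = 0)
    (hg : MemLp g 2) (N : ℕ) : MemLp (conv (dyadSum Φ N) g) 2 := by
  obtain ⟨C, hC, h⟩ := exists_eLpNorm_conv_dyadSum_le_of_memLp hΦ h0
  refine ⟨(continuous_conv (hΦ.dyadSum N)
    (hg.locallyIntegrable (by norm_num))).aestronglyMeasurable, ?_⟩
  exact (h N g hg).trans_lt (ENNReal.mul_lt_top ENNReal.ofReal_lt_top hg.2)

/-- The dyadic sums converge in `L²`. -/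
lemma exists_tendsto_eLpNorm_conv_dyadSum {Φ : Euc n → ℝ} (hΦ : IsTestFun n Φ)
    (h0 : ∫ x, Φ x = 0) (hg : MemLp g 2) :
    ∃ h : Euc n → ℝ, MemLp h 2 ∧
      Tendsto (fun N => eLpNorm (conv (dyadSum Φ N) g - h) 2) atTop (𝓝 0) := by
  obtain ⟨C, hC, hCb⟩ := exists_eLpNorm_conv_dyadSum_le_of_memLp hΦ h0
  have hT := memLp_conv_dyadSum hΦ h0 hg
  have hcau : CauchySeq fun N => (hT N).toLp (conv (dyadSum Φ N) g) := by
    rw [EMetric.cauchySeq_iff']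
    intro ε hε
    obtain ⟨δ, hδ, hδε⟩ : ∃ δ : ℝ, 0 < δ ∧ ENNReal.ofReal ((2 * C + 1) * δ) < ε := by
      rcases eq_or_ne ε ⊤ with rfl | hε'
      · exact ⟨1, one_pos, ENNReal.ofReal_lt_top⟩
      · have hp := ENNReal.toReal_pos hε.ne' hε'
        refine ⟨ε.toReal / (2 * (2 * C + 1)), by positivity, ?_⟩
        rw [ENNReal.ofReal_lt_iff_lt_toReal (by positivity) hε']
        field_simp
        linarith
    obtain ⟨f, hf2, hf1, hf3⟩ := hg.exist_eLpNorm_sub_le (by norm_num) (by norm_num) hδ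
    have hf : IsTestFun n f := ⟨hf1, hf2⟩
    have hfm : MemLp f 2 := hf.continuous.memLp_of_hasCompactSupport hf.2
    obtain ⟨D, hD, hDb⟩ := exists_eLpNorm_conv_dyad_le hΦ h0 hf
    have ht : Tendsto (fun l : ℕ => D * (2 * (1 / 2 : ℝ) ^ l)) atTop (𝓝 0) := by
      simpa using ((tendsto_pow_atTop_nhds_zero_of_lt_one (r := (1 / 2 : ℝ)) (by norm_num)
        (by norm_num)).const_mul 2).const_mul D
    obtain ⟨N, hN⟩ := (ht.eventually (gt_mem_nhds hδ)).exists
    refine ⟨N, fun M hM => ?_⟩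
    rw [Lp.edist_toLp_toLp]
    have hgl : LocallyIntegrable g volume := hg.locallyIntegrable (by norm_num)
    have hfl : LocallyIntegrable f volume := hf.continuous.locallyIntegrable
    have hcf : ∀ K, eLpNorm (conv (dyadSum Φ K) g - conv (dyadSum Φ K) f) 2 ≤
        ENNReal.ofReal (C * δ) := fun K => by
      have : conv (dyadSum Φ K) g - conv (dyadSum Φ K) f = conv (dyadSum Φ K) (g - f) := by
        funext x
        exact (conv_sub_right (hΦ.dyadSum K) hgl hfl x).symm
      rw [this, ENNReal.ofReal_mul hC.le]
      exact (hCb K _ (hg.sub hfm)).trans (mul_le_mul_right hf3 _)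
    have hsum : ∀ l, eLpNorm (conv (dyadSum Φ (N + l)) f - conv (dyadSum Φ N) f) 2 ≤
        ENNReal.ofReal (D * ∑ i ∈ Finset.range l, (1 / 2 : ℝ) ^ (N + i)) := by
      intro l
      induction l with
      | zero => simp
      | succ l ih =>
        have : conv (dyadSum Φ (N + (l + 1))) f - conv (dyadSum Φ N) f =
            (conv (dyadSum Φ (N + l)) f - conv (dyadSum Φ N) f) + conv (dyad Φ (N + l)) f := by
          funext x
          simp only [Pi.sub_apply, Pi.add_apply]
          rw [← add_assoc, conv_dyadSum hΦ hfl (N + l + 1), Finset.sum_range_succ,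
            ← conv_dyadSum hΦ hfl]
          ring
        rw [this, Finset.sum_range_succ, mul_add, ENNReal.ofReal_add (by positivity)
          (by positivity)]
        refine (eLpNorm_add_le ?_ ?_ (by norm_num)).trans (add_le_add ih (hDb _))
        · exact ((continuous_conv (hΦ.dyadSum _) hfl).sub
            (continuous_conv (hΦ.dyadSum _) hfl)).aestronglyMeasurable
        · exact (continuous_conv (hΦ.dyad _) hfl).aestronglyMeasurable
    obtain ⟨l, rfl⟩ := Nat.exists_eq_add_of_le hM
    have hs : D * ∑ i ∈ Finset.range l, (1 / 2 : ℝ) ^ (N + i) ≤ δ := by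
      refine le_trans (mul_le_mul_of_nonneg_left ?_ hD) hN.le
      simp_rw [pow_add]
      rw [← Finset.mul_sum, mul_comm]
      exact mul_le_mul_of_nonneg_right (sum_geometric_two_le _) (by positivity)
    refine lt_of_le_of_lt ?_ hδε
    have hdec : conv (dyadSum Φ (N + l)) g - conv (dyadSum Φ N) g =
        ((conv (dyadSum Φ (N + l)) g - conv (dyadSum Φ (N + l)) f) -
          (conv (dyadSum Φ N) g - conv (dyadSum Φ N) f)) +
          (conv (dyadSum Φ (N + l)) f - conv (dyadSum Φ N) f) := by
      funext x; simp only [Pi.sub_apply, Pi.add_apply]; ring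
    have hc := fun K => continuous_conv (hΦ.dyadSum K) hgl
    have hc' := fun K => continuous_conv (hΦ.dyadSum K) hfl
    rw [hdec]
    refine (eLpNorm_add_le (((hc _).sub (hc' _)).sub ((hc _).sub (hc' _))).aestronglyMeasurable
      ((hc' _).sub (hc' _)).aestronglyMeasurable (by norm_num)).trans ?_
    refine (add_le_add ((eLpNorm_sub_le ((hc _).sub (hc' _)).aestronglyMeasurable
      ((hc _).sub (hc' _)).aestronglyMeasurable (by norm_num)).trans
      (add_le_add (hcf _) (hcf _))) ((hsum l).trans (ENNReal.ofReal_le_ofReal hs))).trans ?_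
    rw [← ENNReal.ofReal_add (by positivity) (by positivity),
      ← ENNReal.ofReal_add (by positivity) (by positivity)]
    exact ENNReal.ofReal_le_ofReal (by linarith)
  obtain ⟨h, hh⟩ := cauchySeq_tendsto_of_complete hcau
  refine ⟨h, Lp.memLp h, ?_⟩
  rw [tendsto_iff_edist_tendsto_0] at hh
  refine hh.congr fun N => ?_
  rw [Lp.edist_def]
  exact eLpNorm_congr_ae ((hT N).coeFn_toLp.sub (ae_eq_refl _))

end Conv

noncomputable section PointwiseConv

variable {n : ℕ} {φ ψ g : Euc n → ℝ}

lemma abs_conv_dyad_sub_le (hφ : IsTestFun n φ) (hψ : IsTestFun n ψ) {C R : ℝ} (hC : 0 < C)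
    (hψC : ∀ z w, ‖ψ z - ψ w‖ ≤ C * ‖z - w‖) (hφR : ∀ z, φ z ≠ 0 → ‖z‖ ≤ R)
    {a b : ℕ} (hab : b ≤ a) (z : Euc n) :
    |conv (dyad φ a) (dyad ψ b) z - (∫ y, φ y) * dyad ψ b z| ≤
      ((2 : ℝ) ^ b) ^ n * ((∫ y, |φ y|) * (C * R) * (1 / 2) ^ (a - b)) := by
  have hi := integrable_kernel_mul (hψ.dyad b).continuous (hψ.dyad b).2
    (hφ.dyad a).continuous.locallyIntegrable z
  rw [conv_comm, conv, ← integral_dyad φ a, mul_comm (∫ y, dyad φ a y), ← integral_const_mul,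
    ← integral_sub hi ((hφ.dyad a).integrable.const_mul _), ← Real.norm_eq_abs]
  have habs : ∫ y, |dyad φ a y| = ∫ y, |φ y| := by
    rw [← integral_dyad (fun y => |φ y|) a]
    congr 1
    funext y
    simp only [dyad, smul_eq_mul, abs_mul, abs_pow, abs_two]
  have hbd : ∀ y, ‖dyad ψ b (z - y) * dyad φ a y - dyad ψ b z * dyad φ a y‖ ≤
      ((2 : ℝ) ^ b) ^ n * ((C * R) * (1 / 2) ^ (a - b)) * |dyad φ a y| := fun y => by
    rw [← sub_mul, norm_mul, Real.norm_eq_abs (dyad φ a y)]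
    rcases eq_or_ne (dyad φ a y) 0 with h0 | h0
    · simp [h0]
    refine mul_le_mul_of_nonneg_right ?_ (abs_nonneg _)
    refine (norm_dyad_sub_le hψC b _ _).trans (mul_le_mul_of_nonneg_left ?_ (by positivity))
    rw [show z - y - z = -y by abel, norm_neg]
    have h1 : 2 ^ a * ‖y‖ ≤ R := by
      by_contra! h
      exact h0 (dyad_eq_zero hφR h)
    have h2 : (2 : ℝ) ^ b * ‖y‖ = (1 / 2) ^ (a - b) * (2 ^ a * ‖y‖) := by
      conv_rhs => rw [← Nat.sub_add_cancel hab, pow_add]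
      rw [Nat.add_sub_cancel, one_div, inv_pow]
      field_simp
    rw [h2]
    calc C * ((1 / 2) ^ (a - b) * (2 ^ a * ‖y‖)) ≤ C * ((1 / 2) ^ (a - b) * R) := by gcongr
      _ = _ := by ring
  refine (norm_integral_le_of_norm_le ((hφ.dyad a).integrable.abs.const_mul _)
    (Eventually.of_forall hbd)).trans (le_of_eq ?_)
  rw [integral_const_mul, habs]
  ring

lemma conv_dyad_eq_zero {R : ℝ} (hφR : ∀ z, φ z ≠ 0 → ‖z‖ ≤ R)
    (hψR : ∀ z, ψ z ≠ 0 → ‖z‖ ≤ R) {a b : ℕ} (hab : b ≤ a) {z : Euc n}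
    (hz : 2 * R * (1 / 2) ^ b < ‖z‖) : conv (dyad φ a) (dyad ψ b) z = 0 := by
  rw [conv]
  refine integral_eq_zero_of_ae (Eventually.of_forall fun y => ?_)
  simp only [Pi.zero_apply, mul_eq_zero]
  by_contra! h
  have h1 : 2 ^ a * ‖z - y‖ ≤ R := by
    by_contra! h'
    exact h.1 (dyad_eq_zero hφR h')
  have h2 : 2 ^ b * ‖y‖ ≤ R := by
    by_contra! h'
    exact h.2 (dyad_eq_zero hψR h')
  have h3 : (2 : ℝ) ^ b * ‖z - y‖ ≤ R :=
    (mul_le_mul_of_nonneg_right (pow_le_pow_right₀ (by norm_num) hab) (norm_nonneg _)).trans h1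
  have h4 : ‖z‖ ≤ ‖z - y‖ + ‖y‖ := by simpa using norm_add_le (z - y) y
  have h5 : 2 * R < 2 ^ b * ‖z‖ := by
    have := mul_lt_mul_of_pos_left hz (show (0 : ℝ) < 2 ^ b by positivity)
    have h6 : (2 : ℝ) ^ b * (1 / 2) ^ b = 1 := by rw [← mul_pow]; norm_num
    calc 2 * R = 2 ^ b * (2 * R * (1 / 2) ^ b) := by linear_combination (-2 * R) * h6
      _ < _ := this
  nlinarith [show (0 : ℝ) < 2 ^ b by positivity]

lemma abs_conv_le_of_integral_eq_zero {κ : Euc n → ℝ} (hκ : Continuous κ)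
    (hκ' : HasCompactSupport κ) (h0 : ∫ y, κ y = 0) (hg : LocallyIntegrable g volume) {B ρ : ℝ}
    (hB : ∀ z, |κ z| ≤ B) (hρ : ∀ z, ρ < ‖z‖ → κ z = 0) (x : Euc n) :
    |conv κ g x| ≤ B * ∫ y in closedBall x ρ, ‖g y - g x‖ := by
  have h1 : conv κ g x = ∫ y, κ (x - y) * (g y - g x) := by
    simp only [mul_sub]
    rw [integral_sub (integrable_kernel_mul hκ hκ' hg x), integral_mul_const,
      integral_sub_left_eq_self κ volume x, h0, zero_mul, sub_zero, conv]
    simpa [mul_comm] using (integrable_kernel_mul hκ hκ'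
      (continuous_const (y := g x)).locallyIntegrable x)
  rw [h1, ← Real.norm_eq_abs]
  refine norm_integral_le_mul_integral_closedBall (f := fun y => g y - g x) ?_ (fun y _ => ?_)
    fun y hy => ?_
  · exact (hg.integrableOn_isCompact (isCompact_closedBall _ _)).sub
      (continuous_const.continuousOn.integrableOn_compact (isCompact_closedBall _ _))
  · rw [norm_mul]
    exact mul_le_mul_of_nonneg_right (hB _) (norm_nonneg _)
  · rw [mem_closedBall, dist_eq_norm, not_le, norm_sub_rev] at hy
    rw [hρ _ hy, zero_mul]

lemma integral_conv (hφ : IsTestFun n φ) (hψ : IsTestFun n ψ) :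
    ∫ x, conv φ ψ x = (∫ x, φ x) * ∫ x, ψ x := by
  have : conv φ ψ = convolution ψ φ (ContinuousLinearMap.mul ℝ ℝ) volume :=
    funext fun x => conv_eq_convolution x
  rw [this, integral_convolution _ hψ.integrable hφ.integrable]
  simp [mul_comm]

lemma hasCompactSupport_conv (hφ : IsTestFun n φ) (hψ : IsTestFun n ψ) :
    HasCompactSupport (conv φ ψ) := by
  have : conv φ ψ = convolution ψ φ (ContinuousLinearMap.mul ℝ ℝ) volume :=
    funext fun x => conv_eq_convolution x
  rw [this]
  exact hψ.2.convolution _ hφ.2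

lemma conv_sub_left {κ κ' : Euc n → ℝ} (hκ : Continuous κ) (hκ' : HasCompactSupport κ)
    (hκ1 : Continuous κ') (hκ1' : HasCompactSupport κ') (hg : LocallyIntegrable g volume)
    (x : Euc n) : conv (κ - κ') g x = conv κ g x - conv κ' g x := by
  rw [conv, conv, conv, ← integral_sub (integrable_kernel_mul hκ hκ' hg x)
    (integrable_kernel_mul hκ1 hκ1' hg x)]
  simp [sub_mul]

lemma conv_conv_dyadSum {Φ : Euc n → ℝ} (hφ : IsTestFun n φ) (hΦ : IsTestFun n Φ)
    (hg : LocallyIntegrable g volume) (M : ℕ) (x : Euc n) :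
    conv φ (conv (dyadSum Φ M) g) x =
      ∑ i ∈ Finset.range M, conv (conv φ (dyad Φ i)) g x := by
  have h1 : conv (dyadSum Φ M) g = fun x => ∑ i ∈ Finset.range M, conv (dyad Φ i) g x :=
    funext fun x => conv_dyadSum hΦ hg M x
  rw [h1, conv]
  simp only [Finset.mul_sum]
  rw [integral_finsetSum _ fun i _ => integrable_kernel_mul hφ.continuous hφ.2
    (continuous_conv (hΦ.dyad i) hg).locallyIntegrable x]
  exact Finset.sum_congr rfl fun i _ => conv_conv hφ (hΦ.dyad i) hg x

variable (n) in
lemma exists_testFun_integral_eq_one : ∃ η : Euc n → ℝ, IsTestFun n η ∧ ∫ x, η x = 1 :=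
  ⟨(freqBump n).normed volume, ⟨(freqBump n).contDiff_normed,
   (freqBump n).hasCompactSupport_normed⟩,
    (freqBump n).integral_normed⟩

/-- Mollification converges at Lebesgue points. -/
lemma tendsto_conv_dyad {η h : Euc n → ℝ} (hη : IsTestFun n η) (hη1 : ∫ x, η x = 1) {C R : ℝ}
    (hC : ∀ z, ‖η z‖ ≤ C) (hR : ∀ z, η z ≠ 0 → ‖z‖ ≤ R) (hh : LocallyIntegrable h volume)
    {x : Euc n} (hx : Tendsto (fun i : ℕ => ((2 : ℝ) ^ i) ^ n *
      ∫ y in closedBall x (R * (1 / 2) ^ i), ‖h y - h x‖) atTop (𝓝 0)) :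
    Tendsto (fun N => conv (dyad η N) h x) atTop (𝓝 (h x)) := by
  rw [tendsto_iff_norm_sub_tendsto_zero]
  have h2 := hx.const_mul C
  rw [mul_zero] at h2
  refine squeeze_zero (fun _ => norm_nonneg _) (fun N => ?_) h2
  have hηi := (hη.dyad N)
  have h1 : conv (dyad η N) h x - h x = ∫ y, dyad η N (x - y) * (h y - h x) := by
    simp only [mul_sub]
    rw [integral_sub (integrable_kernel_mul hηi.continuous hηi.2 hh x), integral_mul_const,
      integral_sub_left_eq_self (dyad η N) volume x, integral_dyad, hη1, one_mul, conv]
    simpa [mul_comm] using (integrable_kernel_mul hηi.continuous hηi.2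
      (continuous_const (y := h x)).locallyIntegrable x)
  rw [h1, ← mul_assoc, mul_comm C]
  refine norm_integral_le_mul_integral_closedBall (f := fun y => h y - h x) ?_ (fun y _ => ?_)
    fun y hy => ?_
  · exact (hh.integrableOn_isCompact (isCompact_closedBall _ _)).sub
      (continuous_const.continuousOn.integrableOn_compact (isCompact_closedBall _ _))
  · rw [norm_mul]
    exact mul_le_mul_of_nonneg_right (norm_dyad_le hC _ _) (norm_nonneg _)
  · rw [mem_closedBall, dist_eq_norm, not_le, norm_sub_rev] at hy
    rw [dyad_eq_zero hR, zero_mul]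
    have h6 : (2 : ℝ) ^ N * (1 / 2) ^ N = 1 := by rw [← mul_pow]; norm_num
    calc R = 2 ^ N * (R * (1 / 2) ^ N) := by linear_combination (-R) * h6
      _ < _ := mul_lt_mul_of_pos_left hy (by positivity)

/-- Almost everywhere convergence of the dyadic sums for `L²` functions. -/
lemma ae_exists_tendsto_conv_dyadSum {Φ : Euc n → ℝ} (hΦ : IsTestFun n Φ)
    (h0 : ∫ x, Φ x = 0) (hg : MemLp g 2) :
    ∀ᵐ x ∂(volume : Measure (Euc n)),
      ∃ c, Tendsto (fun N => conv (dyadSum Φ N) g x) atTop (𝓝 c) := by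
  obtain ⟨h, hh, hT⟩ := exists_tendsto_eLpNorm_conv_dyadSum hΦ h0 hg
  obtain ⟨η, hη, hη1⟩ := exists_testFun_integral_eq_one n
  obtain ⟨C₁, R₁, hC₁, hR₁, hb₁, hl₁, hs₁⟩ := exists_pos_bounds hη
  obtain ⟨C₂, R₂, hC₂, hR₂, hb₂, hl₂, hs₂⟩ := exists_pos_bounds hΦ
  set R := max R₁ R₂ with hRdef
  have hR : 0 < R := by linarith [le_max_left R₁ R₂]
  replace hs₁ : ∀ z, η z ≠ 0 → ‖z‖ ≤ R := fun z hz => (hs₁ z hz).trans (le_max_left _ _)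
  replace hs₂ : ∀ z, Φ z ≠ 0 → ‖z‖ ≤ R := fun z hz => (hs₂ z hz).trans (le_max_right _ _)
  have hgl : LocallyIntegrable g volume := hg.locallyIntegrable (by norm_num)
  have hhl : LocallyIntegrable h volume := hh.locallyIntegrable (by norm_num)
  filter_upwards [ae_tendsto_dyadic_average hgl (show 0 < 2 * R by positivity),
    ae_tendsto_dyadic_average hhl hR] with x hx1 hx2
  refine ⟨h x, ?_⟩
  set m : ℕ → ℝ := fun i => ((2 : ℝ) ^ i) ^ n *
    ∫ y in closedBall x (2 * R * (1 / 2) ^ i), ‖g y - g x‖ with hm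
  have hm0 : ∀ i, 0 ≤ m i := fun i =>
    mul_nonneg (by positivity) (integral_nonneg fun _ => norm_nonneg _)
  set D₁ := (∫ y, |η y|) * (C₂ * R)
  set D₂ := (∫ y, |Φ y|) * (C₁ * R)
  have hD₁ : 0 ≤ D₁ := mul_nonneg (integral_nonneg fun _ => abs_nonneg _) (by positivity)
  have hD₂ : 0 ≤ D₂ := mul_nonneg (integral_nonneg fun _ => abs_nonneg _) (by positivity)
  have hzero : ∀ {b : ℕ} {z : Euc n}, 2 * R * (1 / 2) ^ b < ‖z‖ → R < 2 ^ b * ‖z‖ := by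
    intro b z hz
    have h6 : (2 : ℝ) ^ b * (1 / 2) ^ b = 1 := by rw [← mul_pow]; norm_num
    calc R < 2 * R := by linarith
      _ = 2 ^ b * (2 * R * (1 / 2) ^ b) := by linear_combination (-2 * R) * h6
      _ < _ := mul_lt_mul_of_pos_left hz (by positivity)
  have low : ∀ N, ∀ i < N, |conv (dyad Φ i) g x - conv (conv (dyad η N) (dyad Φ i)) g x| ≤
      D₁ * ((1 / 2) ^ (N - i) * m i) := by
    intro N i hi
    have ht := hΦ.dyad i
    have hcc := continuous_conv (hη.dyad N) ht.continuous.locallyIntegrable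
    have hcs := hasCompactSupport_conv (hη.dyad N) ht
    rw [← conv_sub_left ht.continuous ht.2 hcc hcs hgl]
    have h1 := abs_conv_le_of_integral_eq_zero (κ := dyad Φ i - conv (dyad η N) (dyad Φ i))
      (B := ((2 : ℝ) ^ i) ^ n * (D₁ * (1 / 2) ^ (N - i))) (ρ := 2 * R * (1 / 2) ^ i)
      (ht.continuous.sub hcc) (ht.2.sub hcs) ?_ hgl (fun z => ?_) (fun z hz => ?_) x
    · refine h1.trans (le_of_eq ?_)
      simp only [hm]
      ring
    · simp only [Pi.sub_apply]
      rw [integral_sub ht.integrable (hcc.integrable_of_hasCompactSupport hcs),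
        integral_conv (hη.dyad N) ht, integral_dyad Φ, h0]
      simp
    · have := abs_conv_dyad_sub_le hη hΦ hC₂ hl₂ hs₁ hi.le z
      rwa [hη1, one_mul, abs_sub_comm] at this
    · simp only [Pi.sub_apply]
      rw [conv_dyad_eq_zero hs₁ hs₂ hi.le hz, dyad_eq_zero hs₂ (hzero hz), sub_zero]
  have high : ∀ N l, |conv (conv (dyad η N) (dyad Φ (N + l))) g x| ≤
      D₂ * ((1 / 2) ^ l * m N) := by
    intro N l
    have ht := hΦ.dyad (N + l)
    have hcc := continuous_conv (hη.dyad N) ht.continuous.locallyIntegrable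
    have hcs := hasCompactSupport_conv (hη.dyad N) ht
    have h1 := abs_conv_le_of_integral_eq_zero (κ := conv (dyad η N) (dyad Φ (N + l)))
      (B := ((2 : ℝ) ^ N) ^ n * (D₂ * (1 / 2) ^ l)) (ρ := 2 * R * (1 / 2) ^ N)
      hcc hcs ?_ hgl (fun z => ?_) (fun z hz => ?_) x
    · refine h1.trans (le_of_eq ?_)
      simp only [hm]
      ring
    · rw [integral_conv (hη.dyad N) ht, integral_dyad Φ, h0, mul_zero]
    · have := abs_conv_dyad_sub_le hΦ hη hC₁ hl₁ hs₂ (Nat.le_add_right N l) z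
      rwa [h0, zero_mul, sub_zero, conv_comm, Nat.add_sub_cancel_left] at this
    · rw [conv_comm]
      exact conv_dyad_eq_zero hs₂ hs₁ (Nat.le_add_right N l) hz
  set e : ℕ → ℝ := fun N =>
    D₁ * (∑ i ∈ Finset.range N, (1 / 2 : ℝ) ^ (N - i) * m i) + D₂ * (2 * m N) with he
  have hfin : ∀ N l, |conv (dyadSum Φ N) g x -
      conv (dyad η N) (conv (dyadSum Φ (N + l)) g) x| ≤ e N := by
    intro N l
    rw [conv_conv_dyadSum (hη.dyad N) hΦ hgl, conv_dyadSum hΦ hgl, Finset.sum_range_add,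
      ← sub_sub, ← Finset.sum_sub_distrib]
    refine (abs_sub _ _).trans (add_le_add ?_ ?_)
    · rw [Finset.mul_sum]
      exact (Finset.abs_sum_le_sum_abs _ _).trans
        (Finset.sum_le_sum fun i hi => low N i (Finset.mem_range.1 hi))
    · refine (Finset.abs_sum_le_sum_abs _ _).trans
        ((Finset.sum_le_sum fun i _ => high N i).trans ?_)
      rw [← Finset.mul_sum, ← Finset.sum_mul]
      exact mul_le_mul_of_nonneg_left
        (mul_le_mul_of_nonneg_right (sum_geometric_two_le l) (hm0 N)) hD₂
  have hlim : ∀ N, |conv (dyadSum Φ N) g x - conv (dyad η N) h x| ≤ e N := by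
    intro N
    have ht := tendsto_conv_of_tendsto_eLpNorm (hη.dyad N)
      (fun M => memLp_conv_dyadSum hΦ h0 hg M) hh hT x
    have ht2 := ht.comp (tendsto_add_atTop_nat N)
    have ht3 := (tendsto_const_nhds (x := conv (dyadSum Φ N) g x)).sub ht2
    refine le_of_tendsto ht3.abs (Eventually.of_forall fun l => ?_)
    have := hfin N l
    rwa [add_comm N l] at this
  have he0 : Tendsto e atTop (𝓝 0) := by
    have := ((tendsto_sum_geometric_mul hx1).const_mul D₁).add ((hx1.const_mul 2).const_mul D₂)
    simpa only [mul_zero, add_zero] using this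
  have h7 : Tendsto (fun N => conv (dyadSum Φ N) g x - conv (dyad η N) h x) atTop (𝓝 0) :=
    squeeze_zero_norm (fun N => hlim N) he0
  have h8 := h7.add (tendsto_conv_dyad hη hη1 hb₁ hs₁ hhl hx2)
  simpa using h8

end PointwiseConv

noncomputable section MeasureConv

variable {n : ℕ}

lemma integrable_dyad_sub {Φ : Euc n → ℝ} (hΦ : IsTestFun n Φ) (μ : Measure (Euc n))
    [IsFiniteMeasure μ] (i : ℕ) (x : Euc n) : Integrable (fun y => dyad Φ i (x - y)) μ := by
  have hc : Continuous fun y => dyad Φ i (x - y) :=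
    (hΦ.dyad i).continuous.comp (continuous_const.sub continuous_id)
  obtain ⟨C, hC⟩ := (hΦ.dyad i).2.exists_bound_of_continuous (hΦ.dyad i).continuous
  exact Integrable.of_bound hc.aestronglyMeasurable C (Eventually.of_forall fun y => hC _)

/-- Almost everywhere convergence for measures with bounded density. -/
lemma ae_exists_tendsto_of_le_smul {Φ : Euc n → ℝ} (hΦ : IsTestFun n Φ) (h0 : ∫ x, Φ x = 0)
    {ν : Measure (Euc n)} [IsFiniteMeasure ν] {c : ℝ≥0∞} (hc : c ≠ ⊤)
    (hν : ν ≤ c • (volume : Measure (Euc n))) :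
    ∀ᵐ x ∂(volume : Measure (Euc n)), ∃ l, Tendsto (fun N =>
      ∑ i ∈ Finset.range N, ∫ y, dyad Φ i (x - y) ∂ν) atTop (𝓝 l) := by
  have hac : ν ≪ volume := Measure.absolutelyContinuous_of_le_smul hν
  have hm := Measure.measurable_rnDeriv ν (volume : Measure (Euc n))
  have hd := Measure.withDensity_rnDeriv_eq ν volume hac
  have hle : ν.rnDeriv volume ≤ᵐ[volume] fun _ => c := by
    refine ae_le_of_forall_setLIntegral_le_of_sigmaFinite hm fun s hs _ => ?_
    rw [← withDensity_apply _ hs, hd, setLIntegral_const]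
    exact hν s
  set g : Euc n → ℝ := fun x => (ν.rnDeriv volume x).toReal with hg
  have hgi : Integrable g volume := by
    refine integrable_toReal_of_lintegral_ne_top hm.aemeasurable ?_
    rw [← setLIntegral_univ, ← withDensity_apply _ MeasurableSet.univ, hd]
    exact measure_ne_top _ _
  have hgm : MemLp g 2 := by
    rw [memLp_two_iff_integrable_sq hgi.1]
    simp_rw [sq]
    refine hgi.bdd_mul (c := c.toReal) hgi.1 ?_
    filter_upwards [hle] with x hx
    rw [Real.norm_of_nonneg ENNReal.toReal_nonneg]
    exact ENNReal.toReal_mono hc hx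
  have key : ∀ i x, ∫ y, dyad Φ i (x - y) ∂ν = conv (dyad Φ i) g x := fun i x => by
    conv_lhs => rw [← hd]
    rw [integral_withDensity_eq_integral_toReal_smul hm (Measure.rnDeriv_lt_top _ _), conv]
    simp [hg, mul_comm]
  filter_upwards [ae_exists_tendsto_conv_dyadSum hΦ h0 hgm] with x hx
  obtain ⟨l, hl⟩ := hx
  refine ⟨l, hl.congr fun N => ?_⟩
  rw [conv_dyadSum hΦ (hgm.locallyIntegrable (by norm_num))]
  simp_rw [key]

/-- The set where the upper `n`-density of `μ` is at most `L` at all scales. -/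
def densitySet (μ : Measure (Euc n)) (L : ℝ) : Set (Euc n) :=
  {x | ∀ r > 0, μ (closedBall x r) ≤ ENNReal.ofReal (L * r ^ n)}

lemma isClosed_densitySet (μ : Measure (Euc n)) {L : ℝ} : IsClosed (densitySet μ L) := by
  refine isClosed_of_closure_subset fun x hx r hr => ?_
  have h1 : ∀ ε > 0, μ (closedBall x r) ≤ ENNReal.ofReal (L * (r + ε) ^ n) := fun ε hε => by
    obtain ⟨z, hz, hxz⟩ := Metric.mem_closure_iff.1 hx ε hε
    exact (measure_mono (closedBall_subset_closedBall' (by linarith))).trans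
      (hz (r + ε) (by linarith))
  have h2 : Tendsto (fun ε : ℝ => ENNReal.ofReal (L * (r + ε) ^ n)) (𝓝[>] 0)
      (𝓝 (ENNReal.ofReal (L * (r + 0) ^ n))) := by
    have : Continuous fun ε : ℝ => ENNReal.ofReal (L * (r + ε) ^ n) :=
      ENNReal.continuous_ofReal.comp (by fun_prop)
    exact (this.tendsto 0).mono_left nhdsWithin_le_nhds
  rw [add_zero] at h2
  exact ge_of_tendsto h2 (eventually_mem_nhdsWithin.mono fun ε hε => h1 ε hε)

/-- The density sets exhaust almost all of space. -/
lemma ae_exists_mem_densitySet (μ : Measure (Euc n)) [IsFiniteMeasure μ] :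
    ∀ᵐ x ∂(volume : Measure (Euc n)), ∃ L : ℕ, x ∈ densitySet μ L := by
  filter_upwards [Besicovitch.ae_tendsto_rnDeriv μ volume,
    Measure.rnDeriv_lt_top μ (volume : Measure (Euc n))] with x hx hx2
  have hb : (volume (ball (0 : Euc n) 1)) ≠ ⊤ := measure_ball_lt_top.ne
  have h1 : ∀ᶠ r in 𝓝[>] (0 : ℝ), μ (closedBall x r) / volume (closedBall x r) <
      μ.rnDeriv volume x + 1 :=
    hx.eventually (gt_mem_nhds (ENNReal.lt_add_right hx2.ne one_ne_zero))
  obtain ⟨δ, hδ, h2⟩ := mem_nhdsGT_iff_exists_Ioo_subset.1 h1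
  have hδ' : (0 : ℝ) < δ := hδ
  set K := ((μ.rnDeriv volume x + 1) * volume (ball (0 : Euc n) 1)).toReal with hK
  have hKt : (μ.rnDeriv volume x + 1) * volume (ball (0 : Euc n) 1) ≠ ⊤ :=
    ENNReal.mul_ne_top (by simp [hx2.ne]) hb
  set M := (μ Set.univ).toReal / δ ^ n with hM
  obtain ⟨L, hL⟩ := exists_nat_ge (max K M)
  refine ⟨L, fun r hr => ?_⟩
  rcases lt_or_ge r δ with h | h
  · have h3 : μ (closedBall x r) / volume (closedBall x r) < μ.rnDeriv volume x + 1 := h2 ⟨hr, h⟩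
    have hv : volume (closedBall x r) ≠ 0 := (measure_closedBall_pos _ _ hr).ne'
    have hv' : volume (closedBall x r) ≠ ⊤ := measure_closedBall_lt_top.ne
    have h4 := (ENNReal.div_le_iff hv hv').1 h3.le
    rw [Measure.addHaar_closedBall volume _ hr.le, finrank_euclideanSpace_fin,
      mul_left_comm, ← ENNReal.ofReal_toReal hKt, ← ENNReal.ofReal_mul (by positivity)] at h4
    refine h4.trans (ENNReal.ofReal_le_ofReal ?_)
    rw [mul_comm]
    exact mul_le_mul_of_nonneg_right ((le_max_left _ _).trans hL) (by positivity)
  · refine (measure_mono (Set.subset_univ _)).trans ?_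
    rw [← ENNReal.ofReal_toReal (measure_ne_top μ Set.univ)]
    refine ENNReal.ofReal_le_ofReal ?_
    have h5 : (μ Set.univ).toReal = M * δ ^ n := by rw [hM]; field_simp
    rw [h5]
    have hM0 : 0 ≤ M := by positivity
    exact mul_le_mul ((le_max_right _ _).trans hL)
      (pow_le_pow_left₀ hδ'.le h n) (by positivity) (by positivity)

lemma restrict_densitySet_le (μ : Measure (Euc n)) [IsFiniteMeasure μ] {L : ℝ} (hL : 0 ≤ L) :
    μ.restrict (densitySet μ L) ≤
      (ENNReal.ofReal L * (volume (ball (0 : Euc n) 1))⁻¹) • (volume : Measure (Euc n)) := by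
  have hb : (volume (ball (0 : Euc n) 1)) ≠ ⊤ := measure_ball_lt_top.ne
  have hb0 : (volume (ball (0 : Euc n) 1)) ≠ 0 := (measure_ball_pos _ _ one_pos).ne'
  set c := ENNReal.ofReal L * (volume (ball (0 : Euc n) 1))⁻¹ with hc
  have hct : c ≠ ⊤ := ENNReal.mul_ne_top ENNReal.ofReal_ne_top (ENNReal.inv_ne_top.2 hb0)
  have : IsLocallyFiniteMeasure (c • (volume : Measure (Euc n))) := by
    have h := (inferInstance : IsLocallyFiniteMeasure (c.toNNReal • (volume : Measure (Euc n))))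
    have : c • (volume : Measure (Euc n)) = c.toNNReal • (volume : Measure (Euc n)) := by
      conv_lhs => rw [← ENNReal.coe_toNNReal hct]
      rfl
    rwa [this]
  refine Measure.le_iff.2 fun s hs => ?_
  rw [Measure.restrict_apply hs]
  refine le_trans ?_ (measure_mono (Set.inter_subset_left (s := s) (t := densitySet μ L)))
  refine VitaliFamily.measure_le_of_frequently_le (Besicovitch.vitaliFamily μ) _
    Measure.AbsolutelyContinuous.rfl _ fun x hx => ?_
  refine (Besicovitch.tendsto_filterAt μ x).frequently (Eventually.frequently ?_)
  filter_upwards [self_mem_nhdsWithin] with r hr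
  have hr' : (0 : ℝ) < r := hr
  refine (hx.2 r hr).trans (le_of_eq ?_)
  rw [Measure.smul_apply, smul_eq_mul, Measure.addHaar_closedBall _ _ hr'.le,
    finrank_euclideanSpace_fin, hc, ENNReal.ofReal_mul hL, mul_mul_mul_comm, mul_comm _⁻¹,
    mul_assoc, ENNReal.mul_inv_cancel hb0 hb, mul_one]

end MeasureConv

noncomputable section Smearing

variable {n : ℕ}

/-- The kernel spreading the unit mass at `y ∉ F` uniformly over the ball around `y` whose radius
is half the distance to `F`. -/
def smearKernel (F : Set (Euc n)) (p : Euc n × Euc n) : ℝ≥0∞ :=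
  if dist p.1 p.2 < infDist p.2 F / 2 then
    (ENNReal.ofReal ((infDist p.2 F / 2) ^ n) * volume (ball (0 : Euc n) 1))⁻¹ else 0

lemma measurable_smearKernel (F : Set (Euc n)) : Measurable (smearKernel F) := by
  have h : Continuous fun p : Euc n × Euc n => infDist p.2 F :=
    (continuous_infDist_pt F).comp continuous_snd
  refine Measurable.ite (isOpen_lt (by fun_prop) (h.div_const 2)).measurableSet ?_
    measurable_const
  exact ((ENNReal.measurable_ofReal.comp ((h.div_const 2).pow n).measurable).mul_const _).inv

lemma smearKernel_of_lt {F : Set (Euc n)} {z y : Euc n} (h : dist z y < infDist y F / 2) :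
    smearKernel F (z, y) =
      (ENNReal.ofReal ((infDist y F / 2) ^ n) * volume (ball (0 : Euc n) 1))⁻¹ := if_pos h

lemma smearKernel_of_le {F : Set (Euc n)} {z y : Euc n} (h : infDist y F / 2 ≤ dist z y) :
    smearKernel F (z, y) = 0 := if_neg (not_lt.2 h)

lemma volume_ball_one_ne_zero : volume (ball (0 : Euc n) 1) ≠ 0 :=
  (measure_ball_pos _ _ one_pos).ne'

lemma volume_ball_one_ne_top : volume (ball (0 : Euc n) 1) ≠ ⊤ := measure_ball_lt_top.ne

lemma lintegral_smearKernel {F : Set (Euc n)} (hF : IsClosed F) (hne : F.Nonempty) {y : Euc n}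
    (hy : y ∉ F) : ∫⁻ z, smearKernel F (z, y) = 1 := by
  have hd : 0 < infDist y F := (hF.notMem_iff_infDist_pos hne).1 hy
  have h1 : (fun z => smearKernel F (z, y)) = (ball y (infDist y F / 2)).indicator
      fun _ => (ENNReal.ofReal ((infDist y F / 2) ^ n) * volume (ball (0 : Euc n) 1))⁻¹ := by
    ext z
    by_cases h : dist z y < infDist y F / 2
    · rw [smearKernel_of_lt h, Set.indicator_of_mem (mem_ball.2 h)]
    · rw [smearKernel_of_le (not_lt.1 h), Set.indicator_of_notMem (fun h' => h (mem_ball.1 h'))]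
  have h2 : volume (ball y (infDist y F / 2)) =
      ENNReal.ofReal ((infDist y F / 2) ^ n) * volume (ball (0 : Euc n) 1) := by
    rw [Measure.addHaar_ball_of_pos volume y (by positivity), finrank_euclideanSpace_fin]
  rw [h1, lintegral_indicator_const measurableSet_ball, h2, ENNReal.inv_mul_cancel]
  · refine mul_ne_zero ?_ volume_ball_one_ne_zero
    simpa using by positivity
  · exact ENNReal.mul_ne_top ENNReal.ofReal_ne_top volume_ball_one_ne_top

/-- The smeared density is bounded when `F` is a density set. -/
lemma lintegral_smearKernel_le (μ : Measure (Euc n)) {L : ℝ}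
    (hne : (densitySet μ L).Nonempty) (z : Euc n) :
    ∫⁻ y, smearKernel (densitySet μ L) (z, y) ∂μ ≤
      ENNReal.ofReal (L * 6 ^ n) * (volume (ball (0 : Euc n) 1))⁻¹ := by
  set F := densitySet μ L with hFdef
  have hF : IsClosed F := isClosed_densitySet μ
  obtain ⟨w, hw, hzw⟩ := hF.exists_infDist_eq_dist hne z
  have hdz : 0 ≤ infDist z F := infDist_nonneg
  have key : ∀ y, dist z y < infDist y F / 2 →
      infDist y F < 2 * infDist z F ∧ infDist z F < 3 / 2 * infDist y F := fun y hy => by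
    have h1 : infDist y F ≤ infDist z F + dist y z := infDist_le_infDist_add_dist
    have h2 : infDist z F ≤ infDist y F + dist z y := infDist_le_infDist_add_dist
    rw [dist_comm] at h1
    constructor <;> linarith
  rcases hdz.eq_or_lt with h0 | h0
  · have : ∀ y, smearKernel F (z, y) = 0 := fun y => by
      refine smearKernel_of_le (not_lt.1 fun h => ?_)
      have := key y h
      have := infDist_nonneg (x := y) (s := F)
      linarith
    simp [this]
  · have hle : ∀ y, smearKernel F (z, y) ≤ (closedBall w (2 * infDist z F)).indicator
        (fun _ => (ENNReal.ofReal ((infDist z F / 3) ^ n) * volume (ball (0 : Euc n) 1))⁻¹) y := by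
      intro y
      by_cases h : dist z y < infDist y F / 2
      · obtain ⟨h1, h2⟩ := key y h
        have hyw : y ∈ closedBall w (2 * infDist z F) := by
          rw [mem_closedBall]
          have := dist_triangle y z w
          rw [dist_comm y z] at this
          linarith
        rw [smearKernel_of_lt h, Set.indicator_of_mem hyw]
        have : infDist z F / 3 ≤ infDist y F / 2 := by linarith
        gcongr
      · rw [smearKernel_of_le (not_lt.1 h)]
        exact zero_le
    refine (lintegral_mono hle).trans ?_
    rw [lintegral_indicator_const measurableSet_closedBall]
    calc _ ≤ (ENNReal.ofReal ((infDist z F / 3) ^ n) * volume (ball (0 : Euc n) 1))⁻¹ *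
          ENNReal.ofReal (L * (2 * infDist z F) ^ n) := by
            gcongr
            exact hw _ (by positivity)
      _ = _ := by
        have h3 : L * (2 * infDist z F) ^ n = (infDist z F / 3) ^ n * (L * 6 ^ n) := by
          rw [div_pow, mul_pow, show (6 : ℝ) = 2 * 3 by norm_num, mul_pow]
          field_simp
        have hp : 0 < (infDist z F / 3) ^ n := by positivity
        rw [h3, ENNReal.ofReal_mul hp.le, ENNReal.mul_inv
          (Or.inl (by simpa using hp)) (Or.inl ENNReal.ofReal_ne_top)]
        rw [mul_right_comm, ← mul_assoc, ENNReal.inv_mul_cancel (by simpa using hp)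
          ENNReal.ofReal_ne_top, one_mul]

lemma sum_two_pow_mul_indicator_le {d R : ℝ} (hd : 0 < d) (hR : 0 ≤ R) (N : ℕ) :
    ∑ i ∈ Finset.range N, (if (2 : ℝ) ^ i * d ≤ R then (2 : ℝ) ^ i * d else 0) ≤ 2 * R := by
  have : ∑ i ∈ Finset.range N, (if (2 : ℝ) ^ i * d ≤ R then (2 : ℝ) ^ i * d else 0) ≤
      min ((2 : ℝ) ^ N * d) (2 * R) := by
    induction N with
    | zero => simp only [Finset.range_zero, Finset.sum_empty]; positivity
    | succ N ih =>
      rw [Finset.sum_range_succ]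
      obtain ⟨h1, h2⟩ := le_min_iff.1 ih
      have hp : 0 < (2 : ℝ) ^ N * d := by positivity
      rw [le_min_iff, pow_succ]
      split_ifs with h
      · constructor <;> linarith
      · constructor <;> linarith
  exact this.trans (min_le_right _ _)

end Smearing

noncomputable section BadPart

variable {n : ℕ}

/-- Error majorant for replacing a point mass at `y` by its smeared version. -/
def smearError (F : Set (Euc n)) (D R : ℝ) (i : ℕ) (x y : Euc n) : ℝ :=
  if (2 : ℝ) ^ i * infDist y F ≤ R ∧ (2 : ℝ) ^ i * dist x y ≤ R then
    ((2 : ℝ) ^ i) ^ n * (D * (2 ^ i * infDist y F)) else 0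

lemma smearError_nonneg (F : Set (Euc n)) {D R : ℝ} (hD : 0 ≤ D) (i : ℕ) (x y : Euc n) :
    0 ≤ smearError F D R i x y := by
  have := infDist_nonneg (x := y) (s := F)
  rw [smearError]
  split_ifs <;> positivity

lemma measurable_smearError (F : Set (Euc n)) (D R : ℝ) (i : ℕ) :
    Measurable fun p : Euc n × Euc n => smearError F D R i p.1 p.2 := by
  have h : Continuous fun p : Euc n × Euc n => infDist p.2 F :=
    (continuous_infDist_pt F).comp continuous_snd
  refine Measurable.ite ?_ ?_ measurable_const
  · exact ((isClosed_le (continuous_const.mul h) continuous_const).inter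
      (isClosed_le (continuous_const.mul (continuous_fst.dist continuous_snd))
        continuous_const)).measurableSet
  · exact (continuous_const.mul (continuous_const.mul (continuous_const.mul h))).measurable

lemma lintegral_smearError (F : Set (Euc n)) {D R : ℝ} (hD : 0 ≤ D) (hR : 0 < R) (i : ℕ)
    (y : Euc n) : ∫⁻ x, ENNReal.ofReal (smearError F D R i x y) =
      ENNReal.ofReal (D * R ^ n * if (2 : ℝ) ^ i * infDist y F ≤ R then
        (2 : ℝ) ^ i * infDist y F else 0) * volume (ball (0 : Euc n) 1) := by
  have hd := infDist_nonneg (x := y) (s := F)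
  by_cases h : (2 : ℝ) ^ i * infDist y F ≤ R
  · have h1 : (fun x => ENNReal.ofReal (smearError F D R i x y)) =
        (closedBall y (R / 2 ^ i)).indicator
          fun _ => ENNReal.ofReal (((2 : ℝ) ^ i) ^ n * (D * (2 ^ i * infDist y F))) := by
      ext x
      have : x ∈ closedBall y (R / 2 ^ i) ↔ (2 : ℝ) ^ i * dist x y ≤ R := by
        rw [mem_closedBall, le_div_iff₀' (by positivity)]
      by_cases hx : (2 : ℝ) ^ i * dist x y ≤ R
      · rw [Set.indicator_of_mem (this.2 hx), smearError, if_pos ⟨h, hx⟩]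
      · rw [Set.indicator_of_notMem (mt this.1 hx), smearError, if_neg (fun h' => hx h'.2),
          ENNReal.ofReal_zero]
    rw [h1, lintegral_indicator_const measurableSet_closedBall,
      Measure.addHaar_closedBall volume y (by positivity), finrank_euclideanSpace_fin, ← mul_assoc,
      ← ENNReal.ofReal_mul (by positivity), if_pos h]
    congr 2
    rw [div_pow]
    field_simp
  · simp [smearError, h]

lemma norm_integral_smear_sub_le {Φ : Euc n → ℝ} {F : Set (Euc n)} (hF : IsClosed F)
    (hne : F.Nonempty) {C R : ℝ} (hC0 : 0 ≤ C)
    (hC : ∀ z w, ‖Φ z - Φ w‖ ≤ C * ‖z - w‖) (hR : ∀ z, Φ z ≠ 0 → ‖z‖ ≤ R)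
    (i : ℕ) {x y : Euc n} (hx : x ∈ F) (hy : y ∉ F) :
    ‖∫ z, (smearKernel F (z, y)).toReal * (dyad Φ i (x - y) - dyad Φ i (x - z))‖ ≤
      smearError F C (2 * R) i x y := by
  have hd : 0 < infDist y F := (hF.notMem_iff_infDist_pos hne).1 hy
  have hxy : infDist y F ≤ dist x y := by
    rw [dist_comm]; exact infDist_le_dist_of_mem hx
  have hm : Measurable fun z => smearKernel F (z, y) :=
    (measurable_smearKernel F).comp (by fun_prop)
  have hInt : Integrable (fun z => (smearKernel F (z, y)).toReal) := by
    refine integrable_toReal_of_lintegral_ne_top hm.aemeasurable ?_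
    rw [lintegral_smearKernel hF hne hy]; simp
  have h1 : ∫ z, (smearKernel F (z, y)).toReal = 1 := by
    rw [integral_toReal hm.aemeasurable, lintegral_smearKernel hF hne hy]
    · simp
    · refine ae_lt_top hm ?_
      rw [lintegral_smearKernel hF hne hy]; simp
  have hpt : ∀ z, ‖(smearKernel F (z, y)).toReal * (dyad Φ i (x - y) - dyad Φ i (x - z))‖ ≤
      (smearKernel F (z, y)).toReal * smearError F C (2 * R) i x y := by
    intro z
    rw [norm_mul, Real.norm_of_nonneg ENNReal.toReal_nonneg]
    by_cases hz : dist z y < infDist y F / 2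
    · refine mul_le_mul_of_nonneg_left ?_ ENNReal.toReal_nonneg
      by_cases hb : dyad Φ i (x - y) - dyad Φ i (x - z) = 0
      · rw [hb, norm_zero]
        exact smearError_nonneg F hC0 i x y
      · have hxz : dist x y ≤ 2 * dist x z := by
          have := dist_triangle x z y
          linarith
        have h2 : (2 : ℝ) ^ i * dist x y ≤ 2 * R := by
          by_contra hcon
          push Not at hcon
          refine hb ?_
          have hp : (0 : ℝ) < 2 ^ i := by positivity
          have hR0 : R < 2 ^ i * dist x z := by nlinarith
          have hRR : R < 2 ^ i * dist x y := by
            by_cases hRn : 0 ≤ R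
            · linarith
            · push Not at hRn
              exact hRn.trans_le (by positivity)
          rw [dyad_eq_zero hR (by rwa [← dist_eq_norm]), dyad_eq_zero hR (by rwa [← dist_eq_norm]),
            sub_zero]
        have h3 : (2 : ℝ) ^ i * infDist y F ≤ 2 * R :=
          (mul_le_mul_of_nonneg_left hxy (by positivity)).trans h2
        rw [smearError, if_pos ⟨h3, h2⟩]
        refine (norm_dyad_sub_le hC i _ _).trans ?_
        have : ‖x - y - (x - z)‖ ≤ infDist y F := by
          rw [sub_sub_sub_cancel_left, ← dist_eq_norm]; linarith
        gcongr
    · rw [smearKernel_of_le (not_lt.1 hz)]; simp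
  refine (norm_integral_le_of_norm_le (hInt.mul_const _) (Eventually.of_forall hpt)).trans ?_
  rw [integral_mul_const, h1, one_mul]

lemma exists_summable_smear {Φ : Euc n → ℝ} {F : Set (Euc n)} (hF : IsClosed F)
    (hne : F.Nonempty) {C R : ℝ} (hC0 : 0 ≤ C) (hR0 : 0 < R)
    (hC : ∀ z w, ‖Φ z - Φ w‖ ≤ C * ‖z - w‖) (hR : ∀ z, Φ z ≠ 0 → ‖z‖ ≤ R)
    (μ : Measure (Euc n)) [IsFiniteMeasure μ] :
    ∀ᵐ x ∂(volume : Measure (Euc n)), x ∈ F → Summable fun i : ℕ => ∫ y in Fᶜ,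
      (∫ z, (smearKernel F (z, y)).toReal * (dyad Φ i (x - y) - dyad Φ i (x - z))) ∂μ := by
  have hms : ∀ i, Measurable fun p : Euc n × Euc n =>
      ENNReal.ofReal (smearError F C (2 * R) i p.1 p.2) := fun i =>
    ENNReal.measurable_ofReal.comp (measurable_smearError F C (2 * R) i)
  have hfin : ∫⁻ x, ∑' i : ℕ, ∫⁻ y in Fᶜ, ENNReal.ofReal (smearError F C (2 * R) i x y) ∂μ ≠ ⊤ := by
    have e1 : ∫⁻ x, ∑' i : ℕ, ∫⁻ y in Fᶜ, ENNReal.ofReal (smearError F C (2 * R) i x y) ∂μ =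
        ∫⁻ y in Fᶜ, (∑' i : ℕ, ∫⁻ x, ENNReal.ofReal (smearError F C (2 * R) i x y)) ∂μ := by
      rw [lintegral_tsum fun i => ((hms i).lintegral_prod_right').aemeasurable,
        lintegral_tsum fun i => ((hms i).lintegral_prod_left').aemeasurable]
      exact tsum_congr fun i => lintegral_lintegral_swap
        (f := fun x y => ENNReal.ofReal (smearError F C (2 * R) i x y)) (hms i).aemeasurable
    rw [e1]
    have hle : ∀ y ∈ Fᶜ, ∑' i : ℕ, ∫⁻ x, ENNReal.ofReal (smearError F C (2 * R) i x y) ≤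
        ENNReal.ofReal (C * (2 * R) ^ n * (2 * (2 * R))) * volume (ball (0 : Euc n) 1) := by
      intro y hy
      have hd : 0 < infDist y F := (hF.notMem_iff_infDist_pos hne).1 hy
      simp_rw [lintegral_smearError F hC0 (by positivity : 0 < 2 * R)]
      rw [ENNReal.tsum_mul_right]
      gcongr
      rw [ENNReal.tsum_eq_iSup_nat]
      refine iSup_le fun N => ?_
      rw [← ENNReal.ofReal_sum_of_nonneg fun i _ => by split_ifs <;> positivity, ← Finset.mul_sum]
      gcongr
      exact sum_two_pow_mul_indicator_le hd (by positivity) N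
    refine ((setLIntegral_mono' hF.isOpen_compl.measurableSet hle).trans_lt ?_).ne
    rw [setLIntegral_const]
    exact ENNReal.mul_lt_top (ENNReal.mul_lt_top ENNReal.ofReal_lt_top measure_ball_lt_top)
      (measure_lt_top _ _)
  have hmt : Measurable fun x : Euc n =>
      ∑' i : ℕ, ∫⁻ y in Fᶜ, ENNReal.ofReal (smearError F C (2 * R) i x y) ∂μ :=
    Measurable.tsum fun i => (hms i).lintegral_prod_right'
  filter_upwards [ae_lt_top hmt hfin] with x hx hxF
  refine Summable.of_norm_bounded (ENNReal.summable_toReal hx.ne) fun i => ?_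
  have hi : ∫⁻ y in Fᶜ, ENNReal.ofReal (smearError F C (2 * R) i x y) ∂μ ≠ ⊤ :=
    ENNReal.ne_top_of_tsum_ne_top hx.ne i
  rw [← toReal_enorm]
  refine ENNReal.toReal_mono hi ((enorm_integral_le_lintegral_enorm _).trans ?_)
  refine setLIntegral_mono' hF.isOpen_compl.measurableSet fun y hy => ?_
  rw [← ofReal_norm]
  exact ENNReal.ofReal_le_ofReal (norm_integral_smear_sub_le hF hne hC0 hC hR i hxF hy)

/-- Dyadic sums of a mean zero kernel against a finite measure converge almost everywhere. -/
theorem ae_exists_tendsto_measure {Φ : Euc n → ℝ} (hΦ : IsTestFun n Φ) (h0 : ∫ x, Φ x = 0)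
    (μ : Measure (Euc n)) [IsFiniteMeasure μ] :
    ∀ᵐ x ∂(volume : Measure (Euc n)), ∃ l, Tendsto (fun N =>
      ∑ i ∈ Finset.range N, ∫ y, dyad Φ i (x - y) ∂μ) atTop (𝓝 l) := by
  obtain ⟨C, R, hC0, hR1, hCb, hC, hR⟩ := exists_pos_bounds hΦ
  suffices hL : ∀ L : ℕ, ∀ᵐ x ∂(volume : Measure (Euc n)), x ∈ densitySet μ L → ∃ l,
      Tendsto (fun N => ∑ i ∈ Finset.range N, ∫ y, dyad Φ i (x - y) ∂μ) atTop (𝓝 l) by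
    filter_upwards [ae_all_iff.2 hL, ae_exists_mem_densitySet μ] with x hx ⟨L, hxL⟩
    exact hx L hxL
  intro L
  set F := densitySet μ (L : ℝ) with hFdef
  rcases F.eq_empty_or_nonempty with he | hne
  · simp [he]
  have hF : IsClosed F := isClosed_densitySet μ
  have hFm : MeasurableSet F := hF.measurableSet
  have hk := measurable_smearKernel F
  have hcb : ENNReal.ofReal ((L : ℝ) * 6 ^ n) * (volume (ball (0 : Euc n) 1))⁻¹ ≠ ⊤ :=
    ENNReal.mul_ne_top ENNReal.ofReal_ne_top (ENNReal.inv_ne_top.2 volume_ball_one_ne_zero)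
  set G : Euc n → ℝ≥0∞ := fun z => ∫⁻ y in Fᶜ, smearKernel F (z, y) ∂μ with hG
  have hGm : Measurable G := hk.lintegral_prod_right'
  have hGle : ∀ z, G z ≤ ENNReal.ofReal ((L : ℝ) * 6 ^ n) * (volume (ball (0 : Euc n) 1))⁻¹ :=
    fun z => (setLIntegral_le_lintegral _ _).trans (lintegral_smearKernel_le μ hne z)
  have hmass : ∫⁻ z, G z = μ Fᶜ := by
    rw [hG, lintegral_lintegral_swap (f := fun z y => smearKernel F (z, y)) hk.aemeasurable,
      setLIntegral_congr_fun hF.isOpen_compl.measurableSet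
        (fun y hy => lintegral_smearKernel hF hne hy)]
    simp
  have hfinG : IsFiniteMeasure ((volume : Measure (Euc n)).withDensity G) :=
    isFiniteMeasure_withDensity (by rw [hmass]; exact measure_ne_top _ _)
  have hle2 : (volume : Measure (Euc n)).withDensity G ≤
      (ENNReal.ofReal ((L : ℝ) * 6 ^ n) * (volume (ball (0 : Euc n) 1))⁻¹) • volume := by
    rw [← withDensity_const]
    exact withDensity_mono (Eventually.of_forall hGle)
  have hle1 := restrict_densitySet_le μ (L := (L : ℝ)) (by positivity)
  have hcb1 : ENNReal.ofReal (L : ℝ) * (volume (ball (0 : Euc n) 1))⁻¹ ≠ ⊤ :=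
    ENNReal.mul_ne_top ENNReal.ofReal_ne_top (ENNReal.inv_ne_top.2 volume_ball_one_ne_zero)
  have hki : Integrable (fun p : Euc n × Euc n => (smearKernel F p).toReal)
      ((volume : Measure (Euc n)).prod (μ.restrict Fᶜ)) := by
    refine integrable_toReal_of_lintegral_ne_top hk.aemeasurable ?_
    rw [lintegral_prod _ hk.aemeasurable]
    exact (hmass.trans_lt (measure_lt_top _ _)).ne
  have hsplit : ∀ i x, ∫ y, dyad Φ i (x - y) ∂μ = ∫ y, dyad Φ i (x - y) ∂(μ.restrict F) +
      ∫ z, dyad Φ i (x - z) ∂((volume : Measure (Euc n)).withDensity G) + ∫ y in Fᶜ,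
      (∫ z, (smearKernel F (z, y)).toReal * (dyad Φ i (x - y) - dyad Φ i (x - z))) ∂μ := by
    intro i x
    obtain ⟨B, hB⟩ := (hΦ.dyad i).2.exists_bound_of_continuous (hΦ.dyad i).continuous
    have hdc := (hΦ.dyad i).continuous
    have hi1 : Integrable (fun p : Euc n × Euc n => (smearKernel F p).toReal * dyad Φ i (x - p.1))
        ((volume : Measure (Euc n)).prod (μ.restrict Fᶜ)) :=
      hki.mul_bdd (c := B) (hdc.comp (continuous_const.sub continuous_fst)).aestronglyMeasurable
        (Eventually.of_forall fun p => hB _)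
    have e2 : ∫ z, dyad Φ i (x - z) ∂((volume : Measure (Euc n)).withDensity G) =
        ∫ y in Fᶜ, (∫ z, (smearKernel F (z, y)).toReal * dyad Φ i (x - z)) ∂μ := by
      rw [integral_withDensity_eq_integral_toReal_smul hGm
        (Eventually.of_forall fun z => (hGle z).trans_lt hcb.lt_top),
        ← integral_integral_swap hi1]
      refine integral_congr_ae (Eventually.of_forall fun z => ?_)
      have hm : Measurable fun y => smearKernel F (z, y) := hk.comp (by fun_prop)
      dsimp only
      rw [integral_mul_const, integral_toReal hm.aemeasurable, smul_eq_mul]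
      exact ae_lt_top hm ((hGle z).trans_lt hcb.lt_top).ne
    have e3 : ∫ y in Fᶜ, (∫ z, (smearKernel F (z, y)).toReal *
        (dyad Φ i (x - y) - dyad Φ i (x - z))) ∂μ = ∫ y in Fᶜ, dyad Φ i (x - y) ∂μ -
        ∫ y in Fᶜ, (∫ z, (smearKernel F (z, y)).toReal * dyad Φ i (x - z)) ∂μ := by
      rw [← integral_sub (integrable_dyad_sub hΦ _ i x) hi1.integral_prod_right]
      refine setIntegral_congr_fun hF.isOpen_compl.measurableSet fun y hy => ?_
      have hm : Measurable fun z => smearKernel F (z, y) := hk.comp (by fun_prop)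
      have h1 := lintegral_smearKernel hF hne hy
      have hInt : Integrable (fun z => (smearKernel F (z, y)).toReal) :=
        integrable_toReal_of_lintegral_ne_top hm.aemeasurable (by rw [h1]; simp)
      have hI : ∫ z, (smearKernel F (z, y)).toReal = 1 := by
        rw [integral_toReal hm.aemeasurable (ae_lt_top hm (by rw [h1]; simp)), h1]; simp
      have hInt2 : Integrable fun z => (smearKernel F (z, y)).toReal * dyad Φ i (x - z) :=
        hInt.mul_bdd (c := B) (hdc.comp (continuous_const.sub continuous_id)).aestronglyMeasurable
          (Eventually.of_forall fun p => hB _)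
      dsimp only
      simp_rw [mul_sub]
      rw [integral_sub (hInt.mul_const _) hInt2, integral_mul_const, hI, one_mul]
    rw [e2, e3, ← integral_add_compl hFm (integrable_dyad_sub hΦ μ i x)]
    ring
  filter_upwards [ae_exists_tendsto_of_le_smul hΦ h0 hcb hle2,
    ae_exists_tendsto_of_le_smul hΦ h0 hcb1 hle1,
    exists_summable_smear hF hne hC0.le (by linarith) hC hR μ] with x ⟨l2, h2⟩ ⟨l1, h1⟩ h3 hxF
  refine ⟨_, ((h1.add h2).add (h3 hxF).hasSum.tendsto_sum_nat).congr fun N => ?_⟩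
  rw [← Finset.sum_add_distrib, ← Finset.sum_add_distrib]
  exact Finset.sum_congr rfl fun i _ => (hsplit i x).symm

end BadPart

noncomputable section VectorMeasureConv

variable {n : ℕ} {V W : Type*}
  [NormedAddCommGroup V] [InnerProductSpace ℝ V] [FiniteDimensional ℝ V]
  [NormedAddCommGroup W] [InnerProductSpace ℝ W] [FiniteDimensional ℝ W]

lemma exists_norm_dyad_le {G : Type*} [NormedAddCommGroup G] [NormedSpace ℝ G] {Φ : Euc n → G}
    (hΦ : IsTestFun n Φ) (i : ℕ) : ∃ B, ∀ z, ‖dyad Φ i z‖ ≤ B :=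
  (hΦ.dyad i).2.exists_bound_of_continuous (hΦ.dyad i).continuous

lemma integrable_kernel_apply {T : Euc n → W →L[ℝ] V} (hc : Continuous T)
    (hT : HasCompactSupport T) {μ : Measure (Euc n)} {f : Euc n → W} (hf : LocallyIntegrable f μ)
    (x : Euc n) : Integrable (fun y => T (x - y) (f y)) μ :=
  hT.convolutionExists_right (ContinuousLinearMap.id ℝ (W →L[ℝ] V)).flip hf hc x

lemma ae_exists_tendsto_integrable {Φ : Euc n → ℝ} (hΦ : IsTestFun n Φ) (h0 : ∫ x, Φ x = 0)
    {μ : Measure (Euc n)} {g : Euc n → ℝ} (hg : Integrable g μ) :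
    ∀ᵐ x ∂(volume : Measure (Euc n)), ∃ l, Tendsto (fun N =>
      ∑ i ∈ Finset.range N, ∫ y, dyad Φ i (x - y) * g y ∂μ) atTop (𝓝 l) := by
  have hfin : ∀ {g : Euc n → ℝ}, Integrable g μ →
      IsFiniteMeasure (μ.withDensity fun y => ENNReal.ofReal (g y)) := fun hg =>
    isFiniteMeasure_withDensity_ofReal hg.2
  have hInt : ∀ {g : Euc n → ℝ}, Integrable g μ → ∀ i x,
      ∫ y, dyad Φ i (x - y) ∂(μ.withDensity fun y => ENNReal.ofReal (g y)) =
        ∫ y, dyad Φ i (x - y) * max (g y) 0 ∂μ := fun {g} hg i x => by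
    rw [integral_withDensity_eq_integral_toReal_smul₀ hg.1.aemeasurable.ennreal_ofReal
      (Eventually.of_forall fun _ => ENNReal.ofReal_lt_top)]
    simp_rw [ENNReal.toReal_ofReal', smul_eq_mul, mul_comm]
  have := hfin hg
  have := hfin hg.neg
  filter_upwards [ae_exists_tendsto_measure hΦ h0 (μ.withDensity fun y => ENNReal.ofReal (g y)),
    ae_exists_tendsto_measure hΦ h0 (μ.withDensity fun y => ENNReal.ofReal ((-g) y))]
    with x ⟨l1, h1⟩ ⟨l2, h2⟩
  refine ⟨_, (h1.sub h2).congr fun N => ?_⟩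
  rw [← Finset.sum_sub_distrib]
  refine Finset.sum_congr rfl fun i _ => ?_
  obtain ⟨B, hB⟩ := exists_norm_dyad_le hΦ i
  have hm : AEStronglyMeasurable (fun y => dyad Φ i (x - y)) μ :=
    ((hΦ.dyad i).continuous.comp (continuous_const.sub continuous_id)).aestronglyMeasurable
  rw [hInt hg, hInt hg.neg, ← integral_sub
    (hg.pos_part.bdd_mul hm (Eventually.of_forall fun _ => hB _))
    (hg.neg.pos_part.bdd_mul hm (Eventually.of_forall fun _ => hB _))]
  refine integral_congr_ae (Eventually.of_forall fun y => ?_)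
  dsimp only [Pi.neg_apply]
  rw [← mul_sub, max_zero_sub_max_neg_zero_eq_self]

lemma ae_exists_tendsto_locallyIntegrable {Φ : Euc n → ℝ} (hΦ : IsTestFun n Φ)
    (h0 : ∫ x, Φ x = 0) {μ : Measure (Euc n)} {g : Euc n → ℝ} (hg : LocallyIntegrable g μ) :
    ∀ᵐ x ∂(volume : Measure (Euc n)), ∃ l, Tendsto (fun N =>
      ∑ i ∈ Finset.range N, ∫ y, dyad Φ i (x - y) * g y ∂μ) atTop (𝓝 l) := by
  obtain ⟨C, R, hC0, hR1, -, -, hR⟩ := exists_pos_bounds hΦ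
  have key := ae_all_iff.2 fun m : ℕ => ae_exists_tendsto_integrable hΦ h0
    (hg.integrableOn_isCompact (isCompact_closedBall (0 : Euc n) (m + R)))
  filter_upwards [key] with x hx
  obtain ⟨m, hm⟩ := exists_nat_ge ‖x‖
  obtain ⟨l, hl⟩ := hx m
  refine ⟨l, hl.congr fun N => Finset.sum_congr rfl fun i _ => ?_⟩
  refine setIntegral_eq_integral_of_forall_compl_eq_zero fun y hy => ?_
  rw [dyad_eq_zero hR, zero_mul]
  rw [mem_closedBall_zero_iff, not_le] at hy
  have h1 : R < ‖x - y‖ := by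
    have := norm_sub_norm_le y x
    rw [norm_sub_rev] at this
    linarith
  exact h1.trans_le (le_mul_of_one_le_left (norm_nonneg _) (one_le_pow₀ one_le_two))

/-- Almost everywhere convergence of dyadic sums of a mean zero operator kernel against a
locally finite vector measure. -/
theorem ae_exists_tendsto_vector {Ψ : Euc n → W →L[ℝ] V} (hΨ : IsTestFun n Ψ)
    (h0 : ∫ x, Ψ x = 0) {μ : Measure (Euc n)} {f : Euc n → W} (hf : LocallyIntegrable f μ) :
    ∀ᵐ x ∂(volume : Measure (Euc n)), ∃ l, Tendsto (fun N =>
      ∑ i ∈ Finset.range N, ∫ y, dyad Ψ i (x - y) (f y) ∂μ) atTop (𝓝 l) := by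
  set b := stdOrthonormalBasis ℝ W
  set e := stdOrthonormalBasis ℝ V
  let L : Fin (Module.finrank ℝ V) → Fin (Module.finrank ℝ W) → (W →L[ℝ] V) →L[ℝ] ℝ :=
    fun a c => (innerSL ℝ (e a)) ∘L (ContinuousLinearMap.apply ℝ V (b c))
  have hL : ∀ a c T, L a c T = ⟪e a, T (b c)⟫ := fun a c T => rfl
  have hT : ∀ a c, IsTestFun n fun z => L a c (Ψ z) := fun a c =>
    ⟨(L a c).contDiff.comp hΨ.1, hΨ.2.comp_left (map_zero _)⟩
  have hT0 : ∀ a c, ∫ z, L a c (Ψ z) = 0 := fun a c => by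
    rw [(L a c).integral_comp_comm hΨ.integrable, h0, map_zero]
  have hfc : ∀ c, LocallyIntegrable (fun y => ⟪b c, f y⟫) μ := fun c y => by
    obtain ⟨s, hs, hi⟩ := hf y
    exact ⟨s, hs, (innerSL ℝ (b c)).integrable_comp hi⟩
  have key := ae_all_iff.2 fun a => ae_all_iff.2 fun c =>
    ae_exists_tendsto_locallyIntegrable (hT a c) (hT0 a c) (hfc c)
  filter_upwards [key] with x hx
  choose l hl using hx
  refine ⟨∑ a, (∑ c, l a c) • e a, Tendsto.congr (fun N => ?_) (tendsto_finsetSum _ fun a _ =>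
    (tendsto_finsetSum _ fun c _ => hl a c).smul_const (e a))⟩
  simp_rw [Finset.sum_smul]
  rw [Finset.sum_congr rfl fun a _ => Finset.sum_comm, Finset.sum_comm]
  refine Finset.sum_congr rfl fun i _ => ?_
  have hI : Integrable (fun y => dyad Ψ i (x - y) (f y)) μ :=
    integrable_kernel_apply (hΨ.dyad i).continuous (hΨ.dyad i).2 hf x
  have hd : ∀ a c z, dyad (fun z => L a c (Ψ z)) i z = ⟪e a, dyad Ψ i z (b c)⟫ := fun a c z => by
    rw [dyad, dyad, hL, _root_.smul_apply, real_inner_smul_right, smul_eq_mul]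
  rw [← e.sum_repr' (∫ y, dyad Ψ i (x - y) (f y) ∂μ)]
  refine Finset.sum_congr rfl fun a _ => ?_
  rw [← Finset.sum_smul]
  congr 1
  rw [← integral_inner hI]
  have hJ : ∀ c, Integrable (fun y => dyad (fun z => L a c (Ψ z)) i (x - y) * ⟪b c, f y⟫) μ :=
    fun c => by
      simpa [mul_comm] using! integrable_kernel_apply (V := ℝ) (W := ℝ)
        (T := fun z => dyad (fun z => L a c (Ψ z)) i z • ContinuousLinearMap.id ℝ ℝ)
        (((hT a c).dyad i).continuous.smul continuous_const)
        (((hT a c).dyad i).2.smul_right) (hfc c) x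
  rw [← integral_finsetSum _ fun c _ => hJ c]
  refine integral_congr_ae (Eventually.of_forall fun y => ?_)
  dsimp only
  conv_rhs => rw [← b.sum_repr' (f y)]
  rw [map_sum, inner_sum]
  refine Finset.sum_congr rfl fun c _ => ?_
  rw [hd, map_smul, real_inner_smul_right, mul_comm]

end VectorMeasureConv

noncomputable section KernelConv

variable {n m : ℕ} {V W : Type*}
  [NormedAddCommGroup V] [InnerProductSpace ℝ V] [FiniteDimensional ℝ V]
  [NormedAddCommGroup W] [InnerProductSpace ℝ W] [FiniteDimensional ℝ W]

/-- Convolution of an operator valued kernel with the vector measure `f μ`. -/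
def kconv (T : Euc n → W →L[ℝ] V) (f : Euc n → W) (μ : Measure (Euc n)) (x : Euc n) : V :=
  ∫ y, T (x - y) (f y) ∂μ

variable {μ : Measure (Euc n)} {f : Euc n → W} {T : Euc n → W →L[ℝ] V}

lemma kconv_eq_convolution : kconv T f μ =
    convolution f T (ContinuousLinearMap.id ℝ (W →L[ℝ] V)).flip μ := rfl

lemma contDiff_kconv (hT : IsTestFun n T) (hf : LocallyIntegrable f μ) :
    ContDiff ℝ ∞ (kconv T f μ) := by
  rw [kconv_eq_convolution]
  exact hT.2.contDiff_convolution_right _ hf hT.1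

lemma fderiv_kconv (hT : IsTestFun n T) (hf : LocallyIntegrable f μ) (x v : Euc n) :
    fderiv ℝ (kconv T f μ) x v = kconv (fun z => fderiv ℝ T z v) f μ x := by
  have hT1 : Differentiable ℝ T := hT.1.differentiable (by simp)
  set T' : Euc n → W →L[ℝ] V := fun z => fderiv ℝ T z v with hT'
  have hT'c : IsTestFun n T' := ⟨hT.1.fderiv_dir v, hT.2.fderiv_apply ℝ v⟩
  obtain ⟨C, R, hC0, hR1, hC, -, hR⟩ := exists_pos_bounds hT'c
  have hmeas : ∀ t : ℝ, AEStronglyMeasurable (fun y => T (x + t • v - y) (f y)) μ := fun t =>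
    (integrable_kernel_apply hT.continuous hT.2 hf _).1
  have hd : ∀ y, ∀ t ∈ ball (0 : ℝ) 1, HasDerivAt (fun t : ℝ => T (x + t • v - y) (f y))
      (T' (x + t • v - y) (f y)) t := by
    intro y t _
    have h0 : HasDerivAt (fun t : ℝ => x + t • v - y) v t := by
      simpa using (((hasDerivAt_id t).smul_const v).const_add x).sub_const y
    have h1 := (hT1 (x + t • v - y)).hasFDerivAt.comp_hasDerivAt t h0
    exact ((ContinuousLinearMap.apply ℝ V (f y)).hasFDerivAt.comp_hasDerivAt t h1)
  have hbd : Integrable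
      (fun y => (closedBall x (‖v‖ + R)).indicator (fun y => C * ‖f y‖) y) μ := by
    refine IntegrableOn.integrable_indicator ?_ measurableSet_closedBall
    exact (hf.integrableOn_isCompact (isCompact_closedBall _ _)).norm.const_mul C
  have hle : ∀ y, ∀ t ∈ ball (0 : ℝ) 1, ‖T' (x + t • v - y) (f y)‖ ≤
      (closedBall x (‖v‖ + R)).indicator (fun y => C * ‖f y‖) y := by
    intro y t ht
    by_cases hy : y ∈ closedBall x (‖v‖ + R)
    · rw [Set.indicator_of_mem hy]
      exact ((T' _).le_opNorm _).trans (mul_le_mul_of_nonneg_right (hC _) (norm_nonneg _))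
    · rw [Set.indicator_of_notMem hy]
      by_cases h : T' (x + t • v - y) = 0
      · simp [h]
      · exfalso
        have h1 := hR _ h
        rw [mem_closedBall_iff_norm, not_le] at hy
        rw [mem_ball_zero_iff] at ht
        have h2 : y - x = t • v - (x + t • v - y) := by abel
        have h3 := norm_sub_le (t • v) (x + t • v - y)
        rw [← h2, norm_smul] at h3
        nlinarith [norm_nonneg v]
  have h := (hasDerivAt_integral_of_dominated_loc_of_deriv_le (μ := μ)
    (F := fun (t : ℝ) y => T (x + t • v - y) (f y)) (F' := fun t y => T' (x + t • v - y) (f y))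
    (x₀ := (0 : ℝ)) (ball_mem_nhds 0 one_pos) (Eventually.of_forall hmeas)
    (integrable_kernel_apply hT.continuous hT.2 hf _)
    (integrable_kernel_apply hT'c.continuous hT'c.2 hf _).1
    (Eventually.of_forall hle) hbd (Eventually.of_forall hd)).2
  have hk : HasFDerivAt (kconv T f μ) (fderiv ℝ (kconv T f μ) x) (x + (0 : ℝ) • v) := by
    rw [zero_smul, add_zero]
    exact ((contDiff_kconv hT hf).differentiable (by simp) x).hasFDerivAt
  have h0 : HasDerivAt (fun t : ℝ => x + t • v) v 0 := by
    simpa using ((hasDerivAt_id (0 : ℝ)).smul_const v).const_add x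
  have h4 := hk.comp_hasDerivAt (0 : ℝ) h0
  have h5 := HasDerivAt.unique (f := fun t : ℝ => kconv T f μ (x + t • v)) h4 h
  rw [h5, zero_smul, add_zero]
  rfl

lemma dirDeriv_kconv (hT : IsTestFun n T) (hf : LocallyIntegrable f μ) (I : Fin m → Fin n)
    (x : Euc n) : dirDeriv n m I (kconv T f μ) x = kconv (dirDeriv n m I T) f μ x := by
  induction m generalizing x with
  | zero =>
    have : dirDeriv n 0 I T = T := funext fun z => dirDeriv_fin_zero I T z
    rw [dirDeriv_fin_zero, this]
  | succ m ih =>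
    rw [dirDeriv_succ (contDiff_kconv hT hf), funext (ih (Fin.tail I)),
      fderiv_kconv (hT.dirDeriv _) hf]
    simp_rw [← dirDeriv_succ hT.1]

lemma dirDeriv_dyad {G : Type*} [NormedAddCommGroup G] [NormedSpace ℝ G] {Φ : Euc n → G}
    (hΦ : ContDiff ℝ ∞ Φ) (i : ℕ) (I : Fin m → Fin n) (x : Euc n) :
    dirDeriv n m I (dyad Φ i) x = ((2 : ℝ) ^ i) ^ m • dyad (dirDeriv n m I Φ) i x := by
  have h1 : ContDiff ℝ ∞ fun z : Euc n => Φ ((2 : ℝ) ^ i • z) := hΦ.comp (contDiff_id.const_smul _)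
  have := dirDeriv_const_smul (x := x) (h1.contDiffAt.of_le (by exact_mod_cast le_top))
    (((2 : ℝ) ^ i) ^ n) I
  rw [dyad, smul_comm, ← dirDeriv_comp_smul Φ x (by positivity) I]
  exact this

lemma dirDeriv_comp_sub_left {G : Type*} [NormedAddCommGroup G] [NormedSpace ℝ G]
    (Φ : Euc n → G) (I : Fin m → Fin n) (x y : Euc n) :
    dirDeriv n m I (fun y => Φ (x - y)) y = (-1 : ℝ) ^ m • dirDeriv n m I Φ (x - y) := by
  have h := dirDeriv_comp_smul (fun z => Φ (z + x)) y (c := -1) (by norm_num) I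
  have h2 : dirDeriv n m I (fun z => Φ (z + x)) ((-1 : ℝ) • y) = dirDeriv n m I Φ (x - y) := by
    rw [dirDeriv, iteratedFDeriv_comp_add_right, dirDeriv]
    congr 2
    simp [sub_eq_neg_add]
  rw [h2] at h
  rw [← h]
  congr 2
  funext z
  simp [sub_eq_neg_add]

lemma kconv_sub_kernel {T' : Euc n → W →L[ℝ] V} (hT : IsTestFun n T) (hT' : IsTestFun n T')
    (hf : LocallyIntegrable f μ) (x : Euc n) :
    kconv (fun z => T z - T' z) f μ x = kconv T f μ x - kconv T' f μ x := by
  rw [kconv, kconv, kconv, ← integral_sub (integrable_kernel_apply hT.continuous hT.2 hf x)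
    (integrable_kernel_apply hT'.continuous hT'.2 hf x)]
  rfl

lemma kconv_const_smul_kernel (c : ℝ) (x : Euc n) :
    kconv (fun z => c • T z) f μ x = c • kconv T f μ x := by
  rw [kconv, kconv, ← integral_smul]
  rfl

/-- Local `L¹` bound for the dyadic convolutions. -/
lemma lintegral_closedBall_kconv_dyad_le (hT : IsTestFun n T) [SFinite μ]
    (hf : LocallyIntegrable f μ) {R : ℝ} (hR : ∀ z, T z ≠ 0 → ‖z‖ ≤ R) (i : ℕ) {x₀ : Euc n}
    {ρ ρ' : ℝ} (hρ : R * (1 / 2) ^ i + ρ ≤ ρ') :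
    ∫⁻ x in closedBall x₀ ρ, ‖kconv (dyad T i) f μ x‖ₑ ≤
      (∫⁻ y in closedBall x₀ ρ', ‖f y‖ₑ ∂μ) * ∫⁻ z, ‖T z‖ₑ := by
  have hfK := hf.integrableOn_isCompact (isCompact_closedBall x₀ ρ')
  have hTi : ∫⁻ z, ‖dyad T i z‖ₑ = ∫⁻ z, ‖T z‖ₑ := by
    have h1 : Integrable (fun z => ‖dyad T i z‖) := (hT.dyad i).integrable.norm
    have h2 : Integrable (fun z => ‖T z‖) := hT.integrable.norm
    rw [← ofReal_integral_norm_eq_lintegral_enorm (hT.dyad i).integrable,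
      ← ofReal_integral_norm_eq_lintegral_enorm hT.integrable,
      ← integral_dyad (fun z => ‖T z‖) i]
    congr 2
    funext z
    rw [dyad, dyad, norm_smul, Real.norm_of_nonneg (by positivity), smul_eq_mul]
  have hpt : ∀ x ∈ closedBall x₀ ρ, ‖kconv (dyad T i) f μ x‖ₑ ≤
      ∫⁻ y in closedBall x₀ ρ', ‖dyad T i (x - y)‖ₑ * ‖f y‖ₑ ∂μ := by
    intro x hx
    have : kconv (dyad T i) f μ x = ∫ y in closedBall x₀ ρ', dyad T i (x - y) (f y) ∂μ := by
      refine (setIntegral_eq_integral_of_forall_compl_eq_zero fun y hy => ?_).symm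
      rw [dyad_eq_zero hR, zero_apply]
      rw [mem_closedBall_iff_norm, not_le] at hy
      rw [mem_closedBall_iff_norm] at hx
      have h1 : R * (1 / 2) ^ i < ‖x - y‖ := by
        have := norm_sub_norm_le (y - x₀) (x - x₀)
        rw [sub_sub_sub_cancel_right, norm_sub_rev y x] at this
        linarith
      have h2 := mul_lt_mul_of_pos_left h1 (show (0 : ℝ) < 2 ^ i by positivity)
      rwa [mul_left_comm, ← mul_pow, mul_one_div_cancel two_ne_zero, one_pow, mul_one] at h2
    rw [this]
    refine (enorm_integral_le_lintegral_enorm _).trans (lintegral_mono fun y => ?_)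
    exact ContinuousLinearMap.le_opENorm _ _
  refine (setLIntegral_mono' measurableSet_closedBall hpt).trans ?_
  have hm : AEMeasurable (Function.uncurry fun x y => ‖dyad T i (x - y)‖ₑ * ‖f y‖ₑ)
      (((volume : Measure (Euc n)).restrict (closedBall x₀ ρ)).prod
        (μ.restrict (closedBall x₀ ρ'))) := by
    refine AEMeasurable.mul (f := fun p : Euc n × Euc n => ‖dyad T i (p.1 - p.2)‖ₑ)
      (g := fun p => ‖f p.2‖ₑ) ?_ ?_
    · have hcq : Continuous fun p : Euc n × Euc n => ‖dyad T i (p.1 - p.2)‖ₑ :=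
        ((hT.dyad i).continuous.comp (continuous_fst.sub continuous_snd)).enorm
      exact Measurable.aemeasurable hcq.measurable
    · exact hfK.1.enorm.comp_snd
  rw [lintegral_lintegral_swap hm, mul_comm, ← lintegral_const_mul'' _ hfK.1.enorm]
  refine lintegral_mono fun y => ?_
  show ∫⁻ x in closedBall x₀ ρ, ‖dyad T i (x - y)‖ₑ * ‖f y‖ₑ ≤ (∫⁻ z, ‖T z‖ₑ) * ‖f y‖ₑ
  rw [lintegral_mul_const' _ _ enorm_ne_top]
  have hle : ∫⁻ x in closedBall x₀ ρ, ‖dyad T i (x - y)‖ₑ ≤ ∫⁻ z, ‖T z‖ₑ := by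
    refine (setLIntegral_le_lintegral _ _).trans ?_
    rw [← hTi, lintegral_sub_right_eq_self (fun z => ‖dyad T i z‖ₑ) y]
  exact mul_le_mul' hle le_rfl

/-- Uniform local `L¹` bound for the dyadic convolutions. -/
lemma exists_lintegral_kconv_dyad_le (hT : IsTestFun n T) [IsLocallyFiniteMeasure μ]
    (hf : LocallyIntegrable f μ) (ρ : ℝ) :
    ∃ C : ℝ≥0∞, C ≠ ⊤ ∧ ∀ i, ∫⁻ x in closedBall 0 ρ, ‖kconv (dyad T i) f μ x‖ₑ ≤ C := by
  obtain ⟨C, R, hC0, hR1, hC, -, hR⟩ := exists_pos_bounds hT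
  have hfK := hf.integrableOn_isCompact (isCompact_closedBall (0 : Euc n) (R + ρ))
  refine ⟨(∫⁻ y in closedBall 0 (R + ρ), ‖f y‖ₑ ∂μ) * ∫⁻ z, ‖T z‖ₑ,
    ENNReal.mul_ne_top hfK.2.ne hT.integrable.2.ne, fun i => ?_⟩
  refine lintegral_closedBall_kconv_dyad_le hT hf hR i (add_le_add ?_ le_rfl)
  exact mul_le_of_le_one_right (by linarith) (pow_le_one₀ (by norm_num) (by norm_num))

end KernelConv

section CommonMeasure

variable {n : ℕ} {G : Type*} [NormedAddCommGroup G] [NormedSpace ℝ G]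
  {ν lam : Measure (Euc n)}

lemma integral_rnDeriv_smul_of_le [SigmaFinite lam] [SigmaFinite ν] (h : ν ≤ lam)
    (F : Euc n → G) : ∫ y, F y ∂ν = ∫ y, (ν.rnDeriv lam y).toReal • F y ∂lam := by
  conv_lhs => rw [← Measure.withDensity_rnDeriv_eq ν lam (Measure.absolutelyContinuous_of_le h)]
  exact integral_withDensity_eq_integral_toReal_smul (Measure.measurable_rnDeriv ν lam)
    (Measure.rnDeriv_lt_top ν lam) F

lemma locallyIntegrable_rnDeriv_smul [SigmaFinite lam] [SigmaFinite ν] (h : ν ≤ lam)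
    {F : Euc n → G} (hF : LocallyIntegrable F ν) :
    LocallyIntegrable (fun y => (ν.rnDeriv lam y).toReal • F y) lam := by
  rw [locallyIntegrable_iff] at hF ⊢
  intro K hK
  have h1 := hF K hK
  rw [IntegrableOn, ← Measure.withDensity_rnDeriv_eq ν lam (Measure.absolutelyContinuous_of_le h),
    restrict_withDensity hK.measurableSet] at h1
  exact (integrable_withDensity_iff_integrable_smul' (Measure.measurable_rnDeriv ν lam)
    (ae_restrict_of_ae (Measure.rnDeriv_lt_top ν lam))).1 h1

/-- Lebesgue points with respect to `lam` along dyadic closed balls, normalized by the Lebesgue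
measure: at almost every point the oscillation of `p` around a multiple of the density of the
Lebesgue measure vanishes. -/
lemma ae_exists_tendsto_dyadic_oscillation [IsLocallyFiniteMeasure lam]
    (h : (volume : Measure (Euc n)) ≤ lam) {p : Euc n → G} (hp : LocallyIntegrable p lam) :
    ∀ᵐ x : Euc n, ∃ c : G, ∀ R : ℝ, 0 < R → Tendsto (fun i : ℕ => ((2 : ℝ) ^ i) ^ n *
      ∫ y in closedBall x (R * (1 / 2) ^ i),
        ‖p y - ((volume : Measure (Euc n)).rnDeriv lam y).toReal • c‖ ∂lam) atTop (𝓝 0) := by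
  set t : Euc n → ℝ := fun y => ((volume : Measure (Euc n)).rnDeriv lam y).toReal with ht
  have htl : LocallyIntegrable t lam := by
    have := locallyIntegrable_rnDeriv_smul h (F := fun _ => (1 : ℝ)) (locallyIntegrable_const _)
    simpa using this
  have hac := Measure.absolutelyContinuous_of_le h
  have h1 := hac.ae_le ((Besicovitch.vitaliFamily lam).ae_tendsto_average_norm_sub hp)
  have h2 := hac.ae_le ((Besicovitch.vitaliFamily lam).ae_tendsto_average_norm_sub htl)
  have h2' := hac.ae_le ((Besicovitch.vitaliFamily lam).ae_tendsto_average htl)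
  filter_upwards [h1, h2, h2', Measure.rnDeriv_pos hac,
    hac.ae_le (Measure.rnDeriv_lt_top volume lam)] with x h1 h2 h2' h3 h4
  have htx : 0 < t x := ENNReal.toReal_pos h3.ne' h4.ne
  refine ⟨(t x)⁻¹ • p x, fun R hR => ?_⟩
  have hB := (Besicovitch.tendsto_filterAt lam x).comp (tendsto_half_pow_mul hR)
  have g1 := h1.comp hB
  have g2 := h2.comp hB
  have g3 := h2'.comp hB
  have hvol : ∀ ρ, ∫ y in closedBall x ρ, t y ∂lam = volume.real (closedBall x ρ) := fun ρ =>
    Measure.setIntegral_toReal_rnDeriv hac _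
  set c := (t x)⁻¹ • p x with hc
  have hω : 0 < volume.real (closedBall (0 : Euc n) R) :=
    ENNReal.toReal_pos (measure_closedBall_pos volume _ hR).ne' measure_closedBall_lt_top.ne
  have hsc : ∀ i : ℕ, volume.real (closedBall x (R * (1 / 2) ^ i)) =
      ((1 / 2 : ℝ) ^ i) ^ n * volume.real (closedBall (0 : Euc n) R) := fun i => by
    rw [Measure.real, Measure.real, Measure.addHaar_closedBall volume _ (by positivity),
      Measure.addHaar_closedBall volume _ hR.le, finrank_euclideanSpace_fin, ENNReal.toReal_mul,
      ENNReal.toReal_mul, ENNReal.toReal_ofReal (by positivity),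
      ENNReal.toReal_ofReal (by positivity), mul_pow]
    ring
  -- bound by averages
  have key : Tendsto (fun i : ℕ => volume.real (closedBall (0 : Euc n) R) *
      ((⨍ y in closedBall x (R * (1 / 2) ^ i), t y ∂lam)⁻¹ *
      ((⨍ y in closedBall x (R * (1 / 2) ^ i), ‖p y - p x‖ ∂lam) +
        (⨍ y in closedBall x (R * (1 / 2) ^ i), ‖t y - t x‖ ∂lam) * ‖c‖))) atTop (𝓝 0) := by
    have := (((g3.inv₀ htx.ne').mul (g1.add (g2.mul_const ‖c‖)))).const_mul
      (volume.real (closedBall (0 : Euc n) R))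
    simpa using this
  refine squeeze_zero (fun i => by positivity) (fun i => ?_) key
  set B := closedBall x (R * (1 / 2) ^ i) with hBdef
  have hcpt : IsCompact B := isCompact_closedBall _ _
  have hlam : 0 < lam.real B := by
    refine ENNReal.toReal_pos (fun h0 => ?_) hcpt.measure_lt_top.ne
    exact (measure_closedBall_pos volume x (by positivity : 0 < R * (1 / 2) ^ i)).ne' (hac h0)
  have hpB := hp.integrableOn_isCompact hcpt
  have htB := htl.integrableOn_isCompact hcpt
  have hconst : IntegrableOn (fun _ => p x) B lam := integrableOn_const hcpt.measure_lt_top.ne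
  have hconst' : IntegrableOn (fun _ => t x) B lam := integrableOn_const hcpt.measure_lt_top.ne
  have hle : ∫ y in B, ‖p y - t y • c‖ ∂lam ≤
      (∫ y in B, ‖p y - p x‖ ∂lam) + (∫ y in B, ‖t y - t x‖ ∂lam) * ‖c‖ := by
    have i1 : Integrable (fun y => ‖p y - p x‖) (lam.restrict B) := (hpB.sub hconst).norm
    have i2 : Integrable (fun y => ‖t y - t x‖ * ‖c‖) (lam.restrict B) :=
      (htB.sub hconst').norm.mul_const _
    rw [← integral_mul_const, ← integral_add i1 i2]
    refine integral_mono (hpB.sub (htB.smul_const c)).norm (i1.add i2) fun y => ?_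
    have : p y - t y • c = (p y - p x) - (t y - t x) • c := by
      rw [sub_smul, hc, smul_smul (t x), mul_inv_cancel₀ htx.ne', one_smul]
      abel
    show ‖p y - t y • c‖ ≤ ‖p y - p x‖ + ‖t y - t x‖ * ‖c‖
    rw [this, ← norm_smul]
    exact norm_sub_le _ _
  have hinv : ((2 : ℝ) ^ i) ^ n = volume.real (closedBall (0 : Euc n) R) * (volume.real B)⁻¹ := by
    rw [hBdef, hsc i, one_div, inv_pow, inv_pow]
    field_simp
  rw [setAverage_eq, setAverage_eq, setAverage_eq, hvol, hinv, mul_assoc]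
  refine mul_le_mul_of_nonneg_left ?_ hω.le
  calc (volume.real B)⁻¹ * ∫ y in B, ‖p y - t y • c‖ ∂lam
      ≤ (volume.real B)⁻¹ * ((∫ y in B, ‖p y - p x‖ ∂lam) +
        (∫ y in B, ‖t y - t x‖ ∂lam) * ‖c‖) := by gcongr
    _ = _ := by
        simp only [smul_eq_mul, ← hBdef]
        field_simp

end CommonMeasure

section GeometricSeries

variable {n : ℕ} {V : Type*} [NormedAddCommGroup V] [NormedSpace ℝ V] [CompleteSpace V]

lemma exists_locallyIntegrable_hasSum {j : ℕ} (hj : 1 ≤ j) {g : ℕ → Euc n → V}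
    (hg : ∀ i, Continuous (g i))
    (hb : ∀ ρ : ℝ, ∃ C : ℝ≥0∞, C ≠ ⊤ ∧ ∀ i, ∫⁻ x in closedBall 0 ρ, ‖g i x‖ₑ ≤ C) :
    ∃ w : Euc n → V, LocallyIntegrable w volume ∧
      (∀ᵐ x : Euc n, HasSum (fun i => (((2 : ℝ) ^ i)⁻¹) ^ j • g i x) (w x)) ∧
      ∀ φ : Euc n → ℝ, Continuous φ → HasCompactSupport φ → Tendsto (fun N : ℕ =>
        ∫ x, φ x • ∑ i ∈ Finset.range N, (((2 : ℝ) ^ i)⁻¹) ^ j • g i x) atTop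
        (𝓝 (∫ x, φ x • w x)) := by
  set s : ℕ → Euc n → V := fun i x => (((2 : ℝ) ^ i)⁻¹) ^ j • g i x with hs
  have hsc : ∀ i, Continuous (s i) := fun i => (hg i).const_smul _
  set G : Euc n → ℝ≥0∞ := fun x => ∑' i, ‖s i x‖ₑ with hG
  have hGm : Measurable G := Measurable.tsum fun i => (hsc i).enorm.measurable
  have hsle : ∀ i x, ‖s i x‖ₑ ≤ ENNReal.ofReal ((1 / 2) ^ i) * ‖g i x‖ₑ := fun i x => by
    rw [hs, enorm_smul]
    refine mul_le_mul' ?_ le_rfl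
    rw [Real.enorm_of_nonneg (by positivity)]
    refine ENNReal.ofReal_le_ofReal ?_
    calc (((2 : ℝ) ^ i)⁻¹) ^ j ≤ (((2 : ℝ) ^ i)⁻¹) ^ 1 :=
          pow_le_pow_of_le_one (by positivity) (inv_le_one_of_one_le₀ (one_le_pow₀ one_le_two)) hj
      _ = (1 / 2) ^ i := by rw [pow_one, one_div, inv_pow]
  have hGint : ∀ ρ : ℝ, ∫⁻ x in closedBall 0 ρ, G x ≠ ⊤ := by
    intro ρ
    obtain ⟨C, hC, hle⟩ := hb ρ
    rw [hG, lintegral_tsum fun i => (hsc i).enorm.measurable.aemeasurable]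
    have h1 : ∀ i, ∫⁻ x in closedBall 0 ρ, ‖s i x‖ₑ ≤
        ENNReal.ofReal ((1 / 2) ^ i) * C := fun i => by
      refine (lintegral_mono (hsle i)).trans ?_
      rw [lintegral_const_mul _ (hg i).enorm.measurable]
      exact mul_le_mul' le_rfl (hle i)
    refine ((ENNReal.tsum_le_tsum h1).trans_lt ?_).ne
    rw [ENNReal.tsum_mul_right, ← ENNReal.ofReal_tsum_of_nonneg (fun i => by positivity)
      summable_geometric_two]
    exact ENNReal.mul_lt_top ENNReal.ofReal_lt_top hC.lt_top
  have hae : ∀ᵐ x : Euc n, G x < ⊤ := by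
    have h1 : ∀ N : ℕ, ∀ᵐ x : Euc n, x ∈ closedBall (0 : Euc n) N → G x < ⊤ := fun N =>
      (ae_restrict_iff' measurableSet_closedBall).1 (ae_lt_top hGm (hGint N))
    filter_upwards [ae_all_iff.2 h1] with x hx
    obtain ⟨N, hN⟩ := exists_nat_ge ‖x‖
    exact hx N (by rwa [mem_closedBall_zero_iff])
  have hsum : ∀ᵐ x : Euc n, Summable fun i => ‖s i x‖ := by
    filter_upwards [hae] with x hx
    have := ENNReal.summable_toReal hx.ne
    simpa using this
  set w : Euc n → V := fun x => ∑' i, s i x with hw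
  have hhs : ∀ᵐ x : Euc n, HasSum (fun i => s i x) (w x) := by
    filter_upwards [hsum] with x hx
    exact hx.of_norm.hasSum
  have hpc : ∀ N : ℕ, Continuous fun x => ∑ i ∈ Finset.range N, s i x := fun N =>
    continuous_finsetSum _ fun i _ => hsc i
  have hwm : AEStronglyMeasurable w volume := by
    refine aestronglyMeasurable_of_tendsto_ae atTop (f := fun N x => ∑ i ∈ Finset.range N, s i x)
      (fun N => (hpc N).aestronglyMeasurable) ?_
    filter_upwards [hhs] with x hx
    exact hx.tendsto_sum_nat
  have hpartial : ∀ N x, ‖∑ i ∈ Finset.range N, s i x‖ₑ ≤ G x := fun N x =>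
    (enorm_sum_le _ _).trans (ENNReal.sum_le_tsum _)
  have hwle : ∀ᵐ x : Euc n, ‖w x‖ₑ ≤ G x := by
    filter_upwards [hhs] with x hx
    exact le_of_tendsto hx.tendsto_sum_nat.enorm (Eventually.of_forall fun N => hpartial N x)
  refine ⟨w, ?_, hhs, fun φ hφ hφs => ?_⟩
  · rw [locallyIntegrable_iff]
    intro K hK
    obtain ⟨ρ, hρ⟩ := hK.isBounded.subset_closedBall (0 : Euc n)
    refine IntegrableOn.mono_set ⟨hwm.restrict, ?_⟩ hρ
    exact (lintegral_mono_ae (ae_restrict_of_ae hwle)).trans_lt (hGint ρ).lt_top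
  · obtain ⟨ρ, hρ⟩ := hφs.isCompact.isBounded.subset_closedBall (0 : Euc n)
    obtain ⟨M, hM⟩ := hφs.exists_bound_of_continuous hφ
    have hφ0 : ∀ x ∉ closedBall (0 : Euc n) ρ, φ x = 0 := fun x hx =>
      image_eq_zero_of_notMem_tsupport fun h => hx (hρ h)
    have hred : ∀ F : Euc n → V, ∫ x in closedBall 0 ρ, φ x • F x = ∫ x, φ x • F x := fun F =>
      setIntegral_eq_integral_of_forall_compl_eq_zero fun x hx => by rw [hφ0 x hx, zero_smul]
    simp_rw [← hred]
    refine tendsto_integral_of_dominated_convergence (fun x => M * (G x).toReal)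
      (fun N => (hφ.smul (hpc N)).aestronglyMeasurable) ?_ (fun N => ?_) ?_
    · exact (integrable_toReal_of_lintegral_ne_top hGm.aemeasurable (hGint ρ)).const_mul M
    · filter_upwards [ae_restrict_of_ae hae] with x hx
      rw [norm_smul]
      refine mul_le_mul (hM x) ?_ (norm_nonneg _) ((norm_nonneg _).trans (hM x))
      rw [← toReal_enorm]
      exact ENNReal.toReal_mono hx.ne (hpartial N x)
    · filter_upwards [ae_restrict_of_ae hhs] with x hx
      exact hx.tendsto_sum_nat.const_smul (φ x)

end GeometricSeries

section Representation

variable {n k : ℕ} {V W : Type*}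
  [NormedAddCommGroup V] [InnerProductSpace ℝ V] [FiniteDimensional ℝ V]
  [NormedAddCommGroup W] [InnerProductSpace ℝ W] [FiniteDimensional ℝ W]
  {A : CoeffOp n k V W} {u : Euc n → V} {σ : Measure (Euc n)} {f : Euc n → W}
  {S : Euc n → V →L[ℝ] V} {K : Euc n → W →L[ℝ] V}

lemma kconv_dyad_succ_sub (hS : IsTestFun n S) (hK : IsTestFun n K)
    (hSK : ∀ x, (2 : ℝ) ^ n • S ((2 : ℝ) • x) - S x =
      ∑ I, (dirDeriv n k I K x) ∘L LinearMap.toContinuousLinearMap (A I))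
    (hu : LocallyIntegrable u volume) (hf : LocallyIntegrable f σ)
    (hD : HasDistribA n k A u σ f) (i : ℕ) (x : Euc n) :
    ((2 : ℝ) ^ i) ^ k • (kconv (dyad S (i + 1)) u volume x - kconv (dyad S i) u volume x) =
      kconv (dyad K i) f σ x := by
  have hker : ∀ z, dyad S (i + 1) z - dyad S i z =
      ∑ I, dyad (dirDeriv n k I K) i z ∘L LinearMap.toContinuousLinearMap (A I) := by
    intro z
    have h1 := hSK ((2 : ℝ) ^ i • z)
    rw [smul_smul, ← pow_succ'] at h1
    simp only [dyad, ContinuousLinearMap.smul_comp]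
    rw [← Finset.smul_sum, ← h1, smul_sub, smul_smul, ← mul_pow, ← pow_succ]
  have hSd : ∀ I, IsTestFun n (dirDeriv n k I K) := fun I => hK.dirDeriv I
  have hKi : IsTestFun n (dyad K i) := hK.dyad i
  -- integrability of the pieces
  have hInt : ∀ I, Integrable (fun y => dyad (dirDeriv n k I K) i (x - y) (A I (u y)))
      (volume : Measure (Euc n)) := by
    intro I
    have hAu : LocallyIntegrable (fun y => A I (u y)) volume := by
      rw [locallyIntegrable_iff] at hu ⊢
      intro C hC
      exact (LinearMap.toContinuousLinearMap (A I)).integrable_comp (hu C hC)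
    exact integrable_kernel_apply ((hSd I).dyad i).continuous ((hSd I).dyad i).2 hAu x
  rw [← kconv_sub_kernel (hS.dyad _) (hS.dyad _) hu]
  have hsum : kconv (fun z => dyad S (i + 1) z - dyad S i z) u volume x =
      ∑ I, ∫ y, dyad (dirDeriv n k I K) i (x - y) (A I (u y)) := by
    rw [← integral_finsetSum _ fun I _ => hInt I, kconv]
    refine integral_congr_ae (Eventually.of_forall fun y => ?_)
    simp [hker]
  rw [hsum]
  refine ext_inner_right ℝ fun v => ?_
  obtain ⟨L, hLa⟩ : ∃ L : (W →L[ℝ] V) →L[ℝ] W, ∀ T w, ⟪w, L T⟫ = ⟪T w, v⟫ := by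
    refine ⟨LinearMap.mkContinuous
      { toFun := fun T => ContinuousLinearMap.adjoint T v
        map_add' := fun T T' => by simp
        map_smul' := fun c T => by simp } ‖v‖ fun T => ?_, fun T w =>
      ContinuousLinearMap.adjoint_inner_right T w v⟩
    have h1 := (ContinuousLinearMap.adjoint T).le_opNorm v
    rw [LinearIsometryEquiv.norm_map, mul_comm] at h1
    exact h1
  set φ : Euc n → W := fun y => L (dyad K i (x - y)) with hφ
  have hKx : ContDiff ℝ ∞ fun y => dyad K i (x - y) :=
    hKi.1.comp (contDiff_const.sub contDiff_id)
  have hφt : IsTestFun n φ := by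
    refine ⟨L.contDiff.comp hKx, ?_⟩
    have h1 : HasCompactSupport fun y => dyad K i (x - y) :=
      hKi.2.comp_homeomorph (Homeomorph.subLeft x)
    exact h1.comp_left (map_zero L)
  have hφd : ∀ I y, dirDeriv n k I φ y =
      (-1 : ℝ) ^ k • ((2 : ℝ) ^ i) ^ k • L (dyad (dirDeriv n k I K) i (x - y)) := by
    intro I y
    rw [hφ, dirDeriv_clm_comp I L (hKx.contDiffAt.of_le (by exact_mod_cast le_top)),
      dirDeriv_comp_sub_left, dirDeriv_dyad hK.1, map_smul, map_smul]
  have h := hD φ hφt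
  have hl : ∀ I, ∫ y, ⟪u y, LinearMap.adjoint (A I) (dirDeriv n k I φ y)⟫ =
      (-1 : ℝ) ^ k * ((2 : ℝ) ^ i) ^ k *
        ⟪∫ y, dyad (dirDeriv n k I K) i (x - y) (A I (u y)), v⟫ := by
    intro I
    rw [real_inner_comm, ← integral_inner (hInt I), ← integral_const_mul]
    refine integral_congr_ae (Eventually.of_forall fun y => ?_)
    simp only [hφd]
    rw [LinearMap.adjoint_inner_right, inner_smul_right, inner_smul_right, hLa, mul_assoc,
      real_inner_comm]
  have hr : ∫ y, ⟪f y, φ y⟫ ∂σ = ⟪kconv (dyad K i) f σ x, v⟫ := by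
    rw [kconv, real_inner_comm,
      ← integral_inner (integrable_kernel_apply hKi.continuous hKi.2 hf x)]
    refine integral_congr_ae (Eventually.of_forall fun y => ?_)
    simp only [hφ]
    rw [hLa, real_inner_comm]
  rw [← hr, ← h, inner_smul_left, sum_inner]
  simp_rw [hl]
  rw [← Finset.mul_sum, ← mul_assoc, ← mul_assoc, ← mul_pow]
  simp

end Representation

section WeakDerivatives

variable {n k : ℕ} {V W : Type*}
  [NormedAddCommGroup V] [InnerProductSpace ℝ V] [FiniteDimensional ℝ V]
  [NormedAddCommGroup W] [InnerProductSpace ℝ W] [FiniteDimensional ℝ W]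
  {A : CoeffOp n k V W} {u : Euc n → V} {σ : Measure (Euc n)} {f : Euc n → W}
  {S : Euc n → V →L[ℝ] V} {K : Euc n → W →L[ℝ] V}

lemma tendsto_kconv_dyad_id (hS : IsTestFun n S) (hS1 : ∫ x, S x = ContinuousLinearMap.id ℝ V)
    (hu : LocallyIntegrable u volume) :
    ∀ᵐ x : Euc n, Tendsto (fun N => kconv (dyad S N) u volume x) atTop (𝓝 (u x)) := by
  obtain ⟨C, R, hC0, hR1, hC, -, hR⟩ := exists_pos_bounds hS
  filter_upwards [ae_tendsto_dyadic_average hu (by linarith : 0 < R)] with x hx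
  rw [tendsto_iff_norm_sub_tendsto_zero]
  have h1 : Tendsto (fun i : ℕ => C * (((2 : ℝ) ^ i) ^ n *
      ∫ y in closedBall x (R * (1 / 2) ^ i), ‖u y - u x‖)) atTop (𝓝 0) := by
    simpa using hx.const_mul C
  refine squeeze_zero (fun i => norm_nonneg _) (fun N => ?_) h1
  have hloc : LocallyIntegrable (fun y => u y - u x) volume := hu.sub (locallyIntegrable_const _)
  have hSN := hS.dyad N
  have heq : kconv (dyad S N) u volume x - u x =
      ∫ y, dyad S N (x - y) (u y - u x) := by
    have h2 : ∫ y, dyad S N (x - y) (u x) = u x := by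
      have h3 : Integrable (fun y => dyad S N (x - y)) volume :=
        hSN.integrable.comp_sub_left x
      rw [← ContinuousLinearMap.integral_apply h3, integral_sub_left_eq_self (dyad S N) volume x,
        integral_dyad, hS1]
      rfl
    conv_lhs => rw [← h2]
    rw [kconv, ← integral_sub (integrable_kernel_apply hSN.continuous hSN.2 hu x)
      (integrable_kernel_apply (f := fun _ => u x) hSN.continuous hSN.2
        (locallyIntegrable_const _) x)]
    simp_rw [map_sub]
  rw [heq, ← mul_assoc, mul_comm C]
  refine norm_integral_le_mul_integral_closedBall (f := fun y => u y - u x)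
    (hloc.integrableOn_isCompact (isCompact_closedBall _ _)) (fun y _ => ?_) fun y hy => ?_
  · exact ((dyad S N (x - y)).le_opNorm _).trans
      (mul_le_mul_of_nonneg_right (norm_dyad_le hC N _) (norm_nonneg _))
  · rw [dyad_eq_zero hR, zero_apply]
    rw [mem_closedBall, not_le, dist_comm, dist_eq_norm, one_div, inv_pow,
      ← div_eq_mul_inv, div_lt_iff₀ (by positivity)] at hy
    linarith

lemma dirDeriv_kconv_dyad_eq (hS : IsTestFun n S) (hK : IsTestFun n K)
    (hSK : ∀ x, (2 : ℝ) ^ n • S ((2 : ℝ) • x) - S x =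
      ∑ I, (dirDeriv n k I K x) ∘L LinearMap.toContinuousLinearMap (A I))
    (hu : LocallyIntegrable u volume) (hf : LocallyIntegrable f σ)
    (hD : HasDistribA n k A u σ f) {m j : ℕ} (hmj : m + j = k) (I : Fin m → Fin n)
    (N : ℕ) (x : Euc n) :
    dirDeriv n m I (kconv (dyad S N) u volume) x = kconv (dirDeriv n m I S) u volume x +
      ∑ i ∈ Finset.range N, (((2 : ℝ) ^ i)⁻¹) ^ j • kconv (dyad (dirDeriv n m I K) i) f σ x := by
  have hctop : ((m : ℕ) : WithTop ℕ∞) ≤ ((⊤ : ℕ∞) : WithTop ℕ∞) := by exact_mod_cast le_top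
  induction N with
  | zero =>
    have h0 : dyad S 0 = S := by funext z; simp [dyad]
    rw [h0, dirDeriv_kconv hS hu, Finset.range_zero, Finset.sum_empty, add_zero]
  | succ N ih =>
    have hfun : kconv (dyad S (N + 1)) u volume = fun x =>
        kconv (dyad S N) u volume x + (((2 : ℝ) ^ N) ^ k)⁻¹ • kconv (dyad K N) f σ x := by
      funext x
      rw [← kconv_dyad_succ_sub hS hK hSK hu hf hD N x, smul_smul,
        inv_mul_cancel₀ (by positivity), one_smul]
      abel
    have hKc := contDiff_kconv (hK.dyad N) hf
    rw [Finset.sum_range_succ, ← add_assoc, ← ih, hfun, dirDeriv_add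
      (((contDiff_kconv (hS.dyad N) hu).of_le hctop).contDiffAt)
      ((hKc.const_smul _).of_le hctop).contDiffAt,
      dirDeriv_const_smul (hKc.of_le hctop).contDiffAt, dirDeriv_kconv (hK.dyad N) hf]
    have h1 : dirDeriv n m I (dyad K N) =
        fun z => ((2 : ℝ) ^ N) ^ m • dyad (dirDeriv n m I K) N z :=
      funext fun z => dirDeriv_dyad hK.1 N I z
    rw [h1, kconv_const_smul_kernel, smul_smul]
    congr 2
    rw [← hmj, pow_add, inv_pow]
    field_simp

/-- Weak derivatives of order `k - j` exist and are given by a dyadic series of smooth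
convolutions with the measure `𝒜 u`. -/
theorem exists_isWeakDerivFamily (hS : IsTestFun n S) (hK : IsTestFun n K)
    (hS1 : ∫ x, S x = ContinuousLinearMap.id ℝ V)
    (hSK : ∀ x, (2 : ℝ) ^ n • S ((2 : ℝ) • x) - S x =
      ∑ I, (dirDeriv n k I K x) ∘L LinearMap.toContinuousLinearMap (A I))
    (hu : LocallyIntegrable u volume) [IsLocallyFiniteMeasure σ] (hf : LocallyIntegrable f σ)
    (hD : HasDistribA n k A u σ f) {m j : ℕ} (hj : 1 ≤ j) (hmj : m + j = k) :
    ∃ v : (Fin m → Fin n) → Euc n → V, IsWeakDerivFamily n m u v ∧ ∀ I, ∃ w : Euc n → V,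
      (∀ᵐ x : Euc n, HasSum (fun i => (((2 : ℝ) ^ i)⁻¹) ^ j •
        kconv (dyad (dirDeriv n m I K) i) f σ x) (w x)) ∧
      ∀ x, v I x = kconv (dirDeriv n m I S) u volume x + w x := by
  have key : ∀ (m' j' : ℕ), 1 ≤ j' → m' + j' = k → ∀ I : Fin m' → Fin n, ∃ w : Euc n → V,
      LocallyIntegrable w volume ∧
      (∀ᵐ x : Euc n, HasSum (fun i => (((2 : ℝ) ^ i)⁻¹) ^ j' •
        kconv (dyad (dirDeriv n m' I K) i) f σ x) (w x)) ∧
      ∀ φ : Euc n → ℝ, Continuous φ → HasCompactSupport φ → Tendsto (fun N : ℕ =>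
        ∫ x, φ x • dirDeriv n m' I (kconv (dyad S N) u volume) x) atTop
        (𝓝 (∫ x, φ x • (kconv (dirDeriv n m' I S) u volume x + w x))) := by
    intro m' j' hj' hmj' I
    have hKI := hK.dirDeriv I
    obtain ⟨w, hw, hws, hwt⟩ := exists_locallyIntegrable_hasSum hj'
      (g := fun i => kconv (dyad (dirDeriv n m' I K) i) f σ)
      (fun i => (contDiff_kconv (hKI.dyad i) hf).continuous)
      (fun ρ => exists_lintegral_kconv_dyad_le hKI hf ρ)
    refine ⟨w, hw, hws, fun φ hφ hφs => ?_⟩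
    have hc : Continuous (kconv (dirDeriv n m' I S) u volume) :=
      (contDiff_kconv (hS.dirDeriv I) hu).continuous
    have hi : Integrable (fun x => φ x • kconv (dirDeriv n m' I S) u volume x) volume :=
      (hφ.smul hc).integrable_of_hasCompactSupport hφs.smul_right
    have h1 := (hwt φ hφ hφs).const_add
      (∫ x, φ x • kconv (dirDeriv n m' I S) u volume x)
    have h2 : ∫ x, φ x • (kconv (dirDeriv n m' I S) u volume x + w x) =
        (∫ x, φ x • kconv (dirDeriv n m' I S) u volume x) + ∫ x, φ x • w x := by
      simp_rw [smul_add]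
      exact integral_add hi (hw.integrable_smul_left_of_hasCompactSupport hφ hφs)
    rw [h2]
    refine h1.congr fun N => ?_
    simp_rw [dirDeriv_kconv_dyad_eq hS hK hSK hu hf hD hmj' I N, smul_add]
    refine (integral_add hi ?_).symm
    refine (hφ.smul (continuous_finsetSum _ fun i _ => ?_)).integrable_of_hasCompactSupport
      hφs.smul_right
    exact (contDiff_kconv (hKI.dyad i) hf).continuous.const_smul _
  obtain ⟨w0, hw0, hws0, hwt0⟩ := key 0 k (by omega) (by omega) Fin.elim0
  have hu0 : ∀ᵐ x : Euc n, u x = kconv (dirDeriv n 0 Fin.elim0 S) u volume x + w0 x := by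
    filter_upwards [hws0, tendsto_kconv_dyad_id hS hS1 hu] with x hx1 hx2
    refine tendsto_nhds_unique hx2 ((hx1.tendsto_sum_nat.const_add _).congr fun N => ?_)
    rw [← dirDeriv_kconv_dyad_eq hS hK hSK hu hf hD (by omega), dirDeriv_fin_zero]
  choose w hw hws hwt using key m j hj hmj
  refine ⟨fun I x => kconv (dirDeriv n m I S) u volume x + w I x, ⟨fun I => ?_, fun I φ hφ => ?_⟩,
    fun I => ⟨w I, hws I, fun x => rfl⟩⟩
  · exact ((contDiff_kconv (hS.dirDeriv I) hu).continuous.locallyIntegrable).add (hw I)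
  · have h1 := hwt0 _ (hφ.dirDeriv I).continuous (hφ.dirDeriv I).2
    have h2 := (hwt I φ hφ.continuous hφ.2).const_smul ((-1 : ℝ) ^ m)
    have h3 : ∫ x, dirDeriv n m I φ x • u x = ∫ x, dirDeriv n m I φ x •
        (kconv (dirDeriv n 0 Fin.elim0 S) u volume x + w0 x) :=
      integral_congr_ae (hu0.mono fun x hx => congrArg (dirDeriv n m I φ x • ·) hx)
    rw [h3]
    refine tendsto_nhds_unique h1 (h2.congr fun N => ?_)
    rw [← integral_dirDeriv_smul hφ (contDiff_kconv (hS.dyad N) hu)]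
    simp_rw [dirDeriv_fin_zero]

end WeakDerivatives

noncomputable section TaylorPolynomial

open scoped ContDiff Nat

variable {F : Type*} [NormedAddCommGroup F] [NormedSpace ℝ F] {n m l j : ℕ}

/-- The polynomial with center `x` and Taylor coefficients `C`. -/
def taylorPoly (n j : ℕ) (x : Euc n) (C : (l : ℕ) → (Fin l → Fin n) → F) (y : Euc n) : F :=
  ∑ l ∈ Finset.range (j + 1), (l ! : ℝ)⁻¹ • ∑ J : Fin l → Fin n, (∏ a, (y - x) (J a)) • C l J

lemma abs_prod_coord_le (h : Euc n) (J : Fin l → Fin n) : |∏ a, h (J a)| ≤ ‖h‖ ^ l := by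
  rw [Finset.abs_prod]
  calc ∏ a, |h (J a)| ≤ ∏ _a : Fin l, ‖h‖ :=
        Finset.prod_le_prod (fun _ _ => abs_nonneg _) fun a _ => by
          rw [← Real.norm_eq_abs]; exact PiLp.norm_apply_le h (J a)
    _ = ‖h‖ ^ l := by simp

lemma eq_sum_stdVec (h : Euc n) : h = ∑ i, h i • stdVec n i := by
  ext a
  simp [stdVec, Pi.single_apply, Finset.sum_apply]

lemma iteratedFDeriv_apply_const (g : Euc n → F) (x h : Euc n) :
    iteratedFDeriv ℝ l g x (fun _ => h) =
      ∑ J : Fin l → Fin n, (∏ a, h (J a)) • dirDeriv n l J g x := by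
  classical
  conv_lhs => rw [eq_sum_stdVec h]
  rw [ContinuousMultilinearMap.map_sum]
  refine Finset.sum_congr rfl fun J _ => ?_
  rw [ContinuousMultilinearMap.map_smul_univ]
  rfl

lemma norm_sum_prod_coord_smul_le {h : Euc n} {C : (Fin l → Fin n) → F} {B : ℝ}
    (hC : ∀ J, ‖C J‖ ≤ B) :
    ‖∑ J : Fin l → Fin n, (∏ a, h (J a)) • C J‖ ≤ (n : ℝ) ^ l * (‖h‖ ^ l * B) := by
  calc ‖∑ J : Fin l → Fin n, (∏ a, h (J a)) • C J‖ ≤ ∑ _J : Fin l → Fin n, ‖h‖ ^ l * B := by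
        refine norm_sum_le_of_le _ fun J _ => ?_
        rw [norm_smul, Real.norm_eq_abs]
        exact mul_le_mul (abs_prod_coord_le h J) (hC J) (norm_nonneg _) (by positivity)
    _ = _ := by simp

lemma norm_sub_taylorPoly_le [CompleteSpace F] {g : Euc n → F} (hg : ContDiff ℝ ∞ g)
    {x y : Euc n} {B : ℝ} (hB : ∀ z, ‖z - x‖ ≤ ‖y - x‖ → ∀ J, ‖dirDeriv n (j + 1) J g z‖ ≤ B) :
    ‖g y - taylorPoly n j x (fun l J => dirDeriv n l J g x) y‖ ≤
      (n : ℝ) ^ (j + 1) * (‖y - x‖ ^ (j + 1) * B) := by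
  have h := map_add_eq_sum_add_integral_iteratedFDeriv (f := g) (x := x) (y := y - x) (n := j)
    fun t _ => hg.contDiffAt.of_le (by exact_mod_cast le_top)
  rw [add_sub_cancel] at h
  simp only [taylorPoly, ← iteratedFDeriv_apply_const]
  rw [h, add_sub_cancel_left, norm_smul]
  have h1 : ‖∫ t in (0 : ℝ)..1,
      (1 - t) ^ j • iteratedFDeriv ℝ (j + 1) g (x + t • (y - x)) (fun _ => y - x)‖ ≤
      (n : ℝ) ^ (j + 1) * (‖y - x‖ ^ (j + 1) * B) * |(1 : ℝ) - 0| := by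
    refine intervalIntegral.norm_integral_le_of_norm_le_const fun t ht => ?_
    rw [Set.uIoc_of_le zero_le_one] at ht
    rw [norm_smul, iteratedFDeriv_apply_const]
    have h2 : ‖(1 - t) ^ j‖ ≤ 1 := by
      rw [norm_pow, Real.norm_eq_abs, abs_of_nonneg (by linarith [ht.2])]
      exact pow_le_one₀ (by linarith [ht.2]) (by linarith [ht.1])
    have h3 : ∀ J, ‖dirDeriv n (j + 1) J g (x + t • (y - x))‖ ≤ B := fun J => by
      refine hB _ ?_ J
      rw [add_sub_cancel_left, norm_smul, Real.norm_eq_abs, abs_of_pos ht.1]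
      exact mul_le_of_le_one_left (norm_nonneg _) ht.2
    refine (mul_le_of_le_one_left (norm_nonneg _) h2).trans ?_
    exact norm_sum_prod_coord_smul_le h3
  rw [sub_zero, abs_one, mul_one] at h1
  refine (mul_le_of_le_one_left (norm_nonneg _) ?_).trans h1
  rw [norm_inv, RCLike.norm_natCast]
  exact inv_le_one_of_one_le₀ (by exact_mod_cast Nat.factorial_pos j)

lemma iteratedFDeriv_eq_zero_of_le {f : Euc n → F} {a b : ℕ} (hab : a ≤ b)
    (h : ∀ x, iteratedFDeriv ℝ a f x = 0) (x : Euc n) : iteratedFDeriv ℝ b f x = 0 := by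
  induction b, hab using Nat.le_induction generalizing x with
  | base => exact h x
  | succ b _ ih =>
    have : iteratedFDeriv ℝ b f = 0 := funext ih
    ext v
    rw [iteratedFDeriv_succ_apply_left, this]
    simp

lemma IsPolyDeg.mono {P : Euc n → F} {a b : ℕ} (hab : a ≤ b) (h : IsPolyDeg n a P) :
    IsPolyDeg n b P :=
  ⟨h.1, iteratedFDeriv_eq_zero_of_le (by omega) h.2⟩

lemma isPolyDeg_coord (x : Euc n) (i : Fin n) : IsPolyDeg n 1 fun y : Euc n => (y - x) i := by
  have h1 : ContDiff ℝ ∞ fun y : Euc n => (y - x) i := by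
    have : ContDiff ℝ ∞ fun y : Euc n => (EuclideanSpace.proj i : Euc n →L[ℝ] ℝ) (y - x) := by
      fun_prop
    exact this
  refine ⟨h1, fun y => ?_⟩
  have h2 : ∀ z, fderiv ℝ (fun y : Euc n => (y - x) i) z = EuclideanSpace.proj i := fun z => by
    have := ((EuclideanSpace.proj i : Euc n →L[ℝ] ℝ).hasFDerivAt (x := z - x)).comp z
      ((hasFDerivAt_id z).sub_const x)
    exact this.fderiv
  ext v
  rw [iteratedFDeriv_succ_apply_right, funext h2]
  simp [iteratedFDeriv_succ_const]

lemma IsPolyDeg.smul {a : Euc n → ℝ} {f : Euc n → F} (ha : IsPolyDeg n 1 a)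
    (hf : IsPolyDeg n l f) : IsPolyDeg n (l + 1) fun y => a y • f y := by
  refine ⟨ha.1.smul hf.1, fun x => ?_⟩
  rw [← norm_le_zero_iff]
  refine (norm_iteratedFDeriv_smul_le ha.1 hf.1 x (n := l + 1 + 1)
    (by exact_mod_cast le_top)).trans_eq ?_
  refine Finset.sum_eq_zero fun i hi => ?_
  rw [Finset.mem_range] at hi
  by_cases h : 2 ≤ i
  · rw [iteratedFDeriv_eq_zero_of_le h ha.2]; simp
  · rw [iteratedFDeriv_eq_zero_of_le (by omega) hf.2]; simp

lemma IsPolyDeg.add {f g : Euc n → F} (hf : IsPolyDeg n l f) (hg : IsPolyDeg n l g) :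
    IsPolyDeg n l fun y => f y + g y := by
  refine ⟨hf.1.add hg.1, fun x => ?_⟩
  have h := iteratedFDeriv_add_apply (i := l + 1) (x := x)
    (hf.1.contDiffAt.of_le (by exact_mod_cast le_top))
    (hg.1.contDiffAt.of_le (by exact_mod_cast le_top))
  rw [hf.2, hg.2, add_zero] at h
  exact h

lemma IsPolyDeg.const (c : F) : IsPolyDeg n 0 fun _ : Euc n => c :=
  ⟨contDiff_const, fun x => by simp [iteratedFDeriv_succ_const]⟩

lemma IsPolyDeg.sum {ι : Type*} (s : Finset ι) {f : ι → Euc n → F}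
    (hf : ∀ i ∈ s, IsPolyDeg n l (f i)) : IsPolyDeg n l fun y => ∑ i ∈ s, f i y := by
  classical
  induction s using Finset.induction_on with
  | empty => simpa using (IsPolyDeg.const (0 : F)).mono (Nat.zero_le l)
  | insert a s ha ih =>
    simp only [Finset.sum_insert ha]
    exact (hf a (Finset.mem_insert_self a s)).add
      (ih fun i hi => hf i (Finset.mem_insert_of_mem hi))

lemma isPolyDeg_prod_coord_smul (x : Euc n) (J : Fin l → Fin n) (c : F) :
    IsPolyDeg n l fun y : Euc n => (∏ a, (y - x) (J a)) • c := by
  induction l with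
  | zero => simpa using IsPolyDeg.const c
  | succ l ih =>
    simp only [Fin.prod_univ_succ, mul_smul]
    exact (isPolyDeg_coord x (J 0)).smul (ih fun a => J a.succ)

lemma isPolyDeg_taylorPoly (x : Euc n) (C : (l : ℕ) → (Fin l → Fin n) → F) :
    IsPolyDeg n j (taylorPoly n j x C) := by
  refine IsPolyDeg.sum _ fun l hl => ?_
  rw [Finset.mem_range] at hl
  simp only [Finset.smul_sum]
  refine IsPolyDeg.sum _ fun J _ => ?_
  simp only [smul_comm ((l ! : ℝ)⁻¹)]
  exact (isPolyDeg_prod_coord_smul x J _).mono (by omega)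

lemma taylorPoly_sub (x y : Euc n) (C D : (l : ℕ) → (Fin l → Fin n) → F) :
    taylorPoly n j x (fun l J => C l J - D l J) y =
      taylorPoly n j x C y - taylorPoly n j x D y := by
  simp only [taylorPoly, smul_sub, Finset.sum_sub_distrib]

lemma taylorPoly_sum {ι : Type*} (s : Finset ι) (x y : Euc n)
    (C : ι → (l : ℕ) → (Fin l → Fin n) → F) :
    taylorPoly n j x (fun l J => ∑ i ∈ s, C i l J) y = ∑ i ∈ s, taylorPoly n j x (C i) y := by
  simp only [taylorPoly, Finset.smul_sum]
  rw [Finset.sum_comm]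
  refine Finset.sum_congr rfl fun l _ => Finset.sum_comm

lemma norm_taylorPoly_le {x y : Euc n} {C : (l : ℕ) → (Fin l → Fin n) → F} {B : ℝ}
    (hC : ∀ l ≤ j, ∀ J, ‖y - x‖ ^ l * ‖C l J‖ ≤ B) :
    ‖taylorPoly n j x C y‖ ≤ (∑ l ∈ Finset.range (j + 1), (n : ℝ) ^ l) * B := by
  rw [taylorPoly, Finset.sum_mul]
  refine norm_sum_le_of_le _ fun l hl => ?_
  rw [Finset.mem_range] at hl
  rw [norm_smul, norm_inv, RCLike.norm_natCast]
  refine (mul_le_of_le_one_left (norm_nonneg _)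
    (inv_le_one_of_one_le₀ (by exact_mod_cast Nat.factorial_pos l))).trans ?_
  calc ‖∑ J : Fin l → Fin n, (∏ a, (y - x) (J a)) • C l J‖ ≤ ∑ _J : Fin l → Fin n, B := by
        refine norm_sum_le_of_le _ fun J _ => ?_
        rw [norm_smul, Real.norm_eq_abs]
        exact (mul_le_mul_of_nonneg_right (abs_prod_coord_le _ J) (norm_nonneg _)).trans
          (hC l (by omega) J)
    _ = _ := by simp

end TaylorPolynomial

noncomputable section ScaleDecomposition

variable {n m j : ℕ} {V W : Type*}
  [NormedAddCommGroup V] [InnerProductSpace ℝ V] [FiniteDimensional ℝ V]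
  [NormedAddCommGroup W] [InnerProductSpace ℝ W] [FiniteDimensional ℝ W]

/-- Up to a polynomial of degree `j`, on small dyadic balls around `x` the map `f` splits at every
finer scale into a uniformly small, a smooth and an integrally small part. -/
def HasScaleDecomp (n j : ℕ) (f : Euc n → V) (x : Euc n) : Prop :=
  ∃ P : Euc n → V, IsPolyDeg n j P ∧ ∀ δ > (0 : ℝ), ∀ᶠ I : ℕ in atTop,
    ∃ (G : Euc n → V) (L H : ℕ → Euc n → V),
      (∀ y ∈ closedBall x ((1 / 2) ^ I), ‖G y‖ ≤ δ * ((1 / 2) ^ I) ^ j) ∧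
      (∀ y, L I y = 0) ∧ ∀ N ≥ I,
        (∀ y, f y - P y = G y + L N y + H N y) ∧
        (j < n → ∀ y ∈ closedBall x ((1 / 2) ^ I),
          ‖L N y‖ ≤ δ * ((1 / 2) ^ I) ^ n * (2 ^ N) ^ (n - j)) ∧
        (j = n → ∀ y ∈ closedBall x ((1 / 2) ^ I), ∀ z ∈ closedBall x ((1 / 2) ^ I),
          ‖L N y - L N z‖ ≤ δ * ((1 / 2) ^ I) ^ n * (2 ^ N * ‖y - z‖)) ∧
        ∀ a > (0 : ℝ), volume {y | y ∈ closedBall x ((1 / 2) ^ I) ∧ a < ‖H N y‖} ≤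
          ENNReal.ofReal (δ * ((1 / 2) ^ I) ^ n * ((1 / 2) ^ N) ^ j / a)

lemma exists_tendsto_sum_and_tail_le {s : ℕ → V} {η : ℕ → ℝ} {d : ℕ} (hd : 1 ≤ d)
    (hη : Tendsto η atTop (𝓝 0)) (hs : ∀ i, ‖s i‖ ≤ ((1 / 2 : ℝ) ^ i) ^ d * η i) :
    ∃ c, ∀ ε > (0 : ℝ), ∀ᶠ I : ℕ in atTop,
      ‖c - ∑ i ∈ Finset.range I, s i‖ ≤ ε * ((1 / 2) ^ I) ^ d := by
  have hkey : ∀ ε > (0 : ℝ), ∀ᶠ I : ℕ in atTop, ∀ i,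
      ‖s (i + I)‖ ≤ ε / 2 * ((1 / 2) ^ I) ^ d * (1 / 2) ^ i := by
    intro ε hε
    filter_upwards [eventually_forall_ge_atTop.2 (hη.eventually (Iic_mem_nhds (half_pos hε)))]
      with I hI i
    refine (hs _).trans ?_
    have h1 := hI (i + I) (by omega)
    have h2 : ((1 / 2 : ℝ) ^ (i + I)) ^ d ≤ ((1 / 2) ^ I) ^ d * (1 / 2) ^ i := by
      rw [pow_add, mul_pow, mul_comm]
      refine mul_le_mul_of_nonneg_left ?_ (by positivity)
      exact pow_le_of_le_one (by positivity) (pow_le_one₀ (by norm_num) (by norm_num)) (by omega)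
    calc ((1 / 2 : ℝ) ^ (i + I)) ^ d * η (i + I) ≤ ((1 / 2 : ℝ) ^ (i + I)) ^ d * (ε / 2) := by
          gcongr
      _ ≤ ((1 / 2) ^ I) ^ d * (1 / 2) ^ i * (ε / 2) := by gcongr
      _ = _ := by ring
  have hsum : Summable s := by
    obtain ⟨I, hI⟩ := (hkey 1 one_pos).exists
    rw [← summable_nat_add_iff I]
    refine Summable.of_norm_bounded (g := fun i => 1 / 2 * ((1 / 2 : ℝ) ^ I) ^ d * (1 / 2) ^ i)
      ?_ hI
    exact (summable_geometric_of_lt_one (by norm_num) (by norm_num)).mul_left _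
  refine ⟨∑' i, s i, fun ε hε => ?_⟩
  filter_upwards [hkey ε hε] with I hI
  rw [← hsum.sum_add_tsum_nat_add I, add_sub_cancel_left]
  have hg : HasSum (fun i : ℕ => ε / 2 * ((1 / 2 : ℝ) ^ I) ^ d * (1 / 2) ^ i)
      (ε / 2 * ((1 / 2) ^ I) ^ d * 2) :=
    hasSum_geometric_two.mul_left _
  refine (tsum_of_norm_bounded hg hI).trans_eq (by ring)

lemma norm_kconv_dyad_le {T : Euc n → W →L[ℝ] V} {q : Euc n → W} {lam : Measure (Euc n)}
    (hq : LocallyIntegrable q lam) {C R : ℝ} (hC : ∀ z, ‖T z‖ ≤ C)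
    (hR : ∀ z, T z ≠ 0 → ‖z‖ ≤ R) (i : ℕ) {x y : Euc n} {ρ : ℝ}
    (hρ : R * (1 / 2) ^ i + ‖y - x‖ ≤ ρ) :
    ‖kconv (dyad T i) q lam y‖ ≤ ((2 : ℝ) ^ i) ^ n * C * ∫ u in closedBall x ρ, ‖q u‖ ∂lam := by
  refine norm_integral_le_mul_integral_closedBall
    (hq.integrableOn_isCompact (isCompact_closedBall _ _)) (fun u _ => ?_) fun u hu => ?_
  · exact ((dyad T i _).le_opNorm _).trans
      (mul_le_mul_of_nonneg_right (norm_dyad_le hC i _) (norm_nonneg _))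
  · rw [dyad_eq_zero hR, zero_apply]
    rw [mem_closedBall_iff_norm, not_le] at hu
    have h1 : R * (1 / 2) ^ i < ‖y - u‖ := by
      have := norm_sub_norm_le (u - x) (y - x)
      rw [sub_sub_sub_cancel_right, norm_sub_rev u y] at this
      linarith
    have h2 := mul_lt_mul_of_pos_left h1 (show (0 : ℝ) < 2 ^ i by positivity)
    rwa [mul_left_comm, ← mul_pow, mul_one_div_cancel two_ne_zero, one_pow, mul_one] at h2

lemma norm_kconv_dyad_sub_le {T : Euc n → W →L[ℝ] V} (hT : IsTestFun n T) {q : Euc n → W}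
    {lam : Measure (Euc n)}
    (hq : LocallyIntegrable q lam) {C R : ℝ} (hC : ∀ z w, ‖T z - T w‖ ≤ C * ‖z - w‖)
    (hR : ∀ z, T z ≠ 0 → ‖z‖ ≤ R) (i : ℕ) {x y z : Euc n} {ρ : ℝ}
    (hy : R * (1 / 2) ^ i + ‖y - x‖ ≤ ρ) (hz : R * (1 / 2) ^ i + ‖z - x‖ ≤ ρ) :
    ‖kconv (dyad T i) q lam y - kconv (dyad T i) q lam z‖ ≤
      ((2 : ℝ) ^ i) ^ n * (C * (2 ^ i * ‖y - z‖)) * ∫ u in closedBall x ρ, ‖q u‖ ∂lam := by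
  have hTi := hT.dyad i
  rw [kconv, kconv, ← integral_sub (integrable_kernel_apply hTi.continuous hTi.2 hq y)
    (integrable_kernel_apply hTi.continuous hTi.2 hq z)]
  have haux : ∀ {w u : Euc n}, R * (1 / 2) ^ i + ‖w - x‖ ≤ ρ → u ∉ closedBall x ρ →
      dyad T i (w - u) = 0 := by
    intro w u hw hu
    refine dyad_eq_zero hR ?_
    rw [mem_closedBall_iff_norm, not_le] at hu
    have h1 : R * (1 / 2) ^ i < ‖w - u‖ := by
      have := norm_sub_norm_le (u - x) (w - x)
      rw [sub_sub_sub_cancel_right, norm_sub_rev u w] at this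
      linarith
    have h2 := mul_lt_mul_of_pos_left h1 (show (0 : ℝ) < 2 ^ i by positivity)
    rwa [mul_left_comm, ← mul_pow, mul_one_div_cancel two_ne_zero, one_pow, mul_one] at h2
  refine norm_integral_le_mul_integral_closedBall
    (hq.integrableOn_isCompact (isCompact_closedBall _ _)) (fun u _ => ?_) fun u hu => ?_
  · rw [← _root_.sub_apply]
    refine ((dyad T i (y - u) - dyad T i (z - u)).le_opNorm _).trans
      (mul_le_mul_of_nonneg_right ?_ (norm_nonneg _))
    have := norm_dyad_sub_le hC i (y - u) (z - u)
    rwa [sub_sub_sub_cancel_right] at this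
  · rw [haux hy hu, haux hz hu, zero_apply, sub_zero]

lemma exists_uniform_bounds {T : Euc n → W →L[ℝ] V} (hT : IsTestFun n T) (d : ℕ) :
    ∃ C R : ℝ, 0 < C ∧ 1 ≤ R ∧ (∀ z w, ‖T z - T w‖ ≤ C * ‖z - w‖) ∧
      ∀ l ≤ d, ∀ J : Fin l → Fin n, (∀ z, ‖dirDeriv n l J T z‖ ≤ C) ∧
        ∀ z, dirDeriv n l J T z ≠ 0 → ‖z‖ ≤ R := by
  obtain ⟨C₀, R₀, hC₀, hR₀, -, hL, -⟩ := exists_pos_bounds hT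
  choose Cf Rf hC0 hR1 hC _ hR using fun (p : (l : Fin (d + 1)) × (Fin l → Fin n)) =>
    exists_pos_bounds (hT.dirDeriv p.2)
  have hCs : ∀ p, Cf p ≤ ∑ p, Cf p := fun p =>
    Finset.single_le_sum (fun q _ => (hC0 q).le) (Finset.mem_univ p)
  have hRs : ∀ p, Rf p ≤ ∑ p, Rf p := fun p =>
    Finset.single_le_sum (fun q _ => zero_le_one.trans (hR1 q)) (Finset.mem_univ p)
  have hCn : 0 ≤ ∑ p, Cf p := Finset.sum_nonneg fun q _ => (hC0 q).le
  have hRn : 0 ≤ ∑ p, Rf p := Finset.sum_nonneg fun q _ => zero_le_one.trans (hR1 q)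
  refine ⟨C₀ + ∑ p, Cf p, R₀ + ∑ p, Rf p, by positivity, by linarith, fun z w => ?_,
    fun l hl J => ⟨fun z => ?_, fun z hz => ?_⟩⟩
  · refine (hL z w).trans (mul_le_mul_of_nonneg_right (by linarith) (norm_nonneg _))
  · have := hC ⟨⟨l, by omega⟩, J⟩ z
    have h2 := hCs ⟨⟨l, by omega⟩, J⟩
    linarith
  · have := hR ⟨⟨l, by omega⟩, J⟩ z hz
    have h2 := hRs ⟨⟨l, by omega⟩, J⟩
    linarith

end ScaleDecomposition

noncomputable section ScaleDecompositionOfKernel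

variable {n m j : ℕ} {V W : Type*}
  [NormedAddCommGroup V] [InnerProductSpace ℝ V] [FiniteDimensional ℝ V]
  [NormedAddCommGroup W] [InnerProductSpace ℝ W] [FiniteDimensional ℝ W]

lemma volume_tail_le {g : ℕ → Euc n → V} (hg : ∀ i, Continuous (g i)) {w : Euc n → V}
    (hw : ∀ᵐ y, HasSum (fun i => g i y) (w y)) (s : Set (Euc n)) (N : ℕ)
    {K : ℝ} (hK : ∀ i, ∫⁻ y in s, ‖g (i + N) y‖ₑ ≤ ENNReal.ofReal (K * (1 / 2) ^ i))
    (hK0 : 0 ≤ K) {a : ℝ} (ha : 0 < a) :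
    volume {y | y ∈ s ∧ a < ‖w y - ∑ i ∈ Finset.range N, g i y‖} ≤
      ENNReal.ofReal (2 * K / a) := by
  have hm : ∀ i, Measurable fun y => ‖g (i + N) y‖ₑ := fun i => (hg (i + N)).enorm.measurable
  have hS : Measurable fun y => ∑' i, ‖g (i + N) y‖ₑ := Measurable.tsum hm
  have h1 : ∫⁻ y in s, ∑' i, ‖g (i + N) y‖ₑ ≤ ENNReal.ofReal (2 * K) := by
    rw [lintegral_tsum fun i => (hm i).aemeasurable]
    refine (ENNReal.tsum_le_tsum hK).trans_eq ?_
    rw [← ENNReal.ofReal_tsum_of_nonneg (fun i => by positivity)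
      (summable_geometric_two.mul_left K), tsum_mul_left, tsum_geometric_two, mul_comm]
  have h2 : volume {y | y ∈ s ∧ a < ‖w y - ∑ i ∈ Finset.range N, g i y‖} ≤
      (volume.restrict s) {y | ENNReal.ofReal a ≤ ∑' i, ‖g (i + N) y‖ₑ} := by
    rw [Measure.restrict_apply (measurableSet_le measurable_const hS)]
    refine measure_mono_ae ?_
    filter_upwards [hw] with y hy hys
    refine ⟨?_, hys.1⟩
    show ENNReal.ofReal a ≤ _
    have h3 : w y - ∑ i ∈ Finset.range N, g i y = ∑' i, g (i + N) y := by
      rw [← hy.tsum_eq, ← hy.summable.sum_add_tsum_nat_add N, add_sub_cancel_left]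
    by_cases hf : ∑' i, ‖g (i + N) y‖ₑ = ⊤
    · rw [hf]; exact le_top
    · have h4 : Summable fun i => ‖g (i + N) y‖ := by
        have := ENNReal.summable_toReal hf
        simpa using this
      have h5 := norm_tsum_le_tsum_norm h4
      rw [← h3] at h5
      refine (ENNReal.ofReal_le_ofReal (hys.2.le.trans h5)).trans_eq ?_
      rw [ENNReal.ofReal_tsum_of_nonneg (fun _ => norm_nonneg _) h4]
      simp
  refine h2.trans ?_
  have h3 := (mul_meas_ge_le_lintegral₀ hS.aemeasurable (ENNReal.ofReal a)
    (μ := volume.restrict s)).trans h1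
  rw [ENNReal.ofReal_div_of_pos ha, ENNReal.le_div_iff_mul_le (Or.inl (by simpa using ha))
    (Or.inl ENNReal.ofReal_ne_top), mul_comm]
  exact h3

lemma sum_Ico_two_pow_le {d : ℕ} (hd : 1 ≤ d) (I N : ℕ) :
    ∑ i ∈ Finset.Ico I N, ((2 : ℝ) ^ i) ^ d ≤ (2 ^ N) ^ d := by
  have h : ∑ i ∈ Finset.range N, ((2 : ℝ) ^ i) ^ d ≤ (2 ^ N) ^ d := by
    induction N with
    | zero => simp
    | succ N ih =>
      rw [Finset.sum_range_succ, pow_succ, mul_pow]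
      have : (2 : ℝ) ≤ 2 ^ d := le_self_pow₀ one_le_two (by omega)
      have h0 : (0 : ℝ) ≤ (2 ^ N) ^ d := by positivity
      nlinarith
  refine (Finset.sum_le_sum_of_subset_of_nonneg ?_ fun _ _ _ => by positivity).trans h
  intro i hi
  simp only [Finset.mem_Ico, Finset.mem_range] at hi ⊢
  exact hi.2

theorem hasScaleDecomp_of_kernel {Ψ : Euc n → W →L[ℝ] V} (hΨ : IsTestFun n Ψ) (hj : 1 ≤ j)
    (hjn : j ≤ n) {q : Euc n → W} {lam : Measure (Euc n)} [SFinite lam]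
    (hq : LocallyIntegrable q lam) {x : Euc n}
    (ha : ∀ R > (0 : ℝ), Tendsto
      (fun i : ℕ => ((2 : ℝ) ^ i) ^ n * ∫ y in closedBall x (R * (1 / 2) ^ i), ‖q y‖ ∂lam)
      atTop (𝓝 0))
    (hb : ∀ J : Fin j → Fin n, ∃ l, Tendsto
      (fun N => ∑ i ∈ Finset.range N, kconv (dyad (dirDeriv n j J Ψ) i) q lam x) atTop (𝓝 l))
    {w : Euc n → V}
    (hw : ∀ᵐ y, HasSum (fun i => (((2 : ℝ) ^ i)⁻¹) ^ j • kconv (dyad Ψ i) q lam y) (w y)) :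
    HasScaleDecomp n j w x := by
  obtain ⟨C, R, hC0, hR1, hL, hD⟩ := exists_uniform_bounds hΨ (j + 1)
  set m : ℕ → ℝ := fun i =>
    ((2 : ℝ) ^ i) ^ n * ∫ y in closedBall x ((R + 1) * (1 / 2) ^ i), ‖q y‖ ∂lam with hm_def
  have hm : Tendsto m atTop (𝓝 0) := ha (R + 1) (by linarith)
  have hm0 : ∀ i, 0 ≤ m i := fun i =>
    mul_nonneg (by positivity) (integral_nonneg fun _ => norm_nonneg _)
  have hν : ∀ I, ∫ y in closedBall x ((R + 1) * (1 / 2) ^ I), ‖q y‖ ∂lam =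
      ((1 / 2 : ℝ) ^ I) ^ n * m I := fun I => by
    rw [hm_def]
    simp only
    rw [← mul_assoc, ← mul_pow, ← mul_pow]
    simp
  have hC := fun z => by simpa [dirDeriv_fin_zero] using (hD 0 (by omega) Fin.elim0).1 z
  have hR : ∀ z, Ψ z ≠ 0 → ‖z‖ ≤ R := fun z hz =>
    (hD 0 (by omega) Fin.elim0).2 z (by rwa [dirDeriv_fin_zero])
  have hrad : ∀ {I i : ℕ} {y : Euc n}, I ≤ i → ‖y - x‖ ≤ (1 / 2) ^ I →
      R * (1 / 2) ^ i + ‖y - x‖ ≤ (R + 1) * (1 / 2) ^ I := by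
    intro I i y hIi hy
    have : (1 / 2 : ℝ) ^ i ≤ (1 / 2) ^ I := pow_le_pow_of_le_one (by norm_num) (by norm_num) hIi
    nlinarith
  set g : ℕ → Euc n → V := fun i y => (((2 : ℝ) ^ i)⁻¹) ^ j • kconv (dyad Ψ i) q lam y with hg_def
  have hk : ∀ i, ContDiff ℝ ∞ (kconv (dyad Ψ i) q lam) := fun i => contDiff_kconv (hΨ.dyad i) hq
  have hg : ∀ i, ContDiff ℝ ∞ (g i) := fun i => (hk i).const_smul _
  have hgd : ∀ (l i : ℕ) (J : Fin l → Fin n) (z : Euc n), dirDeriv n l J (g i) z =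
      ((((2 : ℝ) ^ i)⁻¹) ^ j * ((2 : ℝ) ^ i) ^ l) • kconv (dyad (dirDeriv n l J Ψ) i) q lam z := by
    intro l i J z
    have h1 := dirDeriv_const_smul (x := z) ((hk i).contDiffAt.of_le (by exact_mod_cast le_top))
      ((((2 : ℝ) ^ i)⁻¹) ^ j) J
    rw [dirDeriv_kconv (hΨ.dyad i) hq, funext (dirDeriv_dyad hΨ.1 i J),
      kconv_const_smul_kernel, smul_smul] at h1
    exact h1
  have hgb : ∀ (l : ℕ), l ≤ j + 1 → ∀ (i : ℕ) (J : Fin l → Fin n) (z : Euc n),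
      ‖z - x‖ ≤ (1 / 2) ^ i →
      ‖dirDeriv n l J (g i) z‖ ≤ (((2 : ℝ) ^ i)⁻¹) ^ j * ((2 : ℝ) ^ i) ^ l * (C * m i) := by
    intro l hl i J z hz
    rw [hgd, norm_smul, Real.norm_of_nonneg (by positivity)]
    refine mul_le_mul_of_nonneg_left ?_ (by positivity)
    refine (norm_kconv_dyad_le hq (hD l hl J).1 (hD l hl J).2 i (hrad le_rfl hz)).trans_eq ?_
    rw [hm_def]
    ring
  have hcoef : ∀ l, ∀ J : Fin l → Fin n, ∃ c, l ≤ j → ∀ ε > (0 : ℝ), ∀ᶠ I : ℕ in atTop,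
      ‖c - ∑ i ∈ Finset.range I, dirDeriv n l J (g i) x‖ ≤ ε * ((1 / 2) ^ I) ^ (j - l) := by
    intro l J
    rcases lt_trichotomy l j with h | h | h
    · obtain ⟨c, hc⟩ := exists_tendsto_sum_and_tail_le (s := fun i => dirDeriv n l J (g i) x)
        (η := fun i => C * m i) (d := j - l) (by omega) (by simpa using hm.const_mul C)
        fun i => by
          refine (hgb l (by omega) i J x (by simp)).trans_eq ?_
          have : (((2 : ℝ) ^ i)⁻¹) ^ j * ((2 : ℝ) ^ i) ^ l = ((1 / 2 : ℝ) ^ i) ^ (j - l) := by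
            obtain ⟨d, rfl⟩ := Nat.exists_eq_add_of_lt h
            rw [show l + d + 1 - l = d + 1 by omega, add_assoc, pow_add, mul_right_comm, ← mul_pow,
              inv_mul_cancel₀ (by positivity), one_pow, one_mul, one_div, inv_pow (2 : ℝ) i]
          rw [this]
      exact ⟨c, fun _ => hc⟩
    · subst h
      obtain ⟨c, hc⟩ := hb J
      refine ⟨c, fun _ ε hε => ?_⟩
      have h1 : ∀ i, dirDeriv n l J (g i) x = kconv (dyad (dirDeriv n l J Ψ) i) q lam x := by
        intro i
        rw [hgd, ← mul_pow, inv_mul_cancel₀ (by positivity), one_pow, one_smul]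
      simp only [h1, tsub_self, pow_zero, mul_one]
      filter_upwards [(tendsto_iff_norm_sub_tendsto_zero.1 hc).eventually (Iic_mem_nhds hε)]
        with I hI
      rw [norm_sub_rev]
      exact hI
    · exact ⟨0, fun h' => absurd h' (by omega)⟩
  choose Cf hCf using hcoef
  refine ⟨taylorPoly n j x Cf, isPolyDeg_taylorPoly x Cf, fun δ hδ => ?_⟩
  set Sn : ℝ := ∑ l ∈ Finset.range (j + 1), (n : ℝ) ^ l with hSn
  have hSn0 : 0 ≤ Sn := Finset.sum_nonneg fun _ _ => by positivity
  set B : ℝ := (∫⁻ z, ‖Ψ z‖ₑ).toReal with hB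
  have hB0 : 0 ≤ B := ENNReal.toReal_nonneg
  have e1 : ∀ᶠ I : ℕ in atTop, ∀ (l : Fin (j + 1)) (J : Fin l → Fin n),
      ‖Cf l J - ∑ i ∈ Finset.range I, dirDeriv n l J (g i) x‖ ≤
        δ / (2 * (Sn + 1)) * ((1 / 2) ^ I) ^ (j - l) := by
    rw [eventually_all]
    intro l
    rw [eventually_all]
    intro J
    exact hCf l J (by omega) _ (by positivity)
  have e2 : ∀ᶠ I : ℕ in atTop, (n : ℝ) ^ (j + 1) * C *
      ∑ i ∈ Finset.range I, (1 / 2 : ℝ) ^ (I - i) * m i ≤ δ / 2 := by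
    have := (tendsto_sum_geometric_mul hm).const_mul ((n : ℝ) ^ (j + 1) * C)
    rw [mul_zero] at this
    exact this.eventually (Iic_mem_nhds (half_pos hδ))
  have e3 : ∀ᶠ I : ℕ in atTop, C * m I ≤ δ := by
    have := hm.const_mul C
    rw [mul_zero] at this
    exact this.eventually (Iic_mem_nhds hδ)
  have e4 : ∀ᶠ I : ℕ in atTop, 2 * B * m I ≤ δ := by
    have := hm.const_mul (2 * B)
    rw [mul_zero] at this
    exact this.eventually (Iic_mem_nhds hδ)
  filter_upwards [e1, e2, e3, e4] with I h1 h2 h3 h4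
  set c : ℕ → (l : ℕ) → (Fin l → Fin n) → V := fun i l J => dirDeriv n l J (g i) x with hc
  refine ⟨fun y => (∑ i ∈ Finset.range I, (g i y - taylorPoly n j x (c i) y)) -
      taylorPoly n j x (fun l J => Cf l J - ∑ i ∈ Finset.range I, c i l J) y,
    fun N y => ∑ i ∈ Finset.Ico I N, g i y, fun N y => w y - ∑ i ∈ Finset.range N, g i y,
    fun y hy => ?_, fun y => by simp,
    fun N hN => ⟨fun y => ?_, fun hjn' y hy => ?_, fun hjn' y hy z hz => ?_,
      fun a ha0 => ?_⟩⟩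
  · rw [mem_closedBall_iff_norm] at hy
    have b1 : ‖∑ i ∈ Finset.range I, (g i y - taylorPoly n j x (c i) y)‖ ≤
        δ / 2 * ((1 / 2) ^ I) ^ j := by
      have b2 : ‖∑ i ∈ Finset.range I, (g i y - taylorPoly n j x (c i) y)‖ ≤
          ∑ i ∈ Finset.range I, (n : ℝ) ^ (j + 1) * C *
            ((1 / 2 : ℝ) ^ (I - i) * m i) * ((1 / 2) ^ I) ^ j := by
        refine norm_sum_le_of_le _ fun i hi => ?_
        rw [Finset.mem_range] at hi
        have hyi : ∀ z, ‖z - x‖ ≤ ‖y - x‖ → ∀ J,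
            ‖dirDeriv n (j + 1) J (g i) z‖ ≤ 2 ^ i * (C * m i) := by
          intro z hz J
          refine (hgb (j + 1) le_rfl i J z (hz.trans (hy.trans
            (pow_le_pow_of_le_one (by norm_num) (by norm_num) hi.le)))).trans_eq ?_
          rw [pow_succ, ← mul_assoc ((((2 : ℝ) ^ i)⁻¹) ^ j), ← mul_pow,
            inv_mul_cancel₀ (by positivity), one_pow, one_mul]
        refine (norm_sub_taylorPoly_le (hg i) hyi).trans ?_
        have h5 : ‖y - x‖ ^ (j + 1) ≤ ((1 / 2) ^ I) ^ (j + 1) :=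
          pow_le_pow_left₀ (norm_nonneg _) hy _
        have h6 : (1 / 2 : ℝ) ^ I * 2 ^ i = (1 / 2) ^ (I - i) := by
          obtain ⟨d, rfl⟩ := Nat.exists_eq_add_of_le hi.le
          rw [add_tsub_cancel_left, pow_add, mul_right_comm, ← mul_pow]
          norm_num
        have hmi := hm0 i
        calc (n : ℝ) ^ (j + 1) * (‖y - x‖ ^ (j + 1) * (2 ^ i * (C * m i)))
            ≤ (n : ℝ) ^ (j + 1) * (((1 / 2) ^ I) ^ (j + 1) * (2 ^ i * (C * m i))) := by gcongr
          _ = (n : ℝ) ^ (j + 1) * C * (((1 / 2 : ℝ) ^ I * 2 ^ i) * m i) * ((1 / 2) ^ I) ^ j := by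
              ring
          _ = _ := by rw [h6]
      rw [← Finset.sum_mul, ← Finset.mul_sum] at b2
      exact b2.trans (by gcongr)
    have b3 : ‖taylorPoly n j x (fun l J => Cf l J - ∑ i ∈ Finset.range I, c i l J) y‖ ≤
        δ / 2 * ((1 / 2) ^ I) ^ j := by
      refine (norm_taylorPoly_le (B := δ / (2 * (Sn + 1)) * ((1 / 2) ^ I) ^ j)
        fun l hl J => ?_).trans ?_
      · have h5 : ‖y - x‖ ^ l ≤ ((1 / 2) ^ I) ^ l := pow_le_pow_left₀ (norm_nonneg _) hy _
        refine (mul_le_mul h5 (h1 ⟨l, by omega⟩ J) (norm_nonneg _) (by positivity)).trans_eq ?_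
        rw [mul_left_comm, ← pow_add, Nat.add_sub_cancel' hl]
      · rw [← mul_assoc]
        refine mul_le_mul_of_nonneg_right ?_ (by positivity)
        rw [← mul_div_assoc, div_le_div_iff₀ (by positivity) two_pos]
        nlinarith
    refine (norm_sub_le _ _).trans ((add_le_add b1 b3).trans_eq (by ring))
  · simp only
    rw [taylorPoly_sub, taylorPoly_sum, Finset.sum_sub_distrib, ← Finset.sum_range_add_sum_Ico _ hN]
    abel
  · rw [mem_closedBall_iff_norm] at hy
    have b1 : ∀ i ∈ Finset.Ico I N, ‖g i y‖ ≤
        C * (((1 / 2) ^ I) ^ n * m I) * (2 ^ i) ^ (n - j) := by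
      intro i hi
      rw [Finset.mem_Ico] at hi
      rw [hg_def]
      simp only
      rw [norm_smul, Real.norm_of_nonneg (by positivity)]
      have h5 := norm_kconv_dyad_le hq hC hR i (hrad hi.1 hy)
      rw [hν] at h5
      have h6 : (((2 : ℝ) ^ i)⁻¹) ^ j * ((2 : ℝ) ^ i) ^ n = (2 ^ i) ^ (n - j) := by
        obtain ⟨d, rfl⟩ := Nat.exists_eq_add_of_lt hjn'
        rw [show j + d + 1 - j = d + 1 by omega, add_assoc, pow_add, ← mul_assoc, ← mul_pow,
          inv_mul_cancel₀ (by positivity), one_pow, one_mul]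
      calc (((2 : ℝ) ^ i)⁻¹) ^ j * ‖kconv (dyad Ψ i) q lam y‖
          ≤ (((2 : ℝ) ^ i)⁻¹) ^ j * (((2 : ℝ) ^ i) ^ n * C * (((1 / 2) ^ I) ^ n * m I)) := by gcongr
        _ = C * (((1 / 2) ^ I) ^ n * m I) * ((((2 : ℝ) ^ i)⁻¹) ^ j * ((2 : ℝ) ^ i) ^ n) := by ring
        _ = _ := by rw [h6]
    refine (norm_sum_le_of_le _ b1).trans ?_
    rw [← Finset.mul_sum]
    have hmI := hm0 I
    calc _ ≤ C * (((1 / 2) ^ I) ^ n * m I) * (2 ^ N) ^ (n - j) := by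
          gcongr
          exact sum_Ico_two_pow_le (by omega) I N
      _ = (C * m I) * ((1 / 2) ^ I) ^ n * (2 ^ N) ^ (n - j) := by ring
      _ ≤ _ := by gcongr
  · rw [mem_closedBall_iff_norm] at hy hz
    have hmI := hm0 I
    have b1 : ∀ i ∈ Finset.Ico I N, ‖g i y - g i z‖ ≤
        C * (((1 / 2) ^ I) ^ n * m I) * ‖y - z‖ * (2 ^ i) ^ 1 := by
      intro i hi
      rw [Finset.mem_Ico] at hi
      rw [hg_def]
      simp only
      rw [← smul_sub, norm_smul, Real.norm_of_nonneg (by positivity)]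
      have h5 := norm_kconv_dyad_sub_le hΨ hq hL hR i (hrad hi.1 hy) (hrad hi.1 hz)
      rw [hν] at h5
      have h6 : (((2 : ℝ) ^ i)⁻¹) ^ j * ((2 : ℝ) ^ i) ^ n = 1 := by
        rw [hjn', ← mul_pow, inv_mul_cancel₀ (by positivity), one_pow]
      calc (((2 : ℝ) ^ i)⁻¹) ^ j * ‖kconv (dyad Ψ i) q lam y - kconv (dyad Ψ i) q lam z‖
          ≤ (((2 : ℝ) ^ i)⁻¹) ^ j * (((2 : ℝ) ^ i) ^ n * (C * (2 ^ i * ‖y - z‖)) *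
            (((1 / 2) ^ I) ^ n * m I)) := by gcongr
        _ = C * (((1 / 2) ^ I) ^ n * m I) * ‖y - z‖ * (2 ^ i) ^ 1 *
            ((((2 : ℝ) ^ i)⁻¹) ^ j * ((2 : ℝ) ^ i) ^ n) := by ring
        _ = _ := by rw [h6, mul_one]
    rw [← Finset.sum_sub_distrib]
    refine (norm_sum_le_of_le _ b1).trans ?_
    rw [← Finset.mul_sum]
    calc _ ≤ C * (((1 / 2) ^ I) ^ n * m I) * ‖y - z‖ * (2 ^ N) ^ 1 := by
          gcongr
          exact sum_Ico_two_pow_le le_rfl I N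
      _ = (C * m I) * ((1 / 2) ^ I) ^ n * (2 ^ N * ‖y - z‖) := by ring
      _ ≤ _ := by gcongr
  · have hmI := hm0 I
    have hpt : ∀ i, ∫⁻ y in closedBall x ((1 / 2) ^ I), ‖g (i + N) y‖ₑ ≤
        ENNReal.ofReal (((1 / 2) ^ N) ^ j * (((1 / 2) ^ I) ^ n * m I * B) * (1 / 2) ^ i) := by
      intro i
      have h5 := lintegral_closedBall_kconv_dyad_le hΨ hq hR (i + N) (x₀ := x)
        (ρ := (1 / 2) ^ I) (ρ' := (R + 1) * (1 / 2) ^ I) (by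
          have : (1 / 2 : ℝ) ^ (i + N) ≤ (1 / 2) ^ I :=
            pow_le_pow_of_le_one (by norm_num) (by norm_num) (by omega)
          nlinarith)
      rw [← ofReal_integral_norm_eq_lintegral_enorm
        (hq.integrableOn_isCompact (isCompact_closedBall _ _)), hν,
        ← ENNReal.ofReal_toReal hΨ.integrable.2.ne, ← ENNReal.ofReal_mul (by positivity)] at h5
      simp only [hg_def, enorm_smul]
      rw [lintegral_const_mul' _ _ enorm_ne_top, Real.enorm_of_nonneg (by positivity)]
      refine (mul_le_mul' le_rfl h5).trans ?_
      rw [← ENNReal.ofReal_mul (by positivity)]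
      refine ENNReal.ofReal_le_ofReal ?_
      rw [← hB]
      have h6 : (((2 : ℝ) ^ (i + N))⁻¹) ^ j ≤ ((1 / 2) ^ N) ^ j * (1 / 2) ^ i := by
        rw [← inv_pow, ← one_div, pow_add, mul_pow, mul_comm]
        refine mul_le_mul_of_nonneg_left ?_ (by positivity)
        exact pow_le_of_le_one (by positivity) (pow_le_one₀ (by norm_num) (by norm_num)) (by omega)
      calc (((2 : ℝ) ^ (i + N))⁻¹) ^ j * (((1 / 2) ^ I) ^ n * m I * B)
          ≤ (((1 / 2) ^ N) ^ j * (1 / 2) ^ i) * (((1 / 2) ^ I) ^ n * m I * B) := by gcongr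
        _ = _ := by ring
    refine (volume_tail_le (fun i => (hg i).continuous) hw _ N hpt
      (by positivity) ha0).trans (ENNReal.ofReal_le_ofReal ?_)
    refine div_le_div_of_nonneg_right ?_ ha0.le
    calc 2 * (((1 / 2) ^ N) ^ j * (((1 / 2) ^ I) ^ n * m I * B))
        = (2 * B * m I) * ((1 / 2) ^ I) ^ n * ((1 / 2) ^ N) ^ j := by ring
      _ ≤ _ := by gcongr

end ScaleDecompositionOfKernel

section Assembly

variable {n k j m : ℕ} {V W : Type*}
  [NormedAddCommGroup V] [InnerProductSpace ℝ V] [FiniteDimensional ℝ V]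
  [NormedAddCommGroup W] [InnerProductSpace ℝ W] [FiniteDimensional ℝ W]

lemma contDiff_dirDeriv_bounded {h : Euc n → V} (hh : ContDiff ℝ ∞ h) (l : ℕ) (x : Euc n) :
    ∃ B, 0 ≤ B ∧ ∀ z ∈ closedBall x 1, ∀ J : Fin l → Fin n, ‖dirDeriv n l J h z‖ ≤ B := by
  have h1 : ∀ J : Fin l → Fin n, ∃ B, ∀ z ∈ closedBall x 1, ‖dirDeriv n l J h z‖ ≤ B := fun J =>
    (isCompact_closedBall x 1).exists_bound_of_continuousOn
      (contDiff_dirDeriv hh J).continuous.continuousOn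
  choose B hB using h1
  refine ⟨∑ J, |B J|, Finset.sum_nonneg fun J _ => abs_nonneg _, fun z hz J => ?_⟩
  exact (hB J z hz).trans ((le_abs_self _).trans
    (Finset.single_le_sum (f := fun J => |B J|) (fun J _ => abs_nonneg _) (Finset.mem_univ J)))

lemma HasScaleDecomp.add_smooth {w h : Euc n → V} {x : Euc n} (hw : HasScaleDecomp n j w x)
    (hh : ContDiff ℝ ∞ h) : HasScaleDecomp n j (fun y => w y + h y) x := by
  obtain ⟨P, hP, hd⟩ := hw
  obtain ⟨B, hB0, hB⟩ := contDiff_dirDeriv_bounded hh (j + 1) x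
  refine ⟨fun y => P y + taylorPoly n j x (fun l J => dirDeriv n l J h x) y,
    hP.add (isPolyDeg_taylorPoly x _), fun δ hδ => ?_⟩
  have hlim : Tendsto (fun I : ℕ => (n : ℝ) ^ (j + 1) * B * (1 / 2 : ℝ) ^ I) atTop (𝓝 0) := by
    simpa using (tendsto_pow_atTop_nhds_zero_of_lt_one (by norm_num : (0 : ℝ) ≤ 1 / 2)
      (by norm_num)).const_mul ((n : ℝ) ^ (j + 1) * B)
  filter_upwards [hd (δ / 2) (half_pos hδ), hlim.eventually (Iic_mem_nhds (half_pos hδ))]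
    with I ⟨G, L, H, hG, hL, hN⟩ hI
  refine ⟨fun y => G y + (h y - taylorPoly n j x (fun l J => dirDeriv n l J h x) y), L, H,
    fun y hy => ?_, hL, fun N hIN => ?_⟩
  · have hy1 : ‖y - x‖ ≤ (1 / 2) ^ I := by simpa [dist_eq_norm] using hy
    have h1 := norm_sub_taylorPoly_le hh (x := x) (y := y) (j := j) (B := B) fun z hz J => hB z
      (mem_closedBall_iff_norm.2 (hz.trans (hy1.trans
        (pow_le_one₀ (by norm_num) (by norm_num))))) J
    have h2 : (n : ℝ) ^ (j + 1) * (‖y - x‖ ^ (j + 1) * B) ≤ δ / 2 * ((1 / 2) ^ I) ^ j := by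
      calc (n : ℝ) ^ (j + 1) * (‖y - x‖ ^ (j + 1) * B)
          ≤ (n : ℝ) ^ (j + 1) * (((1 / 2) ^ I) ^ (j + 1) * B) := by gcongr
        _ = (n : ℝ) ^ (j + 1) * B * (1 / 2 : ℝ) ^ I * ((1 / 2) ^ I) ^ j := by ring
        _ ≤ _ := by
          have hI' : (n : ℝ) ^ (j + 1) * B * (1 / 2 : ℝ) ^ I ≤ δ / 2 := hI
          gcongr
    calc _ ≤ δ / 2 * ((1 / 2) ^ I) ^ j + δ / 2 * ((1 / 2) ^ I) ^ j :=
          (norm_add_le _ _).trans (add_le_add (hG y hy) (h1.trans h2))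
      _ = _ := by ring
  · obtain ⟨h1, h2, h3, h4⟩ := hN N hIN
    have hδ2 : δ / 2 ≤ δ := by linarith
    refine ⟨fun y => ?_, fun hj y hy => (h2 hj y hy).trans (by gcongr),
      fun hj y hy z hz => (h3 hj y hy z hz).trans (by gcongr),
      fun a ha => (h4 a ha).trans (ENNReal.ofReal_le_ofReal (by gcongr))⟩
    have := h1 y
    rw [sub_eq_iff_eq_add] at this
    simp only
    rw [this]
    abel

lemma kconv_density {Φ : Euc n → W →L[ℝ] V} (hΦ : IsTestFun n Φ) {lam : Measure (Euc n)}
    [SigmaFinite lam] (h : volume ≤ lam) (c : W) (i : ℕ) (y : Euc n) :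
    kconv (dyad Φ i) (fun z => (volume.rnDeriv lam z).toReal • c) lam y = (∫ z, Φ z) c := by
  have h1 := integral_rnDeriv_smul_of_le h fun z => dyad Φ i (y - z) c
  simp only [kconv, map_smul]
  rw [← h1, ← integral_dyad Φ i, ← integral_sub_left_eq_self (dyad Φ i) volume y,
    ContinuousLinearMap.integral_apply ((hΦ.dyad i).integrable.comp_sub_left y)]

lemma integral_dirDeriv_eq_zero {G : Type*} [NormedAddCommGroup G] [NormedSpace ℝ G]
    [CompleteSpace G] {Φ : Euc n → G} (hΦ : IsTestFun n Φ) (hj : 1 ≤ j) (J : Fin j → Fin n) :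
    ∫ x, dirDeriv n j J Φ x = 0 :=
  integral_dirDeriv_schwartz hj (hΦ.2.toSchwartzMap hΦ.1) J

/-- For an elliptic operator, the weak derivatives of order `k - j` of a map of locally bounded
`𝒜`-variation decompose at every small scale around almost every point. -/
theorem exists_hasScaleDecomp {A : CoeffOp n k V W} (hA : IsElliptic n k A) (hj : 1 ≤ j)
    (hjk : j ≤ k) (hjn : j ≤ n) {u : Euc n → V} (hu : MemBVAloc n k A u) :
    ∃ v : (Fin (k - j) → Fin n) → Euc n → V, IsWeakDerivFamily n (k - j) u v ∧
      ∀ᵐ x ∂(volume : Measure (Euc n)), ∀ I, HasScaleDecomp n j (v I) x := by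
  obtain ⟨S, K, hS, hK, hS1, hSK⟩ := exists_compact_dyadic_kernel (hj.trans hjk) hA
  obtain ⟨hu, σ, f, hσ, hf, -, hD⟩ := hu
  obtain ⟨v, hv, hvw⟩ := exists_isWeakDerivFamily hS hK hS1 hSK hu hf hD hj (Nat.sub_add_cancel hjk)
  refine ⟨v, hv, ?_⟩
  rw [ae_all_iff]
  intro I
  obtain ⟨w, hw, hvI⟩ := hvw I
  set Ψ := dirDeriv n (k - j) I K with hΨ_def
  have hΨ : IsTestFun n Ψ := hK.dirDeriv I
  set lam := σ + volume with hlam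
  have : IsLocallyFiniteMeasure lam := by
    refine ⟨fun x => ?_⟩
    obtain ⟨s, hs, hs1⟩ := σ.finiteAt_nhds x
    obtain ⟨t, ht, ht1⟩ := (volume : Measure (Euc n)).finiteAt_nhds x
    refine ⟨s ∩ t, inter_mem hs ht, ?_⟩
    rw [hlam, Measure.add_apply]
    exact ENNReal.add_lt_top.2 ⟨(measure_mono Set.inter_subset_left).trans_lt hs1,
      (measure_mono Set.inter_subset_right).trans_lt ht1⟩
  have hvl : volume ≤ lam := Measure.le_add_left le_rfl
  have hσl : σ ≤ lam := Measure.le_add_right le_rfl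
  set p : Euc n → W := fun y => (σ.rnDeriv lam y).toReal • f y with hp_def
  have hp : LocallyIntegrable p lam := locallyIntegrable_rnDeriv_smul hσl hf
  have hkp : ∀ (T : Euc n → W →L[ℝ] V) y, kconv T f σ y = kconv T p lam y := by
    intro T y
    rw [kconv, integral_rnDeriv_smul_of_le hσl]
    simp only [kconv, hp_def, map_smul]
  have hcan : ∀ᵐ x : Euc n, ∀ J : Fin j → Fin n, ∃ l, Tendsto
      (fun N => ∑ i ∈ Finset.range N, kconv (dyad (dirDeriv n j J Ψ) i) p lam x) atTop (𝓝 l) := by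
    rw [ae_all_iff]
    exact fun J => ae_exists_tendsto_vector (hΨ.dirDeriv J) (integral_dirDeriv_eq_zero hΨ hj J) hp
  filter_upwards [ae_exists_tendsto_dyadic_oscillation hvl hp, hcan] with x ⟨c, hc⟩ hcx
  have ht : LocallyIntegrable (fun y => (volume.rnDeriv lam y).toReal • c) lam :=
    locallyIntegrable_rnDeriv_smul hvl (locallyIntegrable_const c)
  set q : Euc n → W := fun y => p y - (volume.rnDeriv lam y).toReal • c with hq_def
  have hq : LocallyIntegrable q lam := hp.sub ht
  have hkq : ∀ {Φ : Euc n → W →L[ℝ] V}, IsTestFun n Φ → ∀ i y,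
      kconv (dyad Φ i) q lam y = kconv (dyad Φ i) p lam y - (∫ z, Φ z) c := by
    intro Φ hΦ i y
    rw [← kconv_density hΦ hvl c i y]
    simp only [kconv, hq_def, map_sub]
    exact integral_sub (integrable_kernel_apply (hΦ.dyad i).continuous (hΦ.dyad i).2 hp y)
      (integrable_kernel_apply (hΦ.dyad i).continuous (hΦ.dyad i).2 ht y)
  have hgeo : HasSum (fun i : ℕ => (((2 : ℝ) ^ i)⁻¹) ^ j • (∫ z, Ψ z) c)
      ((∑' i : ℕ, (((2 : ℝ) ^ i)⁻¹) ^ j) • (∫ z, Ψ z) c) := by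
    refine HasSum.smul_const (Summable.hasSum ?_) _
    have : (fun i : ℕ => (((2 : ℝ) ^ i)⁻¹) ^ j) = fun i => (((2 : ℝ)⁻¹) ^ j) ^ i := by
      funext i
      rw [← inv_pow, ← pow_mul, ← pow_mul, mul_comm]
    rw [this]
    exact summable_geometric_of_lt_one (by positivity)
      (pow_lt_one₀ (by norm_num) (by norm_num) (by omega))
  set c0 := (∑' i : ℕ, (((2 : ℝ) ^ i)⁻¹) ^ j) • (∫ z, Ψ z) c with hc0
  have hdec : HasScaleDecomp n j (fun y => w y - c0) x := by
    refine hasScaleDecomp_of_kernel hΨ hj hjn hq hc (fun J => ?_) ?_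
    · obtain ⟨l, hl⟩ := hcx J
      refine ⟨l, ?_⟩
      simpa only [hkq (hΨ.dirDeriv J), integral_dirDeriv_eq_zero hΨ hj J, zero_apply,
        sub_zero] using hl
    · filter_upwards [hw] with y hy
      simp only [hkq hΨ, smul_sub]
      simp only [hkp] at hy
      exact hy.sub hgeo
  have hfin := hdec.add_smooth (h := fun y => kconv (dirDeriv n (k - j) I S) u volume y + c0)
    ((contDiff_kconv (hS.dirDeriv I) hu).add contDiff_const)
  convert hfin using 2
  rw [hvI]
  abel

end Assembly

section WeakLp

variable {n j : ℕ} {V : Type*}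
  [NormedAddCommGroup V] [InnerProductSpace ℝ V] [FiniteDimensional ℝ V]

lemma smallO_of_dyadic {Q : ℝ → ℝ≥0∞} {a : ℕ} {C : ℝ} (hC : 0 ≤ C)
    (h : ∀ δ > (0 : ℝ), ∀ᶠ I : ℕ in atTop, ∀ r : ℝ, 0 < r → r ≤ (1 / 2) ^ I →
      (1 / 2) ^ I < 2 * r → Q r ≤ ENNReal.ofReal (C * δ * ((1 / 2) ^ I) ^ a)) :
    SmallO Q a := by
  rw [SmallO, ENNReal.tendsto_nhds_zero]
  intro ε hε
  obtain ⟨e, he0, he⟩ : ∃ e : ℝ, 0 < e ∧ ENNReal.ofReal e ≤ ε := by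
    rcases eq_or_ne ε ⊤ with rfl | hε'
    · exact ⟨1, one_pos, le_top⟩
    · exact ⟨ε.toReal, ENNReal.toReal_pos hε.ne' hε', ENNReal.ofReal_toReal_le⟩
  obtain ⟨I0, hI0⟩ := eventually_atTop.1 (h (e / (C * 2 ^ a + 1)) (by positivity))
  filter_upwards [Ioo_mem_nhdsGT (show (0 : ℝ) < (1 / 2) ^ I0 by positivity)] with r ⟨hr0, hr⟩
  obtain ⟨I, hI1, hI2⟩ := exists_nat_pow_near_of_lt_one hr0
    (hr.le.trans (pow_le_one₀ (by norm_num) (by norm_num))) (by norm_num : (0 : ℝ) < 1 / 2)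
    (by norm_num)
  have hII : I0 ≤ I := by
    have := (pow_lt_pow_iff_right_of_lt_one₀ (by norm_num : (0 : ℝ) < 1 / 2) (by norm_num)).1
      (hI1.trans hr)
    omega
  have h2r : (1 / 2 : ℝ) ^ I < 2 * r := by rw [pow_succ] at hI1; linarith
  refine ENNReal.div_le_of_le_mul (le_trans (hI0 I hII r hr0 hI2 h2r) ?_)
  refine le_trans ?_ (mul_le_mul' he le_rfl)
  rw [← ENNReal.ofReal_mul he0.le, Real.rpow_natCast]
  refine ENNReal.ofReal_le_ofReal ?_
  calc C * (e / (C * 2 ^ a + 1)) * ((1 / 2) ^ I) ^ a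
      ≤ C * (e / (C * 2 ^ a + 1)) * (2 * r) ^ a := by gcongr
    _ = e * r ^ a * ((C * 2 ^ a) / (C * 2 ^ a + 1)) := by rw [mul_pow]; ring
    _ ≤ e * r ^ a * 1 := by
        gcongr
        rw [div_le_one (by positivity)]
        linarith
    _ = _ := mul_one _

lemma rpow_le_of_le_pow {m : ℝ≥0∞} {Ω s : ℝ} (hΩ : 1 ≤ Ω) (hs : 0 ≤ s) (hjn : j < n)
    (h : m ≤ ENNReal.ofReal (Ω * s ^ n)) :
    m ^ (1 / ((n : ℝ) / ((n : ℝ) - (j : ℝ)))) ≤ ENNReal.ofReal (Ω * s ^ (n - j)) := by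
  have hn : (0 : ℝ) < n := by exact_mod_cast (by omega : 0 < n)
  have hd : ((n - j : ℕ) : ℝ) = (n : ℝ) - j := by rw [Nat.cast_sub hjn.le]
  have hd0 : (0 : ℝ) < (n : ℝ) - j := sub_pos.2 (by exact_mod_cast hjn)
  rw [one_div_div]
  refine (ENNReal.rpow_le_rpow h (by positivity)).trans ?_
  rw [ENNReal.ofReal_rpow_of_nonneg (by positivity) (by positivity)]
  refine ENNReal.ofReal_le_ofReal ?_
  rw [Real.mul_rpow (by positivity) (by positivity)]
  refine mul_le_mul ?_ (le_of_eq ?_) (by positivity) (by positivity)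
  · refine Real.rpow_le_self_of_one_le hΩ ?_
    rw [div_le_one hn]
    linarith [(Nat.cast_nonneg j : (0 : ℝ) ≤ j)]
  · rw [← Real.rpow_natCast s n, ← Real.rpow_mul hs, mul_div_cancel₀ _ hn.ne', ← hd,
      Real.rpow_natCast]

lemma volume_closedBall_le (x : Euc n) {ρ : ℝ} (hρ : 0 < ρ) : volume (closedBall x ρ) ≤
    ENNReal.ofReal (max 1 (volume (ball (0 : Euc n) 1)).toReal * ρ ^ n) := by
  rw [Measure.addHaar_closedBall volume x hρ.le, finrank_euclideanSpace_fin, mul_comm,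
    ENNReal.ofReal_mul (by positivity)]
  refine mul_le_mul' ?_ le_rfl
  rw [ENNReal.le_ofReal_iff_toReal_le measure_ball_lt_top.ne (by positivity)]
  exact le_max_right _ _

theorem HasScaleDecomp.memTWeakLp {f : Euc n → V} {x : Euc n} (hjn : j < n)
    (hf : HasScaleDecomp n j f x) : MemTWeakLp n j ((n : ℝ) / ((n : ℝ) - (j : ℝ))) f x := by
  obtain ⟨P, hP, hd⟩ := hf
  refine ⟨P, hP, ?_⟩
  have hn : (0 : ℝ) < n := by exact_mod_cast (by omega : 0 < n)
  have hd0 : (0 : ℝ) < (n : ℝ) - j := sub_pos.2 (by exact_mod_cast hjn)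
  have hexp : (j : ℝ) + n / ((n : ℝ) / ((n : ℝ) - (j : ℝ))) = n := by
    field_simp
    ring
  rw [hexp]
  set Ω := max 1 (volume (ball (0 : Euc n) 1)).toReal with hΩ
  have hΩ1 : 1 ≤ Ω := le_max_left _ _
  refine smallO_of_dyadic (C := 4 * 2 ^ (n - j) * Ω) (by positivity) fun δ hδ => ?_
  filter_upwards [hd δ hδ] with I ⟨G, L, H, hG, _, hN⟩ r hr0 hrI hIr
  set ρ : ℝ := (1 / 2) ^ I with hρ
  have hρ0 : 0 < ρ := by positivity
  refine iSup₂_le fun τ hτ => ?_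
  have hsub : (volume.restrict (ball x r)) {y | τ < ‖f y - P y‖} ≤
      volume {y | y ∈ closedBall x ρ ∧ τ < ‖f y - P y‖} := by
    refine (Measure.le_iff'.1 (Measure.restrict_mono_set volume
      (ball_subset_closedBall.trans (closedBall_subset_closedBall hrI))) _).trans ?_
    rw [Measure.restrict_apply' measurableSet_closedBall]
    exact measure_mono fun y hy => ⟨hy.2, hy.1⟩
  have key : ∀ s : ℝ, 0 ≤ s → τ * s ^ (n - j) ≤ 4 * 2 ^ (n - j) * δ * ρ ^ n →
      volume {y | y ∈ closedBall x ρ ∧ τ < ‖f y - P y‖} ≤ ENNReal.ofReal (Ω * s ^ n) →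
      ENNReal.ofReal τ * (volume.restrict (ball x r)) {y | τ < ‖f y - P y‖} ^
        (1 / ((n : ℝ) / ((n : ℝ) - (j : ℝ)))) ≤
      ENNReal.ofReal (4 * 2 ^ (n - j) * Ω * δ * ρ ^ n) := by
    intro s hs hτs hm
    refine (mul_le_mul' le_rfl (rpow_le_of_le_pow hΩ1 hs hjn (hsub.trans hm))).trans ?_
    rw [← ENNReal.ofReal_mul hτ.le]
    refine ENNReal.ofReal_le_ofReal ?_
    calc τ * (Ω * s ^ (n - j)) = Ω * (τ * s ^ (n - j)) := by ring
      _ ≤ Ω * (4 * 2 ^ (n - j) * δ * ρ ^ n) := by gcongr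
      _ = _ := by ring
  have hsplit : ρ ^ n = ρ ^ j * ρ ^ (n - j) := by rw [← pow_add, Nat.add_sub_cancel' hjn.le]
  rcases le_or_gt τ (4 * δ * ρ ^ j) with hτ1 | hτ1
  · refine key ρ hρ0.le ?_ ((measure_mono fun y hy => hy.1).trans (volume_closedBall_le x hρ0))
    have h1 : (1 : ℝ) ≤ 2 ^ (n - j) := one_le_pow₀ (by norm_num)
    calc τ * ρ ^ (n - j) ≤ 1 * (4 * δ * ρ ^ j) * ρ ^ (n - j) := by rw [one_mul]; gcongr
      _ ≤ 2 ^ (n - j) * (4 * δ * ρ ^ j) * ρ ^ (n - j) := by gcongr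
      _ = _ := by rw [hsplit]; ring
  · have hρd : (1 / ρ) ^ (n - j) < τ / (4 * δ * ρ ^ n) := by
      rw [lt_div_iff₀ (by positivity), hsplit]
      calc (1 / ρ) ^ (n - j) * (4 * δ * (ρ ^ j * ρ ^ (n - j)))
          = 4 * δ * ρ ^ j * (1 / ρ * ρ) ^ (n - j) := by rw [mul_pow]; ring
        _ = 4 * δ * ρ ^ j := by rw [one_div_mul_cancel hρ0.ne', one_pow, mul_one]
        _ < τ := hτ1
    have hρinv : 1 / ρ = 2 ^ I := by rw [hρ, one_div_pow, one_div_one_div]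
    rw [hρinv, ← pow_mul, mul_comm, pow_mul] at hρd
    have h2d : (1 : ℝ) < 2 ^ (n - j) := one_lt_pow₀ (by norm_num) (by omega)
    obtain ⟨N, hN1, hN2⟩ := exists_nat_pow_near
      ((one_le_pow₀ h2d.le).trans hρd.le : (1 : ℝ) ≤ τ / (4 * δ * ρ ^ n)) h2d
    have hIN : I ≤ N := by
      have := (pow_lt_pow_iff_right₀ h2d).1 (hρd.trans hN2)
      omega
    obtain ⟨e1, e2, -, e4⟩ := hN N hIN
    rw [le_div_iff₀ (by positivity)] at hN1
    rw [div_lt_iff₀ (by positivity)] at hN2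
    have hswap : ((2 : ℝ) ^ (n - j)) ^ N = (2 ^ N) ^ (n - j) := by
      rw [← pow_mul, ← pow_mul, mul_comm]
    have hhalf : ((1 / 2 : ℝ) ^ N) ^ (n - j) * (2 ^ N) ^ (n - j) = 1 := by
      rw [← mul_pow, ← mul_pow]; norm_num
    refine key ((1 / 2) ^ N) (by positivity) ?_ ?_
    · calc τ * ((1 / 2) ^ N) ^ (n - j)
          ≤ (2 ^ (n - j)) ^ (N + 1) * (4 * δ * ρ ^ n) * ((1 / 2) ^ N) ^ (n - j) := by gcongr
        _ = 4 * 2 ^ (n - j) * δ * ρ ^ n * (((1 / 2 : ℝ) ^ N) ^ (n - j) * (2 ^ N) ^ (n - j)) := by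
          rw [pow_succ, hswap]; ring
        _ = _ := by rw [hhalf, mul_one]
        _ ≤ _ := le_rfl
    · refine (measure_mono fun y hy => ?_).trans ((e4 (τ / 2) (half_pos hτ)).trans
        (ENNReal.ofReal_le_ofReal ?_))
      · refine ⟨hy.1, ?_⟩
        have h1 := hG y hy.1
        have h2 := e2 hjn y hy.1
        have h3 := hy.2
        rw [e1 y] at h3
        have h4 := (norm_add_le (G y + L N y) (H N y)).trans
          (add_le_add_left (norm_add_le (G y) (L N y)) _)
        rw [hswap] at hN1
        nlinarith
      · rw [div_le_iff₀ (by positivity)]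
        have hsN : ((1 / 2 : ℝ) ^ N) ^ n = ((1 / 2 : ℝ) ^ N) ^ j * ((1 / 2 : ℝ) ^ N) ^ (n - j) := by
          rw [← pow_add, Nat.add_sub_cancel' hjn.le]
        have h5 : δ * ρ ^ n ≤ ((1 / 2 : ℝ) ^ N) ^ (n - j) * (τ / 4) := by
          calc δ * ρ ^ n = ((1 / 2 : ℝ) ^ N) ^ (n - j) *
                (((2 : ℝ) ^ N) ^ (n - j) * (4 * δ * ρ ^ n) / 4) := by
                linear_combination (-(δ * ρ ^ n)) * hhalf
            _ ≤ _ := by rw [← hswap]; gcongr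
        calc δ * ρ ^ n * ((1 / 2) ^ N) ^ j
            ≤ ((1 / 2 : ℝ) ^ N) ^ (n - j) * (τ / 4) * ((1 / 2) ^ N) ^ j := by gcongr
          _ = 1 * ((1 / 2 : ℝ) ^ N) ^ n * (τ / 4) := by rw [hsN]; ring
          _ ≤ Ω * ((1 / 2 : ℝ) ^ N) ^ n * (τ / 2) := by gcongr; norm_num

end WeakLp

section WeakLinfty

variable {n j : ℕ} {V : Type*}
  [NormedAddCommGroup V] [InnerProductSpace ℝ V] [FiniteDimensional ℝ V]
  {α F : Type*} [MeasurableSpace α] [NormedAddCommGroup F] {μ : Measure α} {f : α → F}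

lemma rearr_anti {s t : ℝ} (h : s ≤ t) : rearr μ f t ≤ rearr μ f s :=
  sInf_le_sInf fun _ hl => hl.trans (ENNReal.ofReal_le_ofReal h)

lemma add_one_sq_le_four_mul_two_pow (m : ℕ) : ((m : ℝ) + 1) ^ 2 ≤ 4 * 2 ^ m := by
  have h : ∀ m : ℕ, (m + 4) ^ 2 ≤ 4 * 2 ^ (m + 3) := by
    intro m
    induction m with
    | zero => norm_num
    | succ m ih =>
      rw [show m + 1 + 3 = (m + 3) + 1 by ring, pow_succ 2]
      generalize 2 ^ (m + 3) = a at *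
      have := sq_nonneg m
      linarith [add_sq m 4, add_sq (m + 1) 4, add_sq m 1]
  rcases lt_or_ge m 3 with hm | hm
  · interval_cases m <;> norm_num
  · obtain ⟨m, rfl⟩ := Nat.exists_eq_add_of_le' hm
    have := h m
    push_cast
    rw [show (m : ℝ) + 3 + 1 = m + 4 by ring]
    exact_mod_cast this

lemma rearr_half_pow_le {t : ℝ} {K : ℝ≥0∞}
    (h : ∀ s, 0 < s → s ≤ t → rearr μ f (s / 2) ≤ rearr μ f s + K) (ht : 0 < t) (m : ℕ) :
    rearr μ f (t / 2 ^ m) ≤ rearr μ f t + m * K := by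
  induction m with
  | zero => simp
  | succ m ih =>
    have h1 := h (t / 2 ^ m) (by positivity) (div_le_self ht.le (one_le_pow₀ (by norm_num)))
    rw [pow_succ, ← div_div, Nat.cast_add_one, add_mul, one_mul, ← add_assoc]
    exact h1.trans (by gcongr)

/-- If halving the argument increases the decreasing rearrangement by at most `K`, then its
running average exceeds it by at most `4 K`. -/
lemma rearrStar2_le_of_half_le {t : ℝ} {K : ℝ≥0∞}
    (h : ∀ s, 0 < s → s ≤ t → rearr μ f (s / 2) ≤ rearr μ f s + K) (ht : 0 < t) :
    rearrStar2 μ f t ≤ rearr μ f t + 4 * K := by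
  have hpt : ∀ s ∈ Set.Ioc 0 t,
      rearr μ f s ≤ rearr μ f t +
        ENNReal.ofReal (2 * t ^ (1 / 2 : ℝ) * s ^ (-(1 / 2) : ℝ)) * K := by
    rintro s ⟨hs0, hst⟩
    obtain ⟨m, hm1, hm2⟩ := exists_nat_pow_near_of_lt_one (div_pos hs0 ht)
      ((div_le_one ht).2 hst) (by norm_num : (0 : ℝ) < 1 / 2) (by norm_num)
    rw [lt_div_iff₀ ht] at hm1
    rw [div_le_iff₀ ht] at hm2
    have h1 : rearr μ f s ≤ rearr μ f (t / 2 ^ (m + 1)) := by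
      refine rearr_anti (le_of_eq_of_le ?_ hm1.le)
      rw [one_div_pow]; ring
    refine (h1.trans (rearr_half_pow_le h ht _)).trans ?_
    gcongr
    rw [← ENNReal.ofReal_natCast]
    refine ENNReal.ofReal_le_ofReal ?_
    rw [Real.rpow_neg hs0.le, mul_assoc, ← div_eq_mul_inv, ← Real.div_rpow ht.le hs0.le,
      ← Real.sqrt_eq_rpow]
    have h4 : (2 : ℝ) ^ m ≤ t / s := by
      rw [le_div_iff₀ hs0]
      calc (2 : ℝ) ^ m * s ≤ 2 ^ m * ((1 / 2) ^ m * t) := by gcongr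
        _ = t := by rw [← mul_assoc, ← mul_pow]; norm_num
    have h5 : Real.sqrt (t / s) ^ 2 = t / s := Real.sq_sqrt (by positivity)
    have h6 := add_one_sq_le_four_mul_two_pow m
    refine (sq_le_sq₀ (by positivity) (by positivity)).1 ?_
    push_cast
    rw [mul_pow, h5]
    linarith
  have hInt : ∫⁻ s in Set.Ioc 0 t, ENNReal.ofReal (2 * t ^ (1 / 2 : ℝ) * s ^ (-(1 / 2) : ℝ)) =
      ENNReal.ofReal (4 * t) := by
    have hi : IntervalIntegrable (fun s : ℝ => 2 * t ^ (1 / 2 : ℝ) * s ^ (-(1 / 2) : ℝ))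
        volume 0 t := (intervalIntegral.intervalIntegrable_rpow' (by norm_num)).const_mul _
    rw [← ofReal_integral_eq_lintegral_ofReal
      ((intervalIntegrable_iff_integrableOn_Ioc_of_le ht.le).1 hi),
      ← intervalIntegral.integral_of_le ht.le,
      intervalIntegral.integral_const_mul, integral_rpow (by norm_num)]
    · congr 1
      rw [show (-(1 / 2) + 1 : ℝ) = 1 / 2 by norm_num, Real.zero_rpow (by norm_num), sub_zero,
        show 2 * t ^ (1 / 2 : ℝ) * (t ^ (1 / 2 : ℝ) / (1 / 2)) =
          4 * (t ^ (1 / 2 : ℝ) * t ^ (1 / 2 : ℝ))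
        by ring, ← Real.rpow_add ht]
      norm_num
    · filter_upwards [ae_restrict_mem measurableSet_Ioc] with s hs
      have := hs.1
      positivity
  have h0 : ENNReal.ofReal t ≠ 0 := (ENNReal.ofReal_pos.2 ht).ne'
  calc rearrStar2 μ f t ≤ (ENNReal.ofReal t)⁻¹ * ∫⁻ s in Set.Ioc 0 t, (rearr μ f t +
        ENNReal.ofReal (2 * t ^ (1 / 2 : ℝ) * s ^ (-(1 / 2) : ℝ)) * K) :=
        mul_le_mul' le_rfl (setLIntegral_mono' measurableSet_Ioc hpt)
    _ = (ENNReal.ofReal t)⁻¹ * (ENNReal.ofReal t * (rearr μ f t + 4 * K)) := by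
        congr 1
        rw [lintegral_add_left measurable_const, lintegral_mul_const _ (by fun_prop), hInt,
          setLIntegral_const, Real.volume_Ioc, sub_zero, ENNReal.ofReal_mul (by norm_num), mul_add]
        congr 1
        · ring
        · norm_num
          ring
    _ = _ := by rw [← mul_assoc, ENNReal.inv_mul_cancel h0 ENNReal.ofReal_ne_top, one_mul]

lemma rearr_le_rearr_add {s s' : ℝ} {K : ℝ≥0∞}
    (h : ∀ l : ℝ≥0∞, l ≠ ⊤ → μ {y | l < (‖f y‖₊ : ℝ≥0∞)} ≤ ENNReal.ofReal s →
      μ {y | l + K < (‖f y‖₊ : ℝ≥0∞)} ≤ ENNReal.ofReal s') :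
    rearr μ f s' ≤ rearr μ f s + K := by
  rw [rearr, rearr, ENNReal.sInf_add]
  refine le_iInf₂ fun l hl => sInf_le ?_
  rcases eq_or_ne l ⊤ with rfl | hl'
  · simp
  · exact h l hl' hl

/-- The rearrangement estimate on a ball, from a decomposition of `g` at all dyadic scales. -/
lemma rearr_half_le_of_decomp (hn : 1 ≤ n) {g : Euc n → V} {x : Euc n} {δ r : ℝ} {I : ℕ}
    (hδ : 0 < δ) (hr0 : 0 < r) (hrI : r ≤ (1 / 2) ^ I) (hIr : (1 / 2) ^ I < 2 * r)
    {G : Euc n → V} {L H : ℕ → Euc n → V}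
    (hG : ∀ y ∈ closedBall x ((1 / 2) ^ I), ‖G y‖ ≤ δ * ((1 / 2) ^ I) ^ n)
    (hL0 : ∀ y, L I y = 0) (hg : ∀ N ≥ I, ∀ y, g y = G y + L N y + H N y)
    (hL : ∀ N ≥ I, ∀ y ∈ closedBall x ((1 / 2) ^ I), ∀ z ∈ closedBall x ((1 / 2) ^ I),
      ‖L N y - L N z‖ ≤ δ * ((1 / 2) ^ I) ^ n * (2 ^ N * ‖y - z‖))
    (hH : ∀ N ≥ I, ∀ a > (0 : ℝ), volume {y | y ∈ closedBall x ((1 / 2) ^ I) ∧ a < ‖H N y‖} ≤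
      ENNReal.ofReal (δ * ((1 / 2) ^ I) ^ n * ((1 / 2) ^ N) ^ n / a))
    {ϖ M : ℝ} (hϖ0 : 0 < ϖ) (hϖ : volume (ball (0 : Euc n) 1) = ENNReal.ofReal ϖ)
    (hM : M = 6 + 32 * 4 ^ n / ϖ) {s : ℝ} (hs0 : 0 < s) :
    rearr (volume.restrict (ball x r)) g (s / 2) ≤
      rearr (volume.restrict (ball x r)) g s + ENNReal.ofReal (M * δ * ((1 / 2) ^ I) ^ n) := by
  set ρ : ℝ := (1 / 2) ^ I with hρ
  have hρ0 : 0 < ρ := by positivity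
  set K : ℝ := M * δ * ρ ^ n with hK
  have hM6 : 6 ≤ M := by rw [hM]; linarith [(by positivity : 0 ≤ 32 * 4 ^ n / ϖ)]
  have hMϖ : 32 * 4 ^ n ≤ M * ϖ := by
    rw [hM, add_mul, div_mul_cancel₀ _ hϖ0.ne']; linarith
  have hM0 : 0 < M := by linarith
  have hδρ : 0 < δ * ρ ^ n := by positivity
  have hK6 : 6 * (δ * ρ ^ n) ≤ K := by rw [hK, mul_assoc]; gcongr
  have hK0 : 0 < K := by linarith
  have hsubρ : ∀ y ∈ ball x r, y ∈ closedBall x ρ := fun y hy =>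
    ball_subset_closedBall (ball_subset_ball hrI hy)
  have hXv : ∀ N ≥ I, volume {y | y ∈ closedBall x ρ ∧ K / 4 < ‖H N y‖} ≤
      ENNReal.ofReal (4 / M * ((1 / 2) ^ N) ^ n) := by
    intro N hN
    refine (hH N hN (K / 4) (by positivity)).trans (ENNReal.ofReal_le_ofReal (le_of_eq ?_))
    rw [hK]
    field_simp
  refine rearr_le_rearr_add fun l hl hF => ?_
  rw [Measure.restrict_apply' measurableSet_ball] at hF ⊢
  have hlr : ∀ y, l + ENNReal.ofReal K < (‖g y‖₊ : ℝ≥0∞) ↔ l.toReal + K < ‖g y‖ := by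
    intro y
    rw [← ENNReal.toReal_lt_toReal (ENNReal.add_ne_top.2 ⟨hl, ENNReal.ofReal_ne_top⟩)
      ENNReal.coe_ne_top, ENNReal.toReal_add hl ENNReal.ofReal_ne_top, ENNReal.toReal_ofReal hK0.le]
    simp
  have hlr' : ∀ y, l < (‖g y‖₊ : ℝ≥0∞) ↔ l.toReal < ‖g y‖ := by
    intro y
    rw [← ENNReal.toReal_lt_toReal hl ENNReal.coe_ne_top]
    simp
  simp only [hlr]
  simp only [hlr'] at hF
  have hl0 : 0 ≤ l.toReal := ENNReal.toReal_nonneg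
  rcases le_or_gt (ϖ * r ^ n) (s * 2 ^ (n + 1)) with hs | hs
  · have h1 : {y | l.toReal + K < ‖g y‖} ∩ ball x r ⊆
        {y | y ∈ closedBall x ρ ∧ K / 4 < ‖H I y‖} := by
      rintro y ⟨hy, hyr⟩
      refine ⟨hsubρ y hyr, ?_⟩
      have h2 := hG y (hsubρ y hyr)
      have h3 : ‖g y‖ ≤ ‖G y‖ + ‖H I y‖ := by
        rw [hg I le_rfl y, hL0, add_zero]; exact norm_add_le _ _
      have hy' : l.toReal + K < ‖g y‖ := hy
      linarith
    refine (measure_mono h1).trans ((hXv I le_rfl).trans (ENNReal.ofReal_le_ofReal ?_))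
    have h4 : ρ ^ n ≤ 2 ^ n * r ^ n := by rw [← mul_pow]; gcongr
    rw [div_mul_eq_mul_div, div_le_iff₀ hM0]
    have h5 : ϖ * (4 * ρ ^ n) ≤ ϖ * (s / 2 * M) := by
      calc ϖ * (4 * ρ ^ n) ≤ ϖ * (4 * (2 ^ n * r ^ n)) := by gcongr
        _ = 4 * 2 ^ n * (ϖ * r ^ n) := by ring
        _ ≤ 4 * 2 ^ n * (s * 2 ^ (n + 1)) := by gcongr
        _ = s * (8 * 4 ^ n) := by
          rw [show (4 : ℝ) = 2 * 2 by norm_num, mul_pow]; ring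
        _ ≤ s * (M * ϖ / 2) := by
          gcongr
          linarith [(by positivity : (0 : ℝ) ≤ 4 ^ n)]
        _ = _ := by ring
    exact le_of_mul_le_mul_left h5 hϖ0
  · by_contra hcon
    push Not at hcon
    have hn0 : (n : ℝ) ≠ 0 := by exact_mod_cast (by omega : n ≠ 0)
    obtain ⟨e, he0, he⟩ : ∃ e : ℝ, 0 < e ∧ ϖ * e ^ n = 2 * s := by
      refine ⟨(2 * s / ϖ) ^ (1 / (n : ℝ)), by positivity, ?_⟩
      rw [← Real.rpow_natCast, ← Real.rpow_mul (by positivity), one_div_mul_cancel hn0,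
        Real.rpow_one, mul_div_cancel₀ _ hϖ0.ne']
    have her : 2 * e < r := by
      refine lt_of_pow_lt_pow_left₀ n hr0.le ?_
      refine lt_of_mul_lt_mul_left ?_ hϖ0.le
      calc ϖ * (2 * e) ^ n = 2 ^ n * (ϖ * e ^ n) := by rw [mul_pow]; ring
        _ = s * 2 ^ (n + 1) := by rw [he]; ring
        _ < _ := hs
    have h1e : 1 ≤ 1 / (2 * e) := by
      rw [le_div_iff₀ (by positivity), one_mul]
      exact her.le.trans (hrI.trans (pow_le_one₀ (by norm_num) (by norm_num)))
    obtain ⟨N, hN1, hN2⟩ := exists_nat_pow_near h1e (by norm_num : (1 : ℝ) < 2)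
    rw [le_div_iff₀ (by positivity)] at hN1
    rw [div_lt_iff₀ (by positivity)] at hN2
    have hIN : I ≤ N := by
      by_contra hlt
      push Not at hlt
      have h2 : (2 : ℝ) ^ (N + 1) ≤ 2 ^ I := pow_le_pow_right₀ (by norm_num) hlt
      have h3 : (2 : ℝ) ^ I * ρ = 1 := by rw [hρ, ← mul_pow]; norm_num
      have h4 : (2 : ℝ) ^ (N + 1) * (2 * e) ≤ 2 ^ I * ρ := by
        have : 2 * e ≤ ρ := by linarith
        gcongr
      linarith
    set X := {y | y ∈ closedBall x ρ ∧ K / 4 < ‖H N y‖} with hX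
    have hXs : volume X ≤ ENNReal.ofReal (s / 4) := by
      refine (hXv N hIN).trans (ENNReal.ofReal_le_ofReal ?_)
      have h2 : (1 / 2 : ℝ) ^ N ≤ 4 * e := by
        rw [one_div_pow, div_le_iff₀ (by positivity)]
        rw [pow_succ] at hN2
        linarith
      rw [div_mul_eq_mul_div, div_le_iff₀ hM0]
      refine le_of_mul_le_mul_left ?_ hϖ0
      calc ϖ * (4 * ((1 / 2) ^ N) ^ n) ≤ ϖ * (4 * (4 * e) ^ n) := by gcongr
        _ = 4 * 4 ^ n * (ϖ * e ^ n) := by rw [mul_pow]; ring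
        _ = s / 4 * (32 * 4 ^ n) := by rw [he]; ring
        _ ≤ s / 4 * (M * ϖ) := by gcongr
        _ = _ := by ring
    obtain ⟨y, ⟨hyg, hyr⟩, hyX⟩ : ∃ y ∈ {y | l.toReal + K < ‖g y‖} ∩ ball x r, y ∉ X := by
      by_contra hno
      push Not at hno
      have := hcon.trans_le ((measure_mono hno).trans hXs)
      rw [ENNReal.ofReal_lt_ofReal_iff (by positivity)] at this
      linarith
    set y' := y + (e / r) • (x - y) with hy'
    have hball : ∀ z ∈ ball y' e, z ∈ ball x r ∧ ‖y - z‖ ≤ 2 * e := by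
      intro z hz
      rw [mem_ball_iff_norm] at hz hyr
      have hyx : ‖x - y‖ < r := by rwa [norm_sub_rev]
      constructor
      · rw [mem_ball_iff_norm]
        have h2 : z - x = (z - y') + (1 - e / r) • (y - x) := by
          rw [hy']; module
        have h3 : 0 < 1 - e / r := by
          rw [sub_pos, div_lt_one hr0]; linarith
        have h4 : ‖(1 - e / r) • (y - x)‖ ≤ r - e := by
          rw [norm_smul, Real.norm_of_nonneg h3.le]
          calc (1 - e / r) * ‖y - x‖ ≤ (1 - e / r) * r := by gcongr
            _ = r - e := by field_simp
        rw [h2]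
        linarith [norm_add_le (z - y') ((1 - e / r) • (y - x))]
      · have h2 : y - z = -(z - y') - (e / r) • (x - y) := by
          rw [hy']; module
        have h4 : ‖(e / r) • (x - y)‖ ≤ e := by
          rw [norm_smul, Real.norm_of_nonneg (by positivity)]
          calc e / r * ‖x - y‖ ≤ e / r * r := by gcongr
            _ = e := by field_simp
        rw [h2]
        have h5 := norm_sub_le (-(z - y')) ((e / r) • (x - y))
        rw [norm_neg] at h5
        linarith
    obtain ⟨z, hz, hzF⟩ : ∃ z ∈ ball y' e, z ∉ ({y | l.toReal < ‖g y‖} ∩ ball x r) ∪ X := by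
      by_contra hno
      push Not at hno
      have h2 := (measure_mono (μ := volume) hno).trans ((measure_union_le _ _).trans
        (add_le_add hF hXs))
      rw [Measure.addHaar_ball_of_pos volume y' he0, finrank_euclideanSpace_fin, hϖ,
        ← ENNReal.ofReal_mul (by positivity), ← ENNReal.ofReal_add hs0.le (by positivity),
        ENNReal.ofReal_le_ofReal_iff (by positivity), mul_comm, he] at h2
      linarith
    obtain ⟨hzr, hyz⟩ := hball z hz
    rw [Set.mem_union, not_or] at hzF
    have hgz : ‖g z‖ ≤ l.toReal := not_lt.1 fun h => hzF.1 ⟨h, hzr⟩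
    have hHz : ‖H N z‖ ≤ K / 4 := not_lt.1 fun h => hzF.2 ⟨hsubρ z hzr, h⟩
    have hHy : ‖H N y‖ ≤ K / 4 := not_lt.1 fun h => hyX ⟨hsubρ y hyr, h⟩
    have hGy := hG y (hsubρ y hyr)
    have hGz := hG z (hsubρ z hzr)
    have hLyz : ‖L N y - L N z‖ ≤ δ * ρ ^ n := by
      refine (hL N hIN y (hsubρ y hyr) z (hsubρ z hzr)).trans ?_
      calc δ * ρ ^ n * (2 ^ N * ‖y - z‖) ≤ δ * ρ ^ n * (2 ^ N * (2 * e)) := by gcongr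
        _ ≤ δ * ρ ^ n * 1 := by gcongr
        _ = _ := mul_one _
    have hdiff : g y = g z + (G y - G z) + (L N y - L N z) + (H N y - H N z) := by
      rw [hg N hIN y, hg N hIN z]; abel
    have h6 : ‖g y‖ ≤ ‖g z‖ + (‖G y‖ + ‖G z‖) + ‖L N y - L N z‖ + (‖H N y‖ + ‖H N z‖) := by
      rw [hdiff]
      refine (norm_add_le _ _).trans (add_le_add ?_ (norm_sub_le _ _))
      refine (norm_add_le _ _).trans (add_le_add ?_ le_rfl)
      exact (norm_add_le _ _).trans (add_le_add le_rfl (norm_sub_le _ _))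
    have hyg' : l.toReal + K < ‖g y‖ := hyg
    linarith

theorem HasScaleDecomp.memTWeakLinfty {f : Euc n → V} {x : Euc n} (hn : 1 ≤ n)
    (hf : HasScaleDecomp n n f x) : MemTWeakLinfty n n f x := by
  obtain ⟨P, hP, hd⟩ := hf
  refine ⟨P, hP, ?_⟩
  set ϖ := (volume (ball (0 : Euc n) 1)).toReal with hϖ_def
  have hϖ : volume (ball (0 : Euc n) 1) = ENNReal.ofReal ϖ :=
    (ENNReal.ofReal_toReal measure_ball_lt_top.ne).symm
  have hϖ0 : 0 < ϖ :=
    ENNReal.toReal_pos (measure_ball_pos volume _ one_pos).ne' measure_ball_lt_top.ne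
  refine smallO_of_dyadic (C := 4 * (6 + 32 * 4 ^ n / ϖ)) (by positivity) fun δ hδ => ?_
  filter_upwards [hd δ hδ] with I ⟨G, L, H, hG, hL0, hN⟩ r hr0 hrI hIr
  refine iSup_le fun t => iSup₂_le fun ht _ => ?_
  rw [tsub_le_iff_left]
  refine (rearrStar2_le_of_half_le (fun s hs _ => rearr_half_le_of_decomp hn hδ hr0 hrI hIr hG hL0
    (fun N h => (hN N h).1) (fun N h => (hN N h).2.2.1 rfl) (fun N h => (hN N h).2.2.2)
    hϖ0 hϖ rfl hs) ht).trans_eq ?_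
  rw [mul_assoc 4, mul_assoc 4, ENNReal.ofReal_mul (by norm_num : (0 : ℝ) ≤ 4)]
  norm_num

end WeakLinfty

section PlaneWave

variable {n m k : ℕ} {V W : Type*}
  [NormedAddCommGroup V] [InnerProductSpace ℝ V] [FiniteDimensional ℝ V]
  [NormedAddCommGroup W] [InnerProductSpace ℝ W] [FiniteDimensional ℝ W]

lemma symbolMap_smul (A : CoeffOp n k V W) (c : ℝ) (ξ : Euc n) :
    symbolMap n k A (c • ξ) = c ^ k • symbolMap n k A ξ := by
  simp only [symbolMap, Finset.smul_sum, smul_smul]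
  refine Finset.sum_congr rfl fun I _ => ?_
  simp [Finset.prod_mul_distrib]

/-- A non-elliptic symbol has a kernel vector at some unit frequency. -/
lemma exists_symbolMap_eq_zero {A : CoeffOp n k V W} (hA : ¬ IsElliptic n k A) :
    ∃ (ξ : Euc n) (v : V), ‖ξ‖ = 1 ∧ v ≠ 0 ∧ symbolMap n k A ξ v = 0 := by
  unfold IsElliptic at hA
  push Not at hA
  obtain ⟨ξ, hξ, hinj⟩ := hA
  rw [← LinearMap.ker_eq_bot, Submodule.eq_bot_iff] at hinj
  push Not at hinj
  obtain ⟨v, hv, hv0⟩ := hinj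
  refine ⟨‖ξ‖⁻¹ • ξ, v, ?_, hv0, ?_⟩
  · rw [norm_smul, norm_inv, norm_norm, inv_mul_cancel₀ (norm_ne_zero_iff.2 hξ)]
  · rw [symbolMap_smul, LinearMap.smul_apply, LinearMap.mem_ker.1 hv, smul_zero]

lemma inner_stdVec (ξ : Euc n) (i : Fin n) : ⟪stdVec n i, ξ⟫ = ξ i := by
  simp [stdVec, EuclideanSpace.inner_single_left]

lemma contDiff_inner_left (ξ : Euc n) : ContDiff ℝ ∞ fun x : Euc n => ⟪x, ξ⟫ :=
  contDiff_id.inner ℝ contDiff_const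

lemma dirDeriv_planeWave {h : ℝ → ℝ} (hh : ContDiff ℝ ∞ h) (ξ : Euc n) (I : Fin m → Fin n)
    (x : Euc n) :
    dirDeriv n m I (fun x => h ⟪x, ξ⟫) x = iteratedDeriv m h ⟪x, ξ⟫ * ∏ i, ξ (I i) := by
  have hg : ContDiff ℝ ∞ fun x : Euc n => h ⟪x, ξ⟫ := hh.comp (contDiff_inner_left ξ)
  induction m generalizing x with
  | zero => simp [dirDeriv_fin_zero]
  | succ m ih =>
    rw [dirDeriv_succ hg, show dirDeriv n m (Fin.tail I) (fun x => h ⟪x, ξ⟫) = _ from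
      funext (ih (Fin.tail I))]
    have h1 : HasDerivAt (iteratedDeriv m h) (iteratedDeriv (m + 1) h ⟪x, ξ⟫) ⟪x, ξ⟫ := by
      rw [iteratedDeriv_succ]
      exact (hh.differentiable_iteratedDeriv m
        (by exact_mod_cast ENat.natCast_lt_top m) _).hasDerivAt
    have h2 : HasFDerivAt (fun y : Euc n => ⟪y, ξ⟫) ((innerSL ℝ) ξ) x := by
      have := ((innerSL ℝ) ξ).hasFDerivAt (x := x)
      refine this.congr_of_eventuallyEq (Eventually.of_forall fun y => ?_)
      simp [real_inner_comm]
    have h3 := (h1.comp_hasFDerivAt x h2).mul_const (∏ i, ξ (Fin.tail I i))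
    have h4 := h3.fderiv
    simp only [Function.comp_def] at h4
    rw [h4, Fin.prod_univ_succ]
    simp only [_root_.smul_apply, innerSL_apply_apply, smul_eq_mul]
    rw [real_inner_comm (stdVec n (I 0)) ξ, inner_stdVec]
    simp only [Fin.tail]
    ring

/-- Distributional limits of plane waves in the kernel of the symbol are annihilated by the
operator. -/
theorem memBVAloc_of_tendsto_planeWave {A : CoeffOp n k V W} {ξ : Euc n} {v : V}
    (hv : symbolMap n k A ξ v = 0) {h : ℕ → ℝ → ℝ} (hh : ∀ N, ContDiff ℝ ∞ (h N))
    {s : Euc n → ℝ} (hs : LocallyIntegrable s volume)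
    (hlim : ∀ φ : Euc n → ℝ, Continuous φ → HasCompactSupport φ →
      Tendsto (fun N => ∫ x, φ x • h N ⟪x, ξ⟫) atTop (𝓝 (∫ x, φ x • s x))) :
    MemBVAloc n k A (fun x => s x • v) := by
  refine ⟨fun x => ?_, 0, fun _ => 0, inferInstance,
    fun x => ⟨Set.univ, univ_mem, integrableOn_zero⟩, by simp, ?_⟩
  · obtain ⟨t, ht, hi⟩ := hs x
    exact ⟨t, ht, Integrable.smul_const hi v⟩
  intro φ hφ
  have hψ : ∀ I, IsTestFun n (fun x => ⟪A I v, φ x⟫) := fun I =>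
    ⟨contDiff_const.inner ℝ hφ.1, hφ.2.comp_left (g := fun w => ⟪A I v, w⟫) (inner_zero_right _)⟩
  have hD : ∀ (I : Fin k → Fin n) (x : Euc n), ⟪A I v, dirDeriv n k I φ x⟫ =
      dirDeriv n k I (fun x => ⟪A I v, φ x⟫) x := fun I x => by
    have := dirDeriv_clm_comp I ((innerSL ℝ) (A I v)) (x := x)
      (hφ.1.contDiffAt.of_le (by exact_mod_cast le_top) : ContDiffAt ℝ k φ x)
    simpa using this.symm
  have h1 : ∀ I : Fin k → Fin n,
      ∫ x, ⟪s x • v, LinearMap.adjoint (A I) (dirDeriv n k I φ x)⟫ =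
      ∫ x, dirDeriv n k I (fun x => ⟪A I v, φ x⟫) x • s x := fun I => by
    refine integral_congr_ae (Eventually.of_forall fun x => ?_)
    simp only [LinearMap.adjoint_inner_right, map_smul, real_inner_smul_left, hD, smul_eq_mul]
    ring
  have h2 : Tendsto (fun N => ∑ I : Fin k → Fin n,
      ∫ x, dirDeriv n k I (fun x => ⟪A I v, φ x⟫) x • h N ⟪x, ξ⟫) atTop
      (𝓝 (∑ I : Fin k → Fin n, ∫ x, dirDeriv n k I (fun x => ⟪A I v, φ x⟫) x • s x)) :=
    tendsto_finsetSum _ fun I _ => hlim _ ((hψ I).dirDeriv I).1.continuous ((hψ I).dirDeriv I).2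
  have h3 : ∀ N, ∑ I : Fin k → Fin n,
      ∫ x, dirDeriv n k I (fun x => ⟪A I v, φ x⟫) x • h N ⟪x, ξ⟫ = 0 := fun N => by
    have hc : Continuous (iteratedDeriv k (h N)) :=
      (hh N).continuous_iteratedDeriv k (by exact_mod_cast le_top)
    have hc' : Continuous fun x : Euc n => iteratedDeriv k (h N) ⟪x, ξ⟫ :=
      hc.comp (contDiff_inner_left ξ).continuous
    have e1 : ∀ I : Fin k → Fin n,
        ∫ x, dirDeriv n k I (fun x => ⟪A I v, φ x⟫) x • h N ⟪x, ξ⟫ = (-1 : ℝ) ^ k •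
          ∫ x, iteratedDeriv k (h N) ⟪x, ξ⟫ * ⟪((∏ i, ξ (I i)) • A I) v, φ x⟫ := fun I => by
      rw [integral_dirDeriv_smul (hψ I) (g := fun x => h N ⟪x, ξ⟫)
        ((hh N).comp (contDiff_inner_left ξ))]
      congr 1
      refine integral_congr_ae (Eventually.of_forall fun x => ?_)
      simp only [dirDeriv_planeWave (hh N), LinearMap.smul_apply, real_inner_smul_left,
        smul_eq_mul]
      ring
    have hInt : ∀ I ∈ (Finset.univ : Finset (Fin k → Fin n)), Integrable fun x : Euc n =>
        iteratedDeriv k (h N) ⟪x, ξ⟫ * ⟪((∏ i, ξ (I i)) • A I) v, φ x⟫ := fun I _ =>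
      (hc'.mul (continuous_const.inner hφ.1.continuous)).integrable_of_hasCompactSupport
        ((hφ.2.comp_left (g := fun w => ⟪((∏ i, ξ (I i)) • A I) v, w⟫)
          (inner_zero_right _)).mul_left)
    rw [Finset.sum_congr rfl fun I _ => e1 I, ← Finset.smul_sum, ← integral_finsetSum _ hInt]
    simp only [← Finset.mul_sum, ← sum_inner, ← LinearMap.sum_apply]
    rw [show ∑ I : Fin k → Fin n, (∏ i, ξ (I i)) • A I = symbolMap n k A ξ from rfl, hv]
    simp
  simp only [h3] at h2
  rw [Finset.sum_congr rfl fun I _ => h1 I, tendsto_nhds_unique h2 tendsto_const_nhds]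
  simp

end PlaneWave

noncomputable section HalfSpace

variable {n m k : ℕ} {V W : Type*}
  [NormedAddCommGroup V] [InnerProductSpace ℝ V] [FiniteDimensional ℝ V]
  [NormedAddCommGroup W] [InnerProductSpace ℝ W] [FiniteDimensional ℝ W] {ξ : Euc n}

/-- The indicator function of the half space `{⟪x, ξ⟫ > 0}`. -/
def halfSpaceInd (n : ℕ) (ξ : Euc n) : Euc n → ℝ := {x : Euc n | 0 < ⟪x, ξ⟫}.indicator 1

lemma halfSpaceInd_of_pos {x : Euc n} (h : 0 < ⟪x, ξ⟫) : halfSpaceInd n ξ x = 1 :=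
  Set.indicator_of_mem (s := {x : Euc n | 0 < ⟪x, ξ⟫}) h 1

lemma halfSpaceInd_of_nonpos {x : Euc n} (h : ⟪x, ξ⟫ ≤ 0) : halfSpaceInd n ξ x = 0 :=
  Set.indicator_of_notMem (s := {x : Euc n | 0 < ⟪x, ξ⟫}) (not_lt.2 h) 1

lemma locallyIntegrable_halfSpaceInd : LocallyIntegrable (halfSpaceInd n ξ) volume :=
  (locallyIntegrable_const (1 : ℝ)).indicator
    (measurableSet_lt measurable_const (contDiff_inner_left ξ).continuous.measurable)

lemma memBVAloc_halfSpaceInd {A : CoeffOp n k V W} {v : V} (hv : symbolMap n k A ξ v = 0) :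
    MemBVAloc n k A (fun x => halfSpaceInd n ξ x • v) := by
  refine memBVAloc_of_tendsto_planeWave hv
    (h := fun N t => Real.smoothTransition ((N : ℝ) * t))
    (fun N => Real.smoothTransition.contDiff.comp (contDiff_const.mul contDiff_id))
    locallyIntegrable_halfSpaceInd fun φ hφ hc => ?_
  refine tendsto_integral_of_dominated_convergence (fun x => ‖φ x‖) (fun N => ?_)
    (hφ.integrable_of_hasCompactSupport hc).norm (fun N => ?_) ?_
  · exact (hφ.smul (Real.smoothTransition.continuous.comp
      (continuous_const.mul (contDiff_inner_left ξ).continuous))).aestronglyMeasurable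
  · refine Eventually.of_forall fun x => ?_
    rw [norm_smul, Real.norm_of_nonneg (Real.smoothTransition.nonneg _)]
    exact mul_le_of_le_one_right (norm_nonneg _) (Real.smoothTransition.le_one _)
  · refine Eventually.of_forall fun x => Tendsto.const_smul ?_ _
    rcases lt_or_ge 0 ⟪x, ξ⟫ with h | h
    · rw [halfSpaceInd_of_pos h]
      refine tendsto_const_nhds.congr' ?_
      filter_upwards [(tendsto_natCast_atTop_atTop.atTop_mul_const h).eventually_ge_atTop 1]
        with N hN using (Real.smoothTransition.one_of_one_le hN).symm
    · rw [halfSpaceInd_of_nonpos h]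
      refine tendsto_const_nhds.congr fun N => ?_
      exact (Real.smoothTransition.zero_of_nonpos
        (mul_nonpos_of_nonneg_of_nonpos N.cast_nonneg h)).symm

lemma volume_inner_eq_zero (hξ : ‖ξ‖ = 1) : volume {x : Euc n | ⟪x, ξ⟫ = 0} = 0 := by
  have h := Measure.addHaar_submodule (volume : Measure (Euc n)) (LinearMap.ker (innerₛₗ ℝ ξ)) ?_
  · convert h using 2
    ext x
    simp [real_inner_comm]
  · intro h
    have : ξ ∈ LinearMap.ker (innerₛₗ ℝ ξ) := h ▸ Submodule.mem_top
    simp [hξ] at this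

/-- A smooth function vanishing far on the negative side whose `m`-th derivative in a transversal
coordinate direction vanishes is zero. -/
lemma eq_zero_of_dirDeriv_eq_zero {g : Euc n → ℝ} (hg : ContDiff ℝ ∞ g) {i : Fin n}
    (hi : ξ i ≠ 0) (h : ∀ x, dirDeriv n m (fun _ => i) g x = 0) {R : ℝ}
    (hR : ∀ x : Euc n, ⟪x, ξ⟫ < -R → g x = 0) (x : Euc n) : g x = 0 := by
  induction m generalizing x with
  | zero => simpa [dirDeriv_fin_zero] using h x
  | succ m ih =>
    refine ih (fun x => ?_) x
    set F : Euc n → ℝ := dirDeriv n m (fun _ => i) g with hF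
    have hFd : Differentiable ℝ F := (contDiff_dirDeriv hg _).differentiable (by simp)
    have hF0 : ∀ x, fderiv ℝ F x (stdVec n i) = 0 := fun x => by
      rw [← h x, dirDeriv_succ hg]; rfl
    have hFR : ∀ x : Euc n, ⟪x, ξ⟫ < -R → F x = 0 := fun x hx => by
      have : g =ᶠ[𝓝 x] fun _ => (0 : ℝ) := by
        filter_upwards [(isOpen_lt (contDiff_inner_left ξ).continuous continuous_const).mem_nhds hx]
          with y hy using hR y hy
      rw [hF, dirDeriv_congr this]
      rcases m with _ | m
      · simp [dirDeriv_fin_zero]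
      · simp [dirDeriv]
    have hline : ∀ t : ℝ, HasDerivAt (fun t : ℝ => F (x + t • stdVec n i)) 0 t := fun t => by
      have h0 : HasDerivAt (fun t : ℝ => x + t • stdVec n i) (stdVec n i) t := by
        simpa using ((hasDerivAt_id t).smul_const (stdVec n i)).const_add x
      have := (hFd (x + t • stdVec n i)).hasFDerivAt.comp_hasDerivAt t h0
      rwa [hF0] at this
    have hc := is_const_of_deriv_eq_zero (fun t => (hline t).differentiableAt)
      (fun t => (hline t).deriv)
    have h1 := hc 0 (-(R + 1 + ⟪x, ξ⟫) / ξ i)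
    simp only [zero_smul, add_zero] at h1
    rw [h1]
    refine hFR _ ?_
    rw [inner_add_left, real_inner_smul_left, inner_stdVec, div_mul_cancel₀ _ hi]
    linarith

lemma exists_coord_ne_zero (hξ : ‖ξ‖ = 1) : ∃ i, ξ i ≠ 0 := by
  by_contra! h
  have : ξ = 0 := by ext i; simp [h]
  simp [this] at hξ

/-- The distributional transversal derivatives of a half space indicator do not vanish. -/
lemma exists_integral_dirDeriv_halfSpaceInd_ne_zero (hξ : ‖ξ‖ = 1) {i : Fin n} (hi : ξ i ≠ 0) :
    ∃ φ : Euc n → ℝ, IsTestFun n φ ∧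
      ∫ x, dirDeriv n m (fun _ => i) φ x * halfSpaceInd n ξ x ≠ 0 := by
  by_contra! hcon
  let b : ContDiffBump (0 : Euc n) := ⟨1, 2, one_pos, one_lt_two⟩
  set T : Euc n → ℝ →L[ℝ] ℝ := fun z =>
    ContinuousLinearMap.toSpanSingleton ℝ (ContinuousLinearMap.id ℝ ℝ) (b z) with hT
  have hb : IsTestFun n b := ⟨b.contDiff, b.hasCompactSupport⟩
  have hTt : IsTestFun n T := ⟨(ContinuousLinearMap.contDiff _).comp hb.1,
    hb.2.comp_left (g := ContinuousLinearMap.toSpanSingleton ℝ (ContinuousLinearMap.id ℝ ℝ))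
      (map_zero _)⟩
  have hs := locallyIntegrable_halfSpaceInd (n := n) (ξ := ξ)
  have hU : ∀ x, kconv T (halfSpaceInd n ξ) volume x = ∫ y, b (x - y) * halfSpaceInd n ξ y :=
    fun x => by simp [kconv, hT, ContinuousLinearMap.toSpanSingleton_apply]
  have hin : ∀ x y : Euc n, b (x - y) ≠ 0 → |⟪x, ξ⟫ - ⟪y, ξ⟫| < 2 := fun x y h => by
    have h1 : x - y ∈ Function.support b := h
    rw [b.support_eq, mem_ball_zero_iff] at h1
    rw [← inner_sub_left]
    exact ((abs_real_inner_le_norm _ _).trans_eq (by rw [hξ, mul_one])).trans_lt h1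
  have hz := eq_zero_of_dirDeriv_eq_zero (m := m) (contDiff_kconv hTt hs) hi (R := 2)
    (fun x => ?_) (fun x hx => ?_) ((2 : ℝ) • ξ)
  · rw [hU] at hz
    have h1 : ∀ y, b ((2 : ℝ) • ξ - y) * halfSpaceInd n ξ y = b ((2 : ℝ) • ξ - y) := fun y => by
      by_cases h : b ((2 : ℝ) • ξ - y) = 0
      · rw [h, zero_mul]
      · have h2 := hin _ _ h
        rw [real_inner_smul_left, real_inner_self_eq_norm_sq, hξ, abs_lt] at h2
        rw [halfSpaceInd_of_pos (by linarith [h2.2]), mul_one]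
    simp only [h1] at hz
    rw [integral_sub_left_eq_self (fun y => b y) volume] at hz
    exact b.integral_pos.ne' hz
  · have h1 := hcon (fun y => b (x - y)) ⟨b.contDiff.comp (contDiff_const.sub contDiff_id),
      hb.2.comp_homeomorph (Homeomorph.subLeft x)⟩
    rw [dirDeriv_kconv hTt hs]
    have h2 : ∀ z, dirDeriv n m (fun _ => i) T z =
        ContinuousLinearMap.toSpanSingleton ℝ (ContinuousLinearMap.id ℝ ℝ)
          (dirDeriv n m (fun _ => i) b z) := fun z =>
      dirDeriv_clm_comp _ _ (hb.1.contDiffAt.of_le (by exact_mod_cast le_top))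
    simp only [dirDeriv_comp_sub_left (fun z => b z), smul_eq_mul, mul_assoc] at h1
    rw [integral_const_mul] at h1
    have h3 := (mul_eq_zero.1 h1).resolve_left (pow_ne_zero _ (by norm_num))
    simpa [kconv, h2, ContinuousLinearMap.toSpanSingleton_apply] using h3
  · rw [hU]
    refine integral_eq_zero_of_ae (Eventually.of_forall fun y => ?_)
    by_cases h : b (x - y) = 0
    · simp [h]
    · have h2 := (abs_lt.1 (hin _ _ h)).1
      simp only [Pi.zero_apply]
      rw [halfSpaceInd_of_nonpos (by linarith), mul_zero]

/-- Off the boundary hyperplane the half space indicator has vanishing derivatives. -/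
lemma integral_dirDeriv_halfSpaceInd_eq_zero (hm : 1 ≤ m) {g : Euc n → ℝ} (hg : IsTestFun n g)
    (hsupp : tsupport g ⊆ {x | ⟪x, ξ⟫ ≠ 0}) (I : Fin m → Fin n) :
    ∫ x, dirDeriv n m I g x * halfSpaceInd n ξ x = 0 := by
  have hcont := (contDiff_inner_left ξ).continuous
  set G : Euc n → ℝ := fun x => g x * halfSpaceInd n ξ x with hG
  have hloc : ∀ x : Euc n, (halfSpaceInd n ξ x = 1 ∧ G =ᶠ[𝓝 x] g) ∨
      (dirDeriv n m I g x * halfSpaceInd n ξ x = 0 ∧ G =ᶠ[𝓝 x] fun _ => 0) := fun x => by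
    rcases lt_trichotomy ⟪x, ξ⟫ 0 with h | h | h
    · refine Or.inr ⟨by rw [halfSpaceInd_of_nonpos h.le, mul_zero], ?_⟩
      filter_upwards [(isOpen_lt hcont continuous_const).mem_nhds h] with y hy
      rw [hG]
      simp only
      rw [halfSpaceInd_of_nonpos (le_of_lt hy), mul_zero]
    · refine Or.inr ⟨by rw [halfSpaceInd_of_nonpos h.le, mul_zero], ?_⟩
      have h1 := notMem_tsupport_iff_eventuallyEq.1 fun hx => hsupp hx h
      filter_upwards [h1] with y hy
      rw [hG]
      simp only
      rw [hy, Pi.zero_apply, zero_mul]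
    · refine Or.inl ⟨halfSpaceInd_of_pos h, ?_⟩
      filter_upwards [(isOpen_lt continuous_const hcont).mem_nhds h] with y hy
      rw [hG]
      simp only
      rw [halfSpaceInd_of_pos hy, mul_one]
  have hGt : IsTestFun n G := by
    refine ⟨contDiff_iff_contDiffAt.2 fun x => ?_, hg.2.mul_right⟩
    rcases hloc x with ⟨-, h⟩ | ⟨-, h⟩
    · exact hg.1.contDiffAt.congr_of_eventuallyEq h
    · exact contDiffAt_const.congr_of_eventuallyEq h
  rw [← integral_dirDeriv_eq_zero hGt hm I]
  refine integral_congr_ae (Eventually.of_forall fun x => ?_)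
  rcases hloc x with ⟨h1, h⟩ | ⟨h1, h⟩
  · simp only
    rw [dirDeriv_congr h, h1, mul_one]
  · simp only
    rw [h1, dirDeriv_congr h]
    obtain ⟨m, rfl⟩ := Nat.exists_eq_succ_of_ne_zero (Nat.one_le_iff_ne_zero.1 hm)
    simp [dirDeriv]

/-- A half space indicator has no locally integrable weak derivatives of positive order. -/
theorem not_isWeakDerivFamily_halfSpaceInd (hξ : ‖ξ‖ = 1) {v : V} (hv : v ≠ 0) (hm : 1 ≤ m)
    (w : (Fin m → Fin n) → Euc n → V) :
    ¬ IsWeakDerivFamily n m (fun x => halfSpaceInd n ξ x • v) w := by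
  rintro ⟨hw, h⟩
  obtain ⟨i, hi⟩ := exists_coord_ne_zero hξ
  have hU : IsOpen {x : Euc n | ⟪x, ξ⟫ ≠ 0} :=
    isOpen_ne_fun (contDiff_inner_left ξ).continuous continuous_const
  have hrw : ∀ φ : Euc n → ℝ, IsTestFun n φ →
      (∫ x, dirDeriv n m (fun _ => i) φ x * halfSpaceInd n ξ x) • v =
        (-1 : ℝ) ^ m • ∫ x, φ x • w (fun _ => i) x := fun φ hφ => by
    rw [← h _ φ hφ, ← integral_smul_const]
    simp only [smul_smul]
  have hae := hU.ae_eq_zero_of_integral_contDiff_smul_eq_zero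
    ((hw (fun _ => i)).locallyIntegrableOn _) fun g hg hgc hgs => by
      have h1 := hrw g ⟨hg, hgc⟩
      rw [integral_dirDeriv_halfSpaceInd_eq_zero hm ⟨hg, hgc⟩ hgs, zero_smul] at h1
      exact (smul_eq_zero.1 h1.symm).resolve_left (pow_ne_zero _ (by norm_num))
  have hae0 : ∀ᵐ x, w (fun _ => i) x = 0 := by
    have h2 : ∀ᵐ x : Euc n, ⟪x, ξ⟫ ≠ 0 := by
      rw [ae_iff]
      simpa using volume_inner_eq_zero hξ
    filter_upwards [hae, h2] with x h3 h4 using h3 h4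
  obtain ⟨φ, hφ, hne⟩ := exists_integral_dirDeriv_halfSpaceInd_ne_zero (m := m) hξ hi
  have h1 := hrw φ hφ
  have h2 : ∫ x, φ x • w (fun _ => i) x = 0 :=
    integral_eq_zero_of_ae (by filter_upwards [hae0] with x hx; simp [hx])
  rw [h2, smul_zero] at h1
  exact (smul_ne_zero hne hv) h1

end HalfSpace

noncomputable section Oscillation

variable {n k : ℕ} {V W : Type*}
  [NormedAddCommGroup V] [InnerProductSpace ℝ V] [FiniteDimensional ℝ V]
  [NormedAddCommGroup W] [InnerProductSpace ℝ W] [FiniteDimensional ℝ W] {ξ : Euc n}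

lemma volume_mul_volume_eq_lintegral {S : Set (Euc n)} (hS : MeasurableSet S) {J : Set ℝ}
    (hJ : MeasurableSet J) (ξ : Euc n) :
    volume S * volume J = ∫⁻ y, volume (J ∩ {t : ℝ | y + t • ξ ∈ S}) := by
  set E : Set (ℝ × Euc n) := {p | p.1 ∈ J ∧ p.2 + p.1 • ξ ∈ S} with hE
  have hEm : MeasurableSet E :=
    (measurable_fst hJ).inter ((by fun_prop : Measurable fun p : ℝ × Euc n => p.2 + p.1 • ξ) hS)
  have h1 := Measure.prod_apply (μ := (volume : Measure ℝ)) (ν := (volume : Measure (Euc n))) hEm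
  have h2 := Measure.prod_apply_symm (μ := (volume : Measure ℝ))
    (ν := (volume : Measure (Euc n))) hEm
  have h3 : ∀ t, volume (Prod.mk t ⁻¹' E) = J.indicator (fun _ => volume S) t := fun t => by
    by_cases ht : t ∈ J
    · rw [Set.indicator_of_mem ht, ← measure_preimage_add_right volume (t • ξ) S]
      congr 1
      ext y
      simp [hE, ht]
    · rw [Set.indicator_of_notMem ht]
      have : Prod.mk t ⁻¹' E = ∅ := by ext y; simp [hE, ht]
      rw [this, measure_empty]
  simp only [h3] at h1
  rw [lintegral_indicator_const hJ] at h1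
  rw [← h1, h2]
  rfl

lemma volume_slab_le (hξ : ‖ξ‖ = 1) (q w R : ℝ) :
    volume (closedBall (0 : Euc n) R ∩ {y | |⟪y, ξ⟫ - q| < w}) ≤
      ENNReal.ofReal (2 * w) * volume (closedBall (0 : Euc n) (R + 1)) := by
  have hS : MeasurableSet (closedBall (0 : Euc n) R ∩ {y | |⟪y, ξ⟫ - q| < w}) :=
    measurableSet_closedBall.inter (isOpen_lt
      ((contDiff_inner_left ξ).continuous.sub continuous_const).abs continuous_const).measurableSet
  have h := volume_mul_volume_eq_lintegral hS (measurableSet_Ioo (a := (0 : ℝ)) (b := 1)) ξ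
  rw [Real.volume_Ioo, sub_zero, ENNReal.ofReal_one, mul_one] at h
  rw [h, ← lintegral_indicator_const measurableSet_closedBall]
  refine lintegral_mono fun y => ?_
  by_cases hy : y ∈ closedBall (0 : Euc n) (R + 1)
  · rw [Set.indicator_of_mem hy]
    calc _ ≤ volume (Set.Ioo (q - ⟪y, ξ⟫ - w) (q - ⟪y, ξ⟫ + w)) := by
          refine measure_mono fun t ⟨_, ht⟩ => ?_
          have h2 : |⟪y + t • ξ, ξ⟫ - q| < w := ht.2
          rw [inner_add_left, real_inner_smul_left, real_inner_self_eq_norm_sq, hξ, abs_lt] at h2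
          constructor <;> linarith [h2.1, h2.2]
      _ = _ := by rw [Real.volume_Ioo]; congr 1; ring
  · rw [Set.indicator_of_notMem hy, nonpos_iff_eq_zero]
    convert measure_empty (μ := (volume : Measure ℝ))
    refine Set.eq_empty_of_forall_notMem fun t ⟨ht, ht2⟩ => hy ?_
    have h2 : ‖y + t • ξ‖ ≤ R := mem_closedBall_zero_iff.1 ht2.1
    have h3 : ‖t • ξ‖ ≤ 1 := by
      rw [norm_smul, hξ, mul_one, Real.norm_of_nonneg ht.1.le]
      exact ht.2.le
    rw [mem_closedBall_zero_iff]
    calc ‖y‖ = ‖(y + t • ξ) - t • ξ‖ := by rw [add_sub_cancel_right]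
      _ ≤ _ := (norm_sub_le _ _).trans (add_le_add h2 h3)

lemma le_volume_slab (hξ : ‖ξ‖ = 1) {x : Euc n} {q w r : ℝ} (hw : w < r / 4)
    (hq : |⟪x, ξ⟫ - q| < r / 4) :
    ENNReal.ofReal (2 * w) * volume (ball (0 : Euc n) (r / 4)) ≤
      volume (ball x r ∩ {y | |⟪y, ξ⟫ - q| ≤ w}) * ENNReal.ofReal r := by
  have hS : MeasurableSet (ball x r ∩ {y | |⟪y, ξ⟫ - q| ≤ w}) :=
    measurableSet_ball.inter (isClosed_le
      ((contDiff_inner_left ξ).continuous.sub continuous_const).abs continuous_const).measurableSet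
  have h := volume_mul_volume_eq_lintegral hS
    (measurableSet_Ioo (a := -(r / 2)) (b := r / 2)) ξ
  rw [Real.volume_Ioo, sub_neg_eq_add, add_halves] at h
  rw [h]
  set x' := x + (q - ⟪x, ξ⟫) • ξ with hx'
  have hxq : ⟪x', ξ⟫ = q := by
    rw [hx', inner_add_left, real_inner_smul_left, real_inner_self_eq_norm_sq, hξ]
    ring
  have hxd : ‖x' - x‖ < r / 4 := by
    rw [hx', add_sub_cancel_left, norm_smul, hξ, mul_one, Real.norm_eq_abs, abs_sub_comm]
    exact hq
  rw [← Measure.addHaar_ball_center volume x' (r / 4),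
    ← lintegral_indicator_const measurableSet_ball]
  refine lintegral_mono fun y => ?_
  by_cases hy : y ∈ ball x' (r / 4)
  · rw [Set.indicator_of_mem hy]
    rw [mem_ball_iff_norm] at hy
    have hyq : |⟪y, ξ⟫ - q| < r / 4 := by
      rw [← hxq, ← inner_sub_left]
      exact ((abs_real_inner_le_norm _ _).trans_eq (by rw [hξ, mul_one])).trans_lt hy
    rw [abs_lt] at hyq
    calc _ = volume (Set.Icc (q - ⟪y, ξ⟫ - w) (q - ⟪y, ξ⟫ + w)) := by
          rw [Real.volume_Icc]; congr 1; ring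
      _ ≤ _ := by
          refine measure_mono fun t ht => ?_
          have ht1 : t ∈ Set.Ioo (-(r / 2)) (r / 2) := by
            constructor <;> linarith [ht.1, ht.2]
          refine ⟨ht1, ?_, ?_⟩
          · rw [mem_ball_iff_norm]
            have h3 : ‖t • ξ‖ < r / 2 := by
              rw [norm_smul, hξ, mul_one, Real.norm_eq_abs]
              exact abs_lt.2 ht1
            calc ‖y + t • ξ - x‖ = ‖(y - x') + (x' - x) + t • ξ‖ := by congr 1; abel
              _ ≤ ‖y - x'‖ + ‖x' - x‖ + ‖t • ξ‖ := norm_add₃_le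
              _ < r := by linarith
          · change |⟪y + t • ξ, ξ⟫ - q| ≤ w
            rw [inner_add_left, real_inner_smul_left, real_inner_self_eq_norm_sq, hξ, abs_le]
            constructor <;> linarith [ht.1, ht.2]
  · rw [Set.indicator_of_notMem hy]
    exact zero_le

/-- A bump of height one. -/
def unitBump : ContDiffBump (0 : ℝ) := ⟨1, 2, one_pos, one_lt_two⟩

/-- The profile concentrating near `denseSeq ℝ (k.unpair.1)` at scale `a⁻¹`. -/
def oscProfile (a : ℝ) (i : ℕ) (t : ℝ) : ℝ :=
  a ^ i * unitBump (a ^ i * (t - TopologicalSpace.denseSeq ℝ i.unpair.1))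

lemma contDiff_oscProfile (a : ℝ) (i : ℕ) : ContDiff ℝ ∞ (oscProfile a i) :=
  contDiff_const.mul (unitBump.contDiff.comp
    (contDiff_const.mul (contDiff_id.sub contDiff_const)))

lemma oscProfile_nonneg {a : ℝ} (ha : 0 < a) (i : ℕ) (t : ℝ) : 0 ≤ oscProfile a i t :=
  mul_nonneg (pow_pos ha i).le unitBump.nonneg

lemma lintegral_oscProfile_le (hξ : ‖ξ‖ = 1) {a : ℝ} (ha : 0 < a) (i : ℕ) (R : ℝ) :
    ∫⁻ x in closedBall (0 : Euc n) R, ‖oscProfile a i ⟪x, ξ⟫‖ₑ ≤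
      4 * volume (closedBall (0 : Euc n) (R + 1)) := by
  have hai := pow_pos ha i
  set q := TopologicalSpace.denseSeq ℝ i.unpair.1 with hq
  set S := {y : Euc n | |⟪y, ξ⟫ - q| < 2 * (a ^ i)⁻¹} with hS
  have hSm : MeasurableSet S := (isOpen_lt
    ((contDiff_inner_left ξ).continuous.sub continuous_const).abs continuous_const).measurableSet
  have hle : ∀ x : Euc n, ‖oscProfile a i ⟪x, ξ⟫‖ₑ ≤
      S.indicator (fun _ => ENNReal.ofReal (a ^ i)) x := fun x => by
    by_cases hx : x ∈ S
    · rw [Set.indicator_of_mem hx, Real.enorm_of_nonneg (oscProfile_nonneg ha _ _)]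
      exact ENNReal.ofReal_le_ofReal (mul_le_of_le_one_right hai.le unitBump.le_one)
    · rw [Set.indicator_of_notMem hx]
      have h1 : 2 * (a ^ i)⁻¹ ≤ |⟪x, ξ⟫ - q| := not_lt.1 hx
      have h2 : unitBump (a ^ i * (⟪x, ξ⟫ - q)) = 0 := by
        refine unitBump.zero_of_le_dist ?_
        rw [Real.dist_eq, sub_zero, abs_mul, abs_of_pos hai]
        calc (2 : ℝ) = a ^ i * (2 * (a ^ i)⁻¹) := by field_simp
          _ ≤ _ := mul_le_mul_of_nonneg_left h1 hai.le
      simp [oscProfile, ← hq, h2]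
  calc _ ≤ ∫⁻ x in closedBall (0 : Euc n) R, S.indicator (fun _ => ENNReal.ofReal (a ^ i)) x :=
        lintegral_mono hle
    _ = ENNReal.ofReal (a ^ i) * volume (closedBall (0 : Euc n) R ∩ S) := by
        rw [lintegral_indicator_const hSm, Measure.restrict_apply hSm, Set.inter_comm]
    _ ≤ ENNReal.ofReal (a ^ i) * (ENNReal.ofReal (2 * (2 * (a ^ i)⁻¹)) *
        volume (closedBall (0 : Euc n) (R + 1))) := by
        gcongr
        exact volume_slab_le hξ q _ R
    _ = _ := by
        rw [← mul_assoc, ← ENNReal.ofReal_mul hai.le,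
          show a ^ i * (2 * (2 * (a ^ i)⁻¹)) = 4 by field_simp; norm_num]
        norm_num

/-- There is a function of `⟪x, ξ⟫` alone, annihilated by every operator whose symbol degenerates
at `ξ`, with large level sets around every point. -/
theorem exists_oscillating (hξ : ‖ξ‖ = 1) : ∃ s : Euc n → ℝ, LocallyIntegrable s volume ∧
    (∀ (A : CoeffOp n k V W) (v : V), symbolMap n k A ξ v = 0 →
      MemBVAloc n k A (fun x => s x • v)) ∧
    ∀ (x : Euc n) (r : ℝ), 0 < r → ∃ c : ℝ, 0 < c ∧ ∃ᶠ i in atTop,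
      ENNReal.ofReal (c * (((2 : ℝ) * 4 ^ n) ^ i)⁻¹) ≤
        volume (ball x r ∩ {y | ((4 : ℝ) ^ n) ^ i ≤ s y}) := by
  set a : ℝ := 2 * 4 ^ n with ha_def
  have ha : 0 < a := by positivity
  have ha2 : 2 ≤ a := by
    have : (1 : ℝ) ≤ 4 ^ n := one_le_pow₀ (by norm_num)
    linarith
  obtain ⟨s, hs, hsum, hlim⟩ := exists_locallyIntegrable_hasSum (n := n) (V := ℝ) (j := 1) le_rfl
    (g := fun i x => oscProfile a i ⟪x, ξ⟫)
    (fun i => (contDiff_oscProfile a i).continuous.comp (contDiff_inner_left ξ).continuous)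
    (fun ρ => ⟨4 * volume (closedBall (0 : Euc n) (ρ + 1)),
      ENNReal.mul_ne_top (by norm_num) measure_closedBall_lt_top.ne,
      fun i => lintegral_oscProfile_le hξ ha i ρ⟩)
  refine ⟨s, hs, fun A v hv => ?_, fun x r hr => ?_⟩
  · refine memBVAloc_of_tendsto_planeWave hv
      (h := fun N t => ∑ i ∈ Finset.range N, (((2 : ℝ) ^ i)⁻¹) ^ 1 • oscProfile a i t)
      (fun N => ContDiff.sum fun i _ => contDiff_const.mul (contDiff_oscProfile a i)) hs
      fun φ hφ hc => hlim φ hφ hc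
  · set vb := (volume (ball (0 : Euc n) (r / 4))).toReal with hvb
    have hvb0 : 0 < vb := ENNReal.toReal_pos (measure_ball_pos volume _ (by positivity)).ne'
      measure_ball_lt_top.ne
    refine ⟨2 * vb / r, by positivity, ?_⟩
    obtain ⟨i₀, hi₀⟩ := (TopologicalSpace.denseRange_denseSeq ℝ).exists_mem_open
      (isOpen_ball (x := ⟪x, ξ⟫) (ε := r / 4)) ⟨_, mem_ball_self (by positivity)⟩
    rw [frequently_atTop]
    intro N
    obtain ⟨N', hN'⟩ : ∃ N' : ℕ, (a ^ N')⁻¹ < r / 4 := by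
      obtain ⟨N', h⟩ := exists_pow_lt_of_lt_one (show 0 < r / 4 by positivity)
        (show a⁻¹ < 1 by exact inv_lt_one_of_one_lt₀ (by linarith))
      exact ⟨N', by rwa [inv_pow] at h⟩
    set i := Nat.pair i₀ (max N N') with hi
    have hiN : max N N' ≤ i := Nat.right_le_pair _ _
    refine ⟨i, (le_max_left _ _).trans hiN, ?_⟩
    set q := TopologicalSpace.denseSeq ℝ i.unpair.1 with hq
    have hai := pow_pos ha i
    have hw : (a ^ i)⁻¹ < r / 4 := by
      refine lt_of_le_of_lt ?_ hN'
      exact inv_anti₀ (pow_pos ha _)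
        (pow_le_pow_right₀ (by linarith) ((le_max_right _ _).trans hiN))
    have hxq : |⟪x, ξ⟫ - q| < r / 4 := by
      rw [hq, hi, Nat.unpair_pair, abs_sub_comm]
      exact hi₀
    have hslab := le_volume_slab hξ hw hxq
    have hsub : volume (ball x r ∩ {y | |⟪y, ξ⟫ - q| ≤ (a ^ i)⁻¹}) ≤
        volume (ball x r ∩ {y | ((4 : ℝ) ^ n) ^ i ≤ s y}) := by
      refine measure_mono_ae ?_
      filter_upwards [hsum] with y hy ⟨hy1, hy2⟩
      refine ⟨hy1, ?_⟩
      have h1 : unitBump (a ^ i * (⟪y, ξ⟫ - q)) = 1 := by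
        refine unitBump.one_of_mem_closedBall ?_
        rw [mem_closedBall, Real.dist_eq, sub_zero, abs_mul, abs_of_pos hai]
        calc _ ≤ a ^ i * (a ^ i)⁻¹ := mul_le_mul_of_nonneg_left hy2 hai.le
          _ = 1 := mul_inv_cancel₀ hai.ne'
      have h2 := le_hasSum hy i fun l _ =>
        smul_nonneg (by positivity) (oscProfile_nonneg ha l ⟪y, ξ⟫)
      have h3 : (((2 : ℝ) ^ i)⁻¹) ^ 1 • oscProfile a i ⟪y, ξ⟫ = ((4 : ℝ) ^ n) ^ i := by
        rw [oscProfile, ← hq, h1, ha_def, mul_pow, smul_eq_mul]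
        field_simp
      exact h3 ▸ h2
    have hr' : ENNReal.ofReal r ≠ 0 := by simpa using hr
    rw [← ENNReal.mul_le_mul_iff_left hr' ENNReal.ofReal_ne_top]
    refine le_trans ?_ (hslab.trans (mul_le_mul_left hsub _))
    rw [← ENNReal.ofReal_toReal (measure_ball_lt_top (x := (0 : Euc n)) (r := r / 4)
      (μ := volume)).ne, ← hvb, ← ENNReal.ofReal_mul (by positivity),
      ← ENNReal.ofReal_mul (by positivity)]
    refine (congrArg ENNReal.ofReal ?_).le
    field_simp

end Oscillation

section LargeLevelSets

variable {α F : Type*} [MeasurableSpace α] [NormedAddCommGroup F] {μ : Measure α} {f : α → F}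
  {n j : ℕ}

lemma weakLpNorm_eq_top_of_frequently (hj : 1 ≤ j) (hjn : j < n) {c d : ℝ} (hc : 0 < c)
    (hd : 0 < d) (h : ∃ᶠ i in atTop, ENNReal.ofReal (c * (((2 : ℝ) * 4 ^ n) ^ i)⁻¹) ≤
      μ {y | d * ((4 : ℝ) ^ n) ^ i < ‖f y‖}) :
    weakLpNorm ((n : ℝ) / ((n : ℝ) - (j : ℝ))) μ f = ⊤ := by
  by_contra hC
  set p : ℝ := (n : ℝ) / ((n : ℝ) - (j : ℝ)) with hp_def
  set C := weakLpNorm p μ f with hC_def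
  set a : ℝ := 2 * 4 ^ n with ha_def
  have ha : 0 < a := by positivity
  have hj' : (1 : ℝ) ≤ j := by exact_mod_cast hj
  have hjn' : (0 : ℝ) < n - j := by
    rw [sub_pos]; exact_mod_cast hjn
  have hn : (0 : ℝ) < n := by linarith
  have hp : 0 < p := div_pos hn hjn'
  have hnp : (n : ℝ) + 1 ≤ n * p := by
    rw [hp_def, ← mul_div_assoc, le_div_iff₀ hjn']
    nlinarith
  have hlt : a ^ (1 / p) < 4 ^ n := by
    have h1 : a < ((4 : ℝ) ^ n) ^ p := by
      rw [← Real.rpow_natCast 4 n, ← Real.rpow_mul (by norm_num)]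
      calc a < 4 * 4 ^ n := by
            have : (0 : ℝ) < 4 ^ n := by positivity
            linarith
        _ = (4 : ℝ) ^ ((n : ℝ) + 1) := by
            rw [Real.rpow_add (by norm_num), Real.rpow_natCast, Real.rpow_one, mul_comm]
        _ ≤ _ := Real.rpow_le_rpow_of_exponent_le (by norm_num) hnp
    calc a ^ (1 / p) < (((4 : ℝ) ^ n) ^ p) ^ (1 / p) :=
          Real.rpow_lt_rpow ha.le h1 (by positivity)
      _ = 4 ^ n := by
          rw [← Real.rpow_mul (by positivity), mul_one_div, div_self hp.ne', Real.rpow_one]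
  have hap : 0 < a ^ (1 / p) := Real.rpow_pos_of_pos ha _
  set b := 4 ^ n / a ^ (1 / p) with hb_def
  have hb : 1 < b := (one_lt_div hap).2 hlt
  have hcp : 0 < c ^ (1 / p) := Real.rpow_pos_of_pos hc _
  have hkey : ∃ᶠ i : ℕ in atTop, d * c ^ (1 / p) * b ^ i ≤ C.toReal := by
    refine h.mono fun i hi => ?_
    have ht : 0 < d * ((4 : ℝ) ^ n) ^ i := by positivity
    have h1 : ENNReal.ofReal (d * ((4 : ℝ) ^ n) ^ i) *
        ENNReal.ofReal (c * (a ^ i)⁻¹) ^ (1 / p) ≤ C := by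
      refine le_trans ?_ (le_iSup₂ (f := fun (t : ℝ) (_ : 0 < t) =>
        ENNReal.ofReal t * (μ {x | t < ‖f x‖}) ^ (1 / p)) _ ht)
      gcongr
    rw [ENNReal.ofReal_rpow_of_pos (by positivity), ← ENNReal.ofReal_mul ht.le] at h1
    have h2 := (ENNReal.ofReal_le_iff_le_toReal hC).1 h1
    refine le_trans (le_of_eq ?_) h2
    rw [Real.mul_rpow hc.le (by positivity), Real.inv_rpow (by positivity),
      ← Real.rpow_natCast a i, ← Real.rpow_mul ha.le, mul_comm (i : ℝ), Real.rpow_mul ha.le,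
      Real.rpow_natCast, hb_def, div_pow]
    ring
  have hlim : Tendsto (fun i : ℕ => d * c ^ (1 / p) * b ^ i) atTop atTop :=
    (tendsto_pow_atTop_atTop_of_one_lt hb).const_mul_atTop (by positivity)
  obtain ⟨i, h1, h2⟩ := (hkey.and_eventually (hlim.eventually_gt_atTop C.toReal)).exists
  exact absurd h1 (not_le.2 h2)

lemma rearr_mul_le_lintegral {s t : ℝ} :
    rearr μ f t * ENNReal.ofReal (t - s) ≤ ∫⁻ r in Set.Ioc s t, rearr μ f r := by
  rw [← Real.volume_Ioc, ← setLIntegral_const]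
  exact setLIntegral_mono' measurableSet_Ioc fun r hr => rearr_anti hr.2

lemma rearr_le_rearrStar2 {t : ℝ} (ht : 0 < t) : rearr μ f t ≤ rearrStar2 μ f t := by
  have h := rearr_mul_le_lintegral (μ := μ) (f := f) (s := 0) (t := t)
  rw [sub_zero] at h
  have h0 : ENNReal.ofReal t ≠ 0 := by simpa using ht
  rw [rearrStar2, mul_comm, ← div_eq_mul_inv]
  rwa [ENNReal.le_div_iff_mul_le (Or.inl h0) (Or.inl ENNReal.ofReal_ne_top)]

lemma rearrStar2_half_add_rearr_le {t : ℝ} (ht : 0 < t) :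
    rearrStar2 μ f (t / 2) + rearr μ f t ≤ 2 * rearrStar2 μ f t := by
  have h := rearr_mul_le_lintegral (μ := μ) (f := f) (s := t / 2) (t := t)
  rw [sub_half] at h
  have h0 : ENNReal.ofReal (t / 2) ≠ 0 := by simpa using ht
  have h1 : rearr μ f t ≤
      (ENNReal.ofReal (t / 2))⁻¹ * ∫⁻ r in Set.Ioc (t / 2) t, rearr μ f r := by
    rw [mul_comm, ← div_eq_mul_inv]
    rwa [ENNReal.le_div_iff_mul_le (Or.inl h0) (Or.inl ENNReal.ofReal_ne_top)]
  have h2 : (ENNReal.ofReal (t / 2))⁻¹ = 2 * (ENNReal.ofReal t)⁻¹ := by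
    rw [← ENNReal.ofReal_inv_of_pos (by positivity), ← ENNReal.ofReal_inv_of_pos ht,
      ← ENNReal.ofReal_ofNat, ← ENNReal.ofReal_mul (by norm_num)]
    congr 1
    field_simp
  calc _ ≤ (ENNReal.ofReal (t / 2))⁻¹ * (∫⁻ r in Set.Ioc 0 (t / 2), rearr μ f r) +
        (ENNReal.ofReal (t / 2))⁻¹ * ∫⁻ r in Set.Ioc (t / 2) t, rearr μ f r := by
        gcongr
        exact le_rfl
    _ = (ENNReal.ofReal (t / 2))⁻¹ * ∫⁻ r in Set.Ioc 0 t, rearr μ f r := by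
        rw [← mul_add, ← lintegral_union measurableSet_Ioc (Set.Ioc_disjoint_Ioc_of_le le_rfl),
          Set.Ioc_union_Ioc_eq_Ioc (by positivity) (by linarith)]
    _ = _ := by rw [h2, rearrStar2, mul_assoc]

/-- The oscillation bound forces at most logarithmic growth of the rearrangement. -/
lemma rearrStar2_half_pow_le {C : ℝ≥0∞} (hC : C ≠ ⊤) (h : weakLInftyNorm μ f ≤ C) {t : ℝ}
    (ht : 0 < t) (htμ : ENNReal.ofReal t < μ Set.univ) (hfin : rearr μ f t ≠ ⊤) (m : ℕ) :
    rearrStar2 μ f (t / 2 ^ m) ≤ rearr μ f t + (m + 1) * C := by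
  have hosc : ∀ m : ℕ, rearrStar2 μ f (t / 2 ^ m) ≤ rearr μ f (t / 2 ^ m) + C := fun m => by
    have h1 : 0 < t / 2 ^ m := by positivity
    have h2 : ENNReal.ofReal (t / 2 ^ m) < μ Set.univ :=
      (ENNReal.ofReal_le_ofReal (div_le_self ht.le (one_le_pow₀ one_le_two))).trans_lt htμ
    rw [← tsub_le_iff_left]
    exact (le_iSup₂_of_le (t / 2 ^ m) h1 (le_iSup (fun _ => _) h2)).trans h
  induction m with
  | zero => simpa using hosc 0
  | succ m ih =>
    have hm : 0 < t / 2 ^ m := by positivity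
    have hfm : rearr μ f (t / 2 ^ m) ≠ ⊤ := by
      refine ne_top_of_le_ne_top ?_ ((rearr_le_rearrStar2 hm).trans ih)
      exact ENNReal.add_ne_top.2 ⟨hfin, ENNReal.mul_ne_top (by simp) hC⟩
    have h1 := rearrStar2_half_add_rearr_le (μ := μ) (f := f) hm
    have h2 : rearrStar2 μ f (t / 2 ^ m / 2) ≤ rearrStar2 μ f (t / 2 ^ m) + C := by
      refine (ENNReal.add_le_add_iff_right hfm).1 (h1.trans ?_)
      rw [two_mul, add_assoc, add_comm C]
      gcongr
      exact hosc m
    rw [pow_succ, ← div_div]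
    refine h2.trans ((add_le_add_left ih C).trans (le_of_eq ?_))
    push_cast
    ring

lemma le_rearr_of_lt_measure {t l : ℝ} (h : ENNReal.ofReal t < μ {y | l < ‖f y‖}) :
    ENNReal.ofReal l ≤ rearr μ f t := by
  refine le_sInf fun e he => ?_
  by_contra! hlt
  refine absurd (h.trans_le ((measure_mono fun y hy => ?_).trans he)) (lt_irrefl _)
  rw [Set.mem_ofPred_eq, ← enorm_eq_nnnorm, ← ofReal_norm]
  exact hlt.trans_le (ENNReal.ofReal_le_ofReal (le_of_lt hy))

lemma rearr_ne_top (hf : Integrable f μ) {t : ℝ} (ht : 0 < t) : rearr μ f t ≠ ⊤ := by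
  set L := (∫⁻ y, ‖f y‖ₑ ∂μ) / ENNReal.ofReal t with hL
  have h0 : ENNReal.ofReal t ≠ 0 := by simpa using ht
  have hL' : L ≠ ⊤ := ENNReal.div_ne_top hf.2.ne h0
  refine ne_top_of_le_ne_top (b := L + 1) (by simp [hL']) (sInf_le ?_)
  rw [Set.mem_ofPred_eq]
  have hpos : L + 1 ≠ 0 := by simp
  calc μ {x | L + 1 < (‖f x‖₊ : ℝ≥0∞)} ≤ μ {x | L + 1 ≤ ‖f x‖ₑ} :=
        measure_mono fun x (hx : L + 1 < ‖f x‖ₑ) => show L + 1 ≤ ‖f x‖ₑ from hx.le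
    _ ≤ (∫⁻ y, ‖f y‖ₑ ∂μ) / (L + 1) :=
        meas_ge_le_lintegral_div hf.1.enorm hpos (by simp [hL'])
    _ ≤ _ := by
        refine ENNReal.div_le_of_le_mul ?_
        rw [mul_add, hL, ENNReal.mul_div_cancel h0 ENNReal.ofReal_ne_top]
        exact le_self_add

lemma weakLInftyNorm_eq_top_of_frequently (hn : 1 ≤ n) (hf : Integrable f μ) {c d : ℝ}
    (hc : 0 < c) (hd : 0 < d)
    (h : ∃ᶠ i in atTop, ENNReal.ofReal (c * (((2 : ℝ) * 4 ^ n) ^ i)⁻¹) ≤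
      μ {y | d * ((4 : ℝ) ^ n) ^ i < ‖f y‖}) :
    weakLInftyNorm μ f = ⊤ := by
  by_contra hC
  set C := weakLInftyNorm μ f with hC_def
  have hμ : μ Set.univ ≠ 0 := fun h0 => by
    obtain ⟨i, hi⟩ := h.exists
    rw [measure_mono_null (Set.subset_univ _) h0, nonpos_iff_eq_zero, ENNReal.ofReal_eq_zero] at hi
    exact absurd hi (not_le.2 (by positivity))
  obtain ⟨t, ht0, ht⟩ : ∃ t : ℝ, 0 < t ∧ ENNReal.ofReal t <
      min (μ Set.univ) (ENNReal.ofReal c) := by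
    obtain ⟨e, he0, he⟩ := exists_between
      (lt_min (pos_iff_ne_zero.2 hμ) (ENNReal.ofReal_pos.2 hc))
    have het : e ≠ ⊤ := he.ne_top
    exact ⟨e.toReal, ENNReal.toReal_pos he0.ne' het, by rwa [ENNReal.ofReal_toReal het]⟩
  have htc : t < c := (ENNReal.ofReal_lt_ofReal_iff hc).1 (ht.trans_le (min_le_right _ _))
  have hfin := rearr_ne_top hf ht0
  set K := (rearr μ f t).toReal with hK
  have hkey : ∃ᶠ i : ℕ in atTop, d * ((4 : ℝ) ^ n) ^ i ≤
      K + (((2 * n + 1) * i : ℕ) + 1) * C.toReal := by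
    refine h.mono fun i hi => ?_
    have hpow : ((2 : ℝ) * 4 ^ n) ^ i = 2 ^ ((2 * n + 1) * i) := by
      rw [pow_mul, pow_succ, pow_mul]
      norm_num [mul_comm]
    have hlt : ENNReal.ofReal (t / 2 ^ ((2 * n + 1) * i)) <
        μ {y | d * ((4 : ℝ) ^ n) ^ i < ‖f y‖} := by
      refine lt_of_lt_of_le ?_ hi
      rw [ENNReal.ofReal_lt_ofReal_iff (by positivity), hpow, div_eq_mul_inv]
      exact mul_lt_mul_of_pos_right htc (by positivity)
    have h1 := (le_rearr_of_lt_measure hlt).trans ((rearr_le_rearrStar2 (by positivity)).trans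
      (rearrStar2_half_pow_le hC le_rfl ht0 (ht.trans_le (min_le_left _ _)) hfin _))
    have htop : rearr μ f t + (((2 * n + 1) * i : ℕ) + 1) * C ≠ ⊤ :=
      ENNReal.add_ne_top.2 ⟨hfin, ENNReal.mul_ne_top (by finiteness) hC⟩
    have h2 := (ENNReal.ofReal_le_iff_le_toReal htop).1 h1
    rw [ENNReal.toReal_add hfin (ENNReal.mul_ne_top (by finiteness) hC), ENNReal.toReal_mul,
      ENNReal.toReal_add (by finiteness) (by simp), ENNReal.toReal_natCast,
      ENNReal.toReal_one] at h2
    exact h2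
  have hlim : Tendsto (fun i : ℕ => (K + (((2 * n + 1) * i : ℕ) + 1) * C.toReal) *
      (((4 : ℝ) ^ n) ^ i)⁻¹) atTop (𝓝 0) := by
    have hb : 1 < (4 : ℝ) ^ n := one_lt_pow₀ (by norm_num) (by omega)
    have h1 := tendsto_pow_const_div_const_pow_of_one_lt 1 hb
    have h0 := tendsto_pow_const_div_const_pow_of_one_lt 0 hb
    have h2 := (h0.const_mul (K + C.toReal)).add (h1.const_mul ((2 * n + 1) * C.toReal))
    simp only [mul_zero, add_zero, pow_zero, pow_one] at h2
    refine h2.congr fun i => ?_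
    push_cast
    ring
  obtain ⟨i, h1, h2⟩ := (hkey.and_eventually (hlim.eventually_lt_const hd)).exists
  have hp : 0 < ((4 : ℝ) ^ n) ^ i := by positivity
  rw [← div_eq_mul_inv, div_lt_iff₀ hp] at h2
  exact absurd h1 (not_le.2 h2)

end LargeLevelSets

section Converse

variable {n k j : ℕ} {V W : Type*}
  [NormedAddCommGroup V] [InnerProductSpace ℝ V] [FiniteDimensional ℝ V]
  [NormedAddCommGroup W] [InnerProductSpace ℝ W] [FiniteDimensional ℝ W]

lemma SmallO.exists_ne_top {Q : ℝ → ℝ≥0∞} {a : ℝ} (h : SmallO Q a) : ∃ r, 0 < r ∧ Q r ≠ ⊤ := by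
  obtain ⟨r, hr, hr0⟩ :=
    ((h.eventually (Iio_mem_nhds ENNReal.zero_lt_top)).and self_mem_nhdsWithin).exists
  refine ⟨r, hr0, fun htop => ?_⟩
  have hlt : Q r / ENNReal.ofReal (r ^ a) < ⊤ := hr
  rw [htop, ENNReal.top_div_of_ne_top ENNReal.ofReal_ne_top] at hlt
  exact lt_irrefl _ hlt

/-- Large level sets survive multiplication by a fixed vector and subtraction of a continuous
map. -/
lemma frequently_le_measure_sub {s : Euc n → ℝ} {v : V} (hv : v ≠ 0) {f P : Euc n → V}
    (hf : f =ᵐ[volume] fun x => s x • v) (hP : Continuous P) (hn : 1 ≤ n) {x : Euc n} {r c : ℝ}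
    (h : ∃ᶠ i in atTop, ENNReal.ofReal (c * (((2 : ℝ) * 4 ^ n) ^ i)⁻¹) ≤
        volume (ball x r ∩ {y | ((4 : ℝ) ^ n) ^ i ≤ s y})) :
    ∃ᶠ i in atTop, ENNReal.ofReal (c * (((2 : ℝ) * 4 ^ n) ^ i)⁻¹) ≤
        volume.restrict (ball x r) {y | ‖v‖ / 2 * ((4 : ℝ) ^ n) ^ i < ‖f y - P y‖} := by
  obtain ⟨M, hM⟩ := (isCompact_closedBall x r).exists_bound_of_continuousOn hP.continuousOn
  have hv' : 0 < ‖v‖ := norm_pos_iff.2 hv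
  have hlim : Tendsto (fun i : ℕ => ‖v‖ / 2 * ((4 : ℝ) ^ n) ^ i) atTop atTop :=
    (tendsto_pow_atTop_atTop_of_one_lt
      (one_lt_pow₀ (by norm_num) (by omega))).const_mul_atTop (by positivity)
  refine (h.and_eventually (hlim.eventually_gt_atTop M)).mono fun i ⟨hi, hiM⟩ => hi.trans ?_
  rw [Measure.restrict_apply' measurableSet_ball]
  refine measure_mono_ae ?_
  filter_upwards [hf] with y hy ⟨hy1, hy2⟩
  refine ⟨?_, hy1⟩
  have h1 : ((4 : ℝ) ^ n) ^ i ≤ s y := hy2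
  have h2 : ‖P y‖ ≤ M := hM y (ball_subset_closedBall hy1)
  have h3 : ‖v‖ * ((4 : ℝ) ^ n) ^ i ≤ ‖f y‖ := by
    rw [hy, norm_smul, mul_comm]
    exact mul_le_mul_of_nonneg_right (h1.trans (Real.le_norm_self _)) hv'.le
  change ‖v‖ / 2 * ((4 : ℝ) ^ n) ^ i < ‖f y - P y‖
  linarith [norm_sub_norm_le (f y) (P y)]

theorem not_memTWeak_of_oscillating {s : Euc n → ℝ} {v : V} (hv : v ≠ 0) {f : Euc n → V}
    (hf : f =ᵐ[volume] fun x => s x • v) (hloc : LocallyIntegrable f volume) (hn : 1 ≤ n)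
    (hs : ∀ (x : Euc n) (r : ℝ), 0 < r → ∃ c : ℝ, 0 < c ∧ ∃ᶠ i in atTop,
      ENNReal.ofReal (c * (((2 : ℝ) * 4 ^ n) ^ i)⁻¹) ≤
        volume (ball x r ∩ {y | ((4 : ℝ) ^ n) ^ i ≤ s y})) (hj : 1 ≤ j) (hjn : j ≤ n) (x : Euc n)
    (h1 : j < n → MemTWeakLp n j ((n : ℝ) / ((n : ℝ) - (j : ℝ))) f x)
    (h2 : j = n → MemTWeakLinfty n j f x) : False := by
  have hv' : 0 < ‖v‖ / 2 := by have := norm_pos_iff.2 hv; positivity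
  rcases hjn.lt_or_eq with h | h
  · obtain ⟨P, hP, hsm⟩ := h1 h
    obtain ⟨r, hr, hne⟩ := hsm.exists_ne_top
    obtain ⟨c, hc, hfr⟩ := hs x r hr
    exact hne (weakLpNorm_eq_top_of_frequently hj h hc hv'
      (frequently_le_measure_sub hv hf hP.1.continuous hn hfr))
  · obtain ⟨P, hP, hsm⟩ := h2 h
    obtain ⟨r, hr, hne⟩ := hsm.exists_ne_top
    obtain ⟨c, hc, hfr⟩ := hs x r hr
    have hInt : Integrable (fun y => f y - P y) (volume.restrict (ball x r)) :=
      ((hloc.sub hP.1.continuous.locallyIntegrable).integrableOn_isCompact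
        (isCompact_closedBall x r)).mono_set ball_subset_closedBall
    exact hne (weakLInftyNorm_eq_top_of_frequently hn hInt hc hv'
      (frequently_le_measure_sub hv hf hP.1.continuous hn hfr))

/-- Weak-type differentiability of all maps of locally bounded `𝒜`-variation forces ellipticity. -/
theorem isElliptic_of_memTWeak {A : CoeffOp n k V W} (hj : 1 ≤ j) (hjn : j ≤ n)
    (H : ∀ u : Euc n → V, MemBVAloc n k A u →
      ∃ v : (Fin (k - j) → Fin n) → Euc n → V, IsWeakDerivFamily n (k - j) u v ∧
        ∀ᵐ x ∂(volume : Measure (Euc n)), ∀ I,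
          (j < n → MemTWeakLp n j ((n : ℝ) / ((n : ℝ) - (j : ℝ))) (v I) x) ∧
          (j = n → MemTWeakLinfty n j (v I) x)) : IsElliptic n k A := by
  by_contra hA
  obtain ⟨ξ, v, hξ, hv, hsymb⟩ := exists_symbolMap_eq_zero hA
  rcases Nat.eq_zero_or_pos (k - j) with hm | hm
  · obtain ⟨s, -, hBV, hosc⟩ := exists_oscillating (k := k) (V := V) (W := W) hξ
    obtain ⟨w, ⟨hwl, hw⟩, hae⟩ := H _ (hBV A v hsymb)
    obtain ⟨x, hx⟩ := hae.exists
    let I : Fin (k - j) → Fin n := fun i => (Fin.cast hm i).elim0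
    have heq : w I =ᵐ[volume] fun x => s x • v := by
      refine ae_eq_of_integral_contDiff_smul_eq (hwl I) (hBV A v hsymb).1 fun g hg hgc => ?_
      have h1 := hw I g ⟨hg, hgc⟩
      have h0 : ∀ {m : ℕ} (_ : m = 0) (I : Fin m → Fin n) (x : Euc n),
          dirDeriv n m I g x = g x := by
        rintro m rfl I x
        exact dirDeriv_fin_zero I g x
      simp only [h0 hm, hm, pow_zero, one_smul] at h1
      exact h1.symm
    exact not_memTWeak_of_oscillating hv heq (hwl I) (hj.trans hjn) hosc hj hjn x
      (hx I).1 (hx I).2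
  · obtain ⟨w, hw, -⟩ := H _ (memBVAloc_halfSpaceInd hsymb)
    exact not_isWeakDerivFamily_halfSpaceInd hξ hv hm w hw

end Converse

/-- weak-type theorem of the Appendix: for `1 ≤ j ≤ min{k, n}`,
`𝒜` is elliptic iff for every `u ∈ BV^𝒜_loc`, `D^{k-j} u ∈ t^{j,(n/(n-j),∞)}(x)` a.e.
(the case `j = n` being interpreted in the weak-`L^∞` space of
Bennett–DeVore–Sharpley). -/
theorem statement18 (n k j : ℕ) {V W : Type*}
    [NormedAddCommGroup V] [InnerProductSpace ℝ V] [FiniteDimensional ℝ V]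
    [NormedAddCommGroup W] [InnerProductSpace ℝ W] [FiniteDimensional ℝ W]
    (A : CoeffOp n k V W) (hA : IsSymmetricOp n k A)
    (hj1 : 1 ≤ j) (hjk : j ≤ k) (hjn : j ≤ n) :
    IsElliptic n k A ↔
      ∀ u : Euc n → V, MemBVAloc n k A u →
        ∃ v : (Fin (k - j) → Fin n) → Euc n → V, IsWeakDerivFamily n (k - j) u v ∧
          ∀ᵐ x ∂(volume : Measure (Euc n)), ∀ I,
            (j < n → MemTWeakLp n j ((n : ℝ) / ((n : ℝ) - (j : ℝ))) (v I) x) ∧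
            (j = n → MemTWeakLinfty n j (v I) x) := by
  refine ⟨fun hell u hu => ?_, isElliptic_of_memTWeak hj1 hjn⟩
  obtain ⟨v, hv, hae⟩ := exists_hasScaleDecomp hell hj1 hjk hjn hu
  refine ⟨v, hv, ?_⟩
  filter_upwards [hae] with x hx I
  exact ⟨fun h => (hx I).memTWeakLp h, fun h => by subst h; exact (hx I).memTWeakLinfty hj1⟩
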